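/- (Approximate smooth linearization of a family of circle diffeomorphisms.) Let F : (−1,1) × ℝ → ℝ be C^∞ with F(ε, x+1) = F(ε,x) + 1 and ∂F/∂x(ε,x) > 0 for all (ε,x), so that each F(ε,·) is a lift of a smooth orientation-preserving circle diffeomorphism. Suppose the rotation number ρ = lim_{n→∞} F(0,·)ⁿ(0)/n of F(0,·) is Diophantine. Then there exist ε₀ ∈ (0,1), a C^∞ map Φ : (−ε₀,ε₀) × ℝ → ℝ with Φ(ε,x+1) = Φ(ε,x) + 1 and ∂Φ/∂x(ε,x) > 0, and a C^∞ function α : (−ε₀,ε₀) → ℝ with α(0) = ρ, such that the functions r(ε,x) := Φ(ε,·)^{−1}(F(ε, Φ(ε,x))) − x − α(ε) are 1-periodic in x and satisfy: for every n, k ∈ ℕ there is a constant C with sup_{x∈ℝ} |∂ₓᵏ r(ε,x)| ≤ C·|ε|ⁿ for all |ε| < ε₀. -/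

import Mathlib

open Set Filter

/-- A real number `r` is Diophantine with constants `c, β > 0` if
`|r − p/q| ≥ c/q^(2+β)` for all `p ∈ ℤ` and all integers `q ≥ 1`. -/
def DiophantineWith (c β r : ℝ) : Prop :=
  ∀ (p : ℤ) (q : ℕ), 1 ≤ q → c / (q : ℝ) ^ (2 + β) ≤ |r - (p : ℝ) / (q : ℝ)|

/-- `r` is Diophantine if it is Diophantine with some constants `c, β > 0`. -/
def Diophantine (r : ℝ) : Prop :=
  ∃ c > (0 : ℝ), ∃ β > (0 : ℝ), DiophantineWith c β r

/-- Best approximation property of two consecutive convergents. -/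
theorem best_approx_of_det {ρ : ℝ} {q q' : ℕ} {p p' : ℤ} (hq' : 1 ≤ q')
    (hdet : |(q' : ℤ) * p - q * p'| = 1)
    (hsign : (q * ρ - p) * (q' * ρ - p') < 0)
    {d : ℕ} {k : ℤ} (hd : d < q') (hk : |d * ρ - k| < |q * ρ - p|) : d = 0 ∧ k = 0 := by
  set D : ℤ := (q' : ℤ) * p - q * p' with hD
  have hDD : D * D = 1 := by
    have := abs_mul_abs_self D
    rw [hdet] at this; linarith
  obtain ⟨u, hu⟩ : ∃ u : ℤ, u = D * (q' * k - d * p') := ⟨_, rfl⟩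
  obtain ⟨v, hv⟩ : ∃ v : ℤ, v = D * (d * p - q * k) := ⟨_, rfl⟩
  have h1 : (d : ℤ) = u * q + v * q' := by
    have : (d : ℤ) = D * D * d := by rw [hDD, one_mul]
    rw [this, hu, hv, hD]; ring
  have h2 : k = u * p + v * p' := by
    have : k = D * D * k := by rw [hDD, one_mul]
    rw [this, hu, hv, hD]; ring
  have h3 : (d : ℝ) * ρ - k = u * (q * ρ - p) + v * (q' * ρ - p') := by
    have h1' : (d : ℝ) = u * q + v * q' := by exact_mod_cast h1
    have h2' : (k : ℝ) = u * p + v * p' := by exact_mod_cast h2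
    rw [h1', h2']; ring
  set δ := (q : ℝ) * ρ - p with hδ
  set δ' := (q' : ℝ) * ρ - p' with hδ'
  have key : u = 0 → v = 0 → d = 0 ∧ k = 0 := by
    intro hu hv
    subst hu hv
    simp at h1 h2
    exact ⟨h1, h2⟩
  have hdq : (d : ℤ) < q' := by exact_mod_cast hd
  have hd0 : (0 : ℤ) ≤ d := by positivity
  have hq0 : (0 : ℤ) ≤ q := by positivity
  have hq1 : (1 : ℤ) ≤ q' := by exact_mod_cast hq'
  rw [h3] at hk
  have same : ∀ a b : ℝ, 0 ≤ a * b → |a| ≤ |a + b| := by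
    intro a b hab
    apply sq_le_sq.1
    nlinarith [sq_nonneg b]
  by_cases hu0 : u = 0
  · have : v = 0 := by
      rw [hu0] at h1
      by_contra hv0
      rcases lt_or_gt_of_ne hv0 with h | h <;> nlinarith
    exact key hu0 this
  · exfalso
    have hu1 : (1 : ℝ) ≤ |(u : ℝ)| := by
      have := Int.one_le_abs hu0
      exact_mod_cast this
    have hle : |δ| ≤ |u * δ| := by
      rw [abs_mul]; nlinarith [abs_nonneg δ]
    by_cases huv : u * v ≤ 0
    · have huv' : (u : ℝ) * v ≤ 0 := by exact_mod_cast huv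
      have := same (u * δ) (v * δ') (by
        have : (u : ℝ) * δ * (v * δ') = (u * v) * (δ * δ') := by ring
        rw [this]; exact mul_nonneg_of_nonpos_of_nonpos huv' hsign.le)
      linarith
    · push Not at huv
      rcases lt_or_gt_of_ne hu0 with h | h
      · have : v < 0 := by
          by_contra hc; push Not at hc; nlinarith
        nlinarith
      · have : 0 < v := by
          by_contra hc; push Not at hc; nlinarith
        nlinarith

/-- Numerators, denominators and basic estimates for the continued fraction convergents of `ρ`. -/
structure Convergents (ρ : ℝ) (q : ℕ → ℕ) (p : ℕ → ℤ) : Prop where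
  q_pos : ∀ n, 1 ≤ q n
  q_le : ∀ n, q n ≤ q (n + 1)
  two_q_le : ∀ n, 2 * q n ≤ q (n + 2)
  sign : ∀ n, 0 < (-1) ^ n * (q n * ρ - p n)
  lt : ∀ n, |q (n + 1) * ρ - p (n + 1)| < |q n * ρ - p n|
  two_mul_le : ∀ n, 2 * |q (n + 2) * ρ - p (n + 2)| ≤ |q n * ρ - p n|
  best : ∀ n (d : ℕ) (k : ℤ), d < q (n + 1) → |d * ρ - k| < |q n * ρ - p n| → d = 0 ∧ k = 0
  mul_le : ∀ n, q (n + 1) * |q n * ρ - p n| ≤ 1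
  le_mul : ∀ n, 1 ≤ 2 * (q (n + 1) * |q n * ρ - p n|)

/-- One step of the continued fraction algorithm. -/
noncomputable def cfStep (ρ : ℝ) (s : (ℕ × ℤ) × (ℕ × ℤ)) : (ℕ × ℤ) × (ℕ × ℤ) :=
  (s.2, (⌊|s.1.1 * ρ - s.1.2| / |s.2.1 * ρ - s.2.2|⌋₊ * s.2.1 + s.1.1,
    ⌊|s.1.1 * ρ - s.1.2| / |s.2.1 * ρ - s.2.2|⌋₊ * s.2.2 + s.1.2))

/-- Invariant of the continued fraction algorithm. -/
structure CFInv (ρ : ℝ) (e : ℤ) (s : (ℕ × ℤ) × (ℕ × ℤ)) : Prop where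
  q_pos : 1 ≤ s.2.1
  sign_fst : e * (s.1.1 * ρ - s.1.2) < 0
  sign_snd : 0 < e * (s.2.1 * ρ - s.2.2)
  lt : |s.2.1 * ρ - s.2.2| < |s.1.1 * ρ - s.1.2|
  det : (s.2.1 : ℤ) * s.1.2 - s.1.1 * s.2.2 = e

theorem CFInv.step {ρ : ℝ} (hρ : Irrational ρ) {e : ℤ} (he : e = 1 ∨ e = -1)
    {s : (ℕ × ℤ) × (ℕ × ℤ)} (h : CFInv ρ e s) :
    CFInv ρ (-e) (cfStep ρ s) ∧ s.1.1 + s.2.1 ≤ (cfStep ρ s).2.1 ∧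
    |(cfStep ρ s).2.1 * ρ - (cfStep ρ s).2.2| + |s.2.1 * ρ - s.2.2| ≤ |s.1.1 * ρ - s.1.2| := by
  obtain ⟨⟨q, p⟩, ⟨q', p'⟩⟩ := s
  obtain ⟨h1, h2, h3, h4, h5⟩ := h
  simp only at h1 h2 h3 h4 h5
  simp only [cfStep]
  set a := ⌊|(q : ℝ) * ρ - p| / |q' * ρ - p'|⌋₊ with ha
  set δ := (q : ℝ) * ρ - p with hδ
  set δ' := (q' : ℝ) * ρ - p' with hδ'
  have hδ'0 : δ' ≠ 0 := by rintro h0; rw [h0] at h3; simp at h3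
  have hpos : 0 < |δ'| := abs_pos.2 hδ'0
  have ha1 : 1 ≤ a := by
    apply Nat.le_floor
    rw [Nat.cast_one, le_div_iff₀ hpos]; linarith
  have ha2 : (a : ℝ) * |δ'| ≤ |δ| := by
    rw [← le_div_iff₀ hpos]; exact Nat.floor_le (by positivity)
  have ha3 : |δ| < (a + 1) * |δ'| := by
    rw [← div_lt_iff₀ hpos]; exact Nat.lt_floor_add_one _
  have hq'' : 1 ≤ a * q' + q := by nlinarith
  have hδ'' : (((a * q' + q : ℕ) : ℝ)) * ρ - ((a * p' + p : ℤ) : ℝ) = a * δ' + δ := by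
    push_cast; rw [hδ, hδ']; ring
  have hne : (a : ℝ) * δ' + δ ≠ 0 := by
    rw [← hδ'']
    have := (hρ.natCast_mul (m := a * q' + q) (by omega)).sub_intCast (a * p' + p)
    exact this.ne_zero
  have hlt : (a : ℝ) * |δ'| < |δ| := by
    refine lt_of_le_of_ne ha2 fun hc => hne ?_
    rcases he with rfl | rfl
    · simp at h2 h3
      rw [abs_of_pos h3, abs_of_neg h2] at hc; linarith
    · simp at h2 h3
      rw [abs_of_neg (by linarith), abs_of_pos (by linarith)] at hc; linarith
  have habs : |(a : ℝ) * δ' + δ| = |δ| - a * |δ'| := by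
    rcases he with rfl | rfl
    · simp at h2 h3
      rw [abs_of_pos h3, abs_of_neg h2] at *
      rw [abs_of_neg] <;> linarith
    · simp at h2 h3
      rw [abs_of_neg (show δ' < 0 by linarith), abs_of_pos (show 0 < δ by linarith)] at *
      rw [abs_of_pos] <;> linarith
  have ha1' : (1 : ℝ) ≤ a := by exact_mod_cast ha1
  refine ⟨⟨hq'', ?_, ?_, ?_, ?_⟩, ?_, ?_⟩
  · simp only; push_cast; linarith
  · simp only; rw [hδ'']
    rcases he with rfl | rfl
    · simp at h2 h3
      rw [abs_of_pos h3, abs_of_neg h2] at hlt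
      push_cast; linarith
    · simp at h2 h3
      rw [abs_of_neg (show δ' < 0 by linarith), abs_of_pos (show 0 < δ by linarith)] at hlt
      push_cast; linarith
  · simp only; rw [hδ'', habs]; linarith
  · simp only; push_cast; linarith
  · nlinarith
  · rw [hδ'', habs]; nlinarith

theorem CFInv.det_abs {ρ : ℝ} {e : ℤ} (he : e = 1 ∨ e = -1)
    {s : (ℕ × ℤ) × (ℕ × ℤ)} (h : CFInv ρ e s) :
    (s.2.1 : ℝ) * |s.1.1 * ρ - s.1.2| + s.1.1 * |s.2.1 * ρ - s.2.2| = 1 := by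
  obtain ⟨⟨q, p⟩, ⟨q', p'⟩⟩ := s
  obtain ⟨h1, h2, h3, h4, h5⟩ := h
  simp only at h1 h2 h3 h4 h5 ⊢
  have h5' : (q' : ℝ) * p - q * p' = e := by exact_mod_cast h5
  rcases he with rfl | rfl
  · push_cast at h2 h3 h5'
    rw [abs_of_neg (by linarith), abs_of_pos (by linarith)]; linarith
  · push_cast at h2 h3 h5'
    rw [abs_of_pos (by linarith), abs_of_neg (by linarith)]; linarith

theorem exists_convergents {ρ : ℝ} (hρ : Irrational ρ) : ∃ q p, Convergents ρ q p := by
  let S : ℕ → (ℕ × ℤ) × (ℕ × ℤ) := fun n => (cfStep ρ)^[n] ((0, 1), (1, ⌊ρ⌋))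
  have hS : ∀ n, S (n + 1) = cfStep ρ (S n) := fun n => Function.iterate_succ_apply' _ _ _
  have he : ∀ n : ℕ, ((-1 : ℤ) ^ n = 1 ∨ (-1 : ℤ) ^ n = -1) := fun n => neg_one_pow_eq_or ℤ n
  have hinv : ∀ n, CFInv ρ ((-1) ^ n) (S n) := by
    intro n
    induction n with
    | zero =>
      have h1 := Int.floor_le ρ
      have h2 := Int.lt_floor_add_one ρ
      have h3 : (⌊ρ⌋ : ℝ) ≠ ρ := fun h => hρ ⟨(⌊ρ⌋ : ℚ), by simpa using h⟩
      have h4 : (⌊ρ⌋ : ℝ) < ρ := lt_of_le_of_ne h1 h3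
      constructor <;> simp [S, -Int.self_sub_floor] <;> try linarith
      rw [abs_of_pos (by linarith)]; linarith
    | succ n ih =>
      rw [hS, pow_succ, mul_neg_one]
      exact (ih.step hρ (he n)).1
  have hstep := fun n => (hinv n).step hρ (he n)
  have hsnd : ∀ n, (S (n + 1)).1 = (S n).2 := fun n => by rw [hS]; rfl
  refine ⟨fun n => (S n).2.1, fun n => (S n).2.2, ?_⟩
  have hqadd : ∀ n, (S n).2.1 + (S (n + 1)).2.1 ≤ (S (n + 2)).2.1 := by
    intro n
    have := (hstep (n + 1)).2.1
    rwa [← hS, hsnd] at this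
  have hle : ∀ n, (S n).2.1 ≤ (S (n + 1)).2.1 := by
    intro n
    have := (hstep n).2.1
    rw [← hS] at this; omega
  have hlt : ∀ n, |((S (n + 1)).2.1 : ℝ) * ρ - (S (n + 1)).2.2|
      < |((S n).2.1 : ℝ) * ρ - (S n).2.2| := by
    intro n
    have := (hinv (n + 1)).lt
    rwa [hsnd] at this
  have hdet : ∀ n, ((S (n + 1)).2.1 : ℝ) * |((S n).2.1 : ℝ) * ρ - (S n).2.2|
      + (S n).2.1 * |((S (n + 1)).2.1 : ℝ) * ρ - (S (n + 1)).2.2| = 1 := by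
    intro n
    have := (hinv (n + 1)).det_abs (he _)
    rwa [hsnd] at this
  constructor
  · exact fun n => (hinv n).q_pos
  · exact hle
  · intro n
    have := hqadd n
    have := hle n
    omega
  · intro n
    have := (hinv n).sign_snd
    push_cast at this
    exact this
  · exact hlt
  · intro n
    have h1 := (hstep (n + 1)).2.2
    rw [← hS, hsnd] at h1
    have := hlt (n + 1)
    linarith
  · intro n d k hd hk
    have h := hinv (n + 1)
    have h1 := h.det
    have h2 := h.sign_fst
    have h3 := h.sign_snd
    rw [hsnd] at h1 h2
    refine best_approx_of_det (q := (S n).2.1) (p := (S n).2.2)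
      (p' := (S (n + 1)).2.2) (hinv (n + 1)).q_pos ?_ ?_ hd hk
    · rw [h1]; rcases he (n + 1) with h | h <;> rw [h] <;> rfl
    · rcases he (n + 1) with h | h <;> rw [h] at h2 h3 <;> push_cast at h2 h3 <;> nlinarith
  · intro n
    have := hdet n
    have h0 : (0 : ℝ) ≤ (S n).2.1 * |((S (n + 1)).2.1 : ℝ) * ρ - (S (n + 1)).2.2| := by positivity
    linarith
  · intro n
    have := hdet n
    have h0 : ((S n).2.1 : ℝ) ≤ (S (n + 1)).2.1 := by exact_mod_cast hle n
    have h1 := hlt n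
    have h2 : ((S n).2.1 : ℝ) * |((S (n + 1)).2.1 : ℝ) * ρ - (S (n + 1)).2.2| ≤
      ((S (n + 1)).2.1 : ℝ) * |((S n).2.1 : ℝ) * ρ - (S n).2.2| :=
      mul_le_mul h0 h1.le (abs_nonneg _) (by positivity)
    linarith

/-- Smooth lifts of orientation-preserving circle diffeomorphisms. -/
structure SmoothLift (f : ℝ → ℝ) : Prop where
  contDiff : ContDiff ℝ (⊤ : ℕ∞) f
  map_add_one : ∀ x, f (x + 1) = f x + 1
  deriv_pos : ∀ x, 0 < deriv f x

namespace SmoothLift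

variable {f g : ℝ → ℝ}

theorem differentiable (hf : SmoothLift f) : Differentiable ℝ f :=
  hf.contDiff.differentiable (by simp)

theorem continuous (hf : SmoothLift f) : Continuous f := hf.contDiff.continuous

theorem strictMono (hf : SmoothLift f) : StrictMono f := strictMono_of_deriv_pos hf.deriv_pos

theorem id : SmoothLift (fun x : ℝ => x) :=
  ⟨contDiff_id, fun _ => rfl, fun x => by simp⟩

theorem comp (hf : SmoothLift f) (hg : SmoothLift g) : SmoothLift (fun x => f (g x)) := by
  refine ⟨hf.contDiff.comp hg.contDiff, fun x => by rw [hg.map_add_one, hf.map_add_one], ?_⟩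
  intro x
  have := ((hf.differentiable (g x)).hasDerivAt.comp x (hg.differentiable x).hasDerivAt).deriv
  simp only [Function.comp_def] at this
  rw [this]
  exact mul_pos (hf.deriv_pos _) (hg.deriv_pos _)

theorem iterate (hf : SmoothLift f) (n : ℕ) : SmoothLift (f^[n]) := by
  induction n with
  | zero => exact SmoothLift.id
  | succ n ih =>
    have := hf.comp ih
    have h : f^[n + 1] = fun x => f (f^[n] x) := by
      ext x; rw [Function.iterate_succ_apply']
    rwa [h]

theorem reflect (hf : SmoothLift f) : SmoothLift (fun x => -f (-x)) := by
  refine ⟨(hf.contDiff.comp contDiff_neg).neg, fun x => ?_, fun x => ?_⟩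
  · have := hf.map_add_one (-(x + 1))
    rw [show -(x + 1) + 1 = -x by ring] at this
    linarith
  · have h1 : HasDerivAt f (deriv f (-x)) (-x) := (hf.differentiable _).hasDerivAt
    have h2 := (h1.comp x (hasDerivAt_neg x)).neg
    have h3 : deriv (fun x => -f (-x)) x = deriv f (-x) := by
      have := h2.deriv
      simpa [Function.comp_def] using this
    rw [h3]; exact hf.deriv_pos _

/-- The associated bundled degree one lift. -/
def toLift (hf : SmoothLift f) : CircleDeg1Lift where
  toFun := f
  monotone' := hf.strictMono.monotone
  map_add_one' := hf.map_add_one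

@[simp] theorem coe_toLift (hf : SmoothLift f) : ⇑hf.toLift = f := rfl

theorem coe_toLift_pow (hf : SmoothLift f) (n : ℕ) : ⇑(hf.toLift ^ n) = f^[n] := by
  rw [CircleDeg1Lift.coe_pow, coe_toLift]

theorem map_add_int (hf : SmoothLift f) (x : ℝ) (k : ℤ) : f (x + k) = f x + k :=
  hf.toLift.map_add_int x k

theorem map_sub_int (hf : SmoothLift f) (x : ℝ) (k : ℤ) : f (x - k) = f x - k :=
  hf.toLift.map_sub_int x k

theorem deriv_add_one (hf : SmoothLift f) (x : ℝ) : deriv f (x + 1) = deriv f x := by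
  rw [← deriv_comp_add_const f 1 x]
  have : (fun x => f (x + 1)) = fun x => f x + 1 := funext hf.map_add_one
  rw [this, deriv_add_const]

end SmoothLift

/-- A smooth lift with irrational rotation number `ρ`. -/
structure RotLift (f : ℝ → ℝ) (ρ : ℝ) : Prop extends SmoothLift f where
  tendsto : Tendsto (fun n : ℕ => f^[n] 0 / n) atTop (nhds ρ)
  irrational : Irrational ρ

namespace RotLift

variable {f : ℝ → ℝ} {ρ : ℝ}

theorem translationNumber (hf : RotLift f ρ) : hf.toSmoothLift.toLift.translationNumber = ρ := by
  apply CircleDeg1Lift.translationNumber_eq_of_tendsto₀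
  exact hf.tendsto

theorem reflect (hf : RotLift f ρ) : RotLift (fun x => -f (-x)) (-ρ) := by
  refine ⟨hf.toSmoothLift.reflect, ?_, hf.irrational.neg⟩
  have h : ∀ n : ℕ, (fun x => -f (-x))^[n] 0 = -(f^[n] 0) := by
    intro n
    induction n with
    | zero => simp
    | succ n ih => rw [Function.iterate_succ_apply', ih, Function.iterate_succ_apply']; simp
  simp only [h, neg_div]
  exact hf.tendsto.neg

theorem lt_iterate (hf : RotLift f ρ) {d : ℕ} {k : ℤ} (h : (k : ℝ) < d * ρ) (y : ℝ) :
    y + k < f^[d] y := by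
  have := CircleDeg1Lift.lt_map_of_int_lt_translationNumber (hf.toSmoothLift.toLift ^ d)
    (n := k) (by rw [CircleDeg1Lift.translationNumber_pow, hf.translationNumber]; exact h) y
  rwa [hf.toSmoothLift.coe_toLift_pow] at this

theorem iterate_lt (hf : RotLift f ρ) {d : ℕ} {k : ℤ} (h : d * ρ < (k : ℝ)) (y : ℝ) :
    f^[d] y < y + k := by
  have := CircleDeg1Lift.map_lt_of_translationNumber_lt_int (hf.toSmoothLift.toLift ^ d)
    (n := k) (by rw [CircleDeg1Lift.translationNumber_pow, hf.translationNumber]; exact h) y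
  rwa [hf.toSmoothLift.coe_toLift_pow] at this

/-- Orbits are ordered as for the rotation by `ρ`. -/
theorem lt_of_lt (hf : RotLift f ρ) {a b : ℕ} {k k' : ℤ} (h : a * ρ + k < b * ρ + k') (y : ℝ) :
    f^[a] y + k < f^[b] y + k' := by
  rcases le_total a b with hab | hab
  · obtain ⟨d, rfl⟩ := Nat.exists_eq_add_of_le' hab
    have := hf.lt_iterate (d := d) (k := k - k') (by push_cast at h ⊢; linarith) (f^[a] y)
    rw [← Function.iterate_add_apply] at this
    push_cast at this; linarith
  · obtain ⟨d, rfl⟩ := Nat.exists_eq_add_of_le' hab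
    have := hf.iterate_lt (d := d) (k := k' - k) (by push_cast at h ⊢; linarith) (f^[b] y)
    rw [← Function.iterate_add_apply] at this
    push_cast at this; linarith

theorem lt_iff (hf : RotLift f ρ) {a b : ℕ} {k k' : ℤ} (y : ℝ) :
    f^[a] y + k < f^[b] y + k' ↔ a * ρ + k < b * ρ + k' := by
  refine ⟨fun h => ?_, fun h => hf.lt_of_lt h y⟩
  rcases lt_trichotomy (a * ρ + (k : ℝ)) (b * ρ + k') with h1 | h1 | h1
  · exact h1
  · exfalso
    have h2 : ((a : ℤ) - (b : ℤ) : ℤ) * ρ = ((k' - k : ℤ) : ℝ) := by push_cast; linarith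
    by_cases hab : (a : ℤ) - b = 0
    · have : a = b := by omega
      subst this
      have : k = k' := by
        have : (k : ℝ) = k' := by linarith
        exact_mod_cast this
      subst this
      exact lt_irrefl _ h
    · exact (hf.irrational.intCast_mul hab).ne_int _ h2
  · exact absurd (hf.lt_of_lt h1 y) (not_lt.2 h.le)

end RotLift

/-- The Birkhoff sum `log (deriv f^[l])`. -/
noncomputable def logD (f : ℝ → ℝ) (l : ℕ) (x : ℝ) : ℝ := Real.log (deriv f^[l] x)

namespace SmoothLift
variable {f : ℝ → ℝ}

theorem exp_logD (hf : SmoothLift f) (l : ℕ) (x : ℝ) : Real.exp (logD f l x) = deriv f^[l] x :=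
  Real.exp_log ((hf.iterate l).deriv_pos x)

theorem deriv_iterate_add (hf : SmoothLift f) (a b : ℕ) (x : ℝ) :
    deriv f^[a + b] x = deriv f^[a] (f^[b] x) * deriv f^[b] x := by
  rw [Function.iterate_add]
  exact deriv_comp x ((hf.iterate a).differentiable _) ((hf.iterate b).differentiable _)

theorem logD_add (hf : SmoothLift f) (a b : ℕ) (x : ℝ) :
    logD f (a + b) x = logD f a (f^[b] x) + logD f b x := by
  rw [logD, hf.deriv_iterate_add,
    Real.log_mul ((hf.iterate a).deriv_pos _).ne' ((hf.iterate b).deriv_pos _).ne', logD, logD]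

theorem logD_eq_sum (hf : SmoothLift f) (l : ℕ) (x : ℝ) :
    logD f l x = ∑ i ∈ Finset.range l, logD f 1 (f^[i] x) := by
  induction l with
  | zero => simp [logD]
  | succ l ih => rw [Finset.sum_range_succ, ← ih, add_comm l 1, hf.logD_add, add_comm]

theorem contDiff_deriv (hf : SmoothLift f) : ContDiff ℝ (⊤ : ℕ∞) (deriv f) :=
  (contDiff_infty_iff_deriv.1 hf.contDiff).2

theorem contDiff_logD (hf : SmoothLift f) (l : ℕ) : ContDiff ℝ (⊤ : ℕ∞) (logD f l) :=
  (hf.iterate l).contDiff_deriv.log fun x => ((hf.iterate l).deriv_pos x).ne'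

theorem logD_add_one (hf : SmoothLift f) (l : ℕ) (x : ℝ) : logD f l (x + 1) = logD f l x := by
  rw [logD, logD, (hf.iterate l).deriv_add_one]

end SmoothLift

/-- A continuous 1-periodic function is bounded. -/
theorem exists_bound_of_periodic {u : ℝ → ℝ} (hu : Continuous u) (hp : ∀ x, u (x + 1) = u x) :
    ∃ C, 0 < C ∧ ∀ x, |u x| ≤ C := by
  obtain ⟨C, hC⟩ := (isCompact_Icc (a := (0 : ℝ)) (b := 1)).exists_bound_of_continuousOn
    hu.continuousOn
  refine ⟨|C| + 1, by positivity, fun x => ?_⟩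
  have h1 : u x = u (Int.fract x) := by
    have := (show Function.Periodic u 1 from hp).sub_int_mul_eq (x := x) ⌊x⌋
    rw [mul_one] at this
    exact this.symm
  rw [h1]
  have := hC (Int.fract x) ⟨Int.fract_nonneg x, (Int.fract_lt_one x).le⟩
  rw [Real.norm_eq_abs] at this
  have := le_abs_self C
  linarith

theorem iteratedDeriv_add_one {u : ℝ → ℝ} (hp : ∀ x, u (x + 1) = u x) (j : ℕ) (x : ℝ) :
    iteratedDeriv j u (x + 1) = iteratedDeriv j u x := by
  have := iteratedDeriv_comp_add_const j u 1
  have h2 : (fun z => u (z + 1)) = u := funext hp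
  rw [h2] at this
  exact (congrFun this x).symm

theorem contDiff_iteratedDeriv_infty {u : ℝ → ℝ} (hu : ContDiff ℝ (⊤ : ℕ∞) u) (j : ℕ) :
    ContDiff ℝ (⊤ : ℕ∞) (iteratedDeriv j u) := by
  induction j with
  | zero => simpa using hu
  | succ j ih => rw [iteratedDeriv_succ]; exact (contDiff_infty_iff_deriv.1 ih).2

theorem exists_bound_iteratedDeriv {u : ℝ → ℝ} (hu : ContDiff ℝ (⊤ : ℕ∞) u)
    (hp : ∀ x, u (x + 1) = u x) (j : ℕ) : ∃ C, 0 < C ∧ ∀ x, |iteratedDeriv j u x| ≤ C :=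
  exists_bound_of_periodic (contDiff_iteratedDeriv_infty hu j).continuous
    (iteratedDeriv_add_one hp j)

section meanValue

variable {u u' u'' : ℝ → ℝ} {x y B : ℝ}

theorem exists_eq_mul_sub (hxy : x ≤ y) (h : ∀ t, HasDerivAt u (u' t) t) :
    ∃ ξ ∈ Icc x y, u y - u x = u' ξ * (y - x) := by
  rcases hxy.eq_or_lt with rfl | hlt
  · exact ⟨x, ⟨le_rfl, le_rfl⟩, by simp⟩
  · obtain ⟨ξ, hξ, h1⟩ := exists_hasDerivAt_eq_slope u u' hlt
      (fun t _ => (h t).continuousAt.continuousWithinAt) (fun t _ => h t)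
    refine ⟨ξ, Ioo_subset_Icc_self hξ, ?_⟩
    rw [h1, div_mul_cancel₀]; linarith

theorem abs_sub_le_of_deriv_bound (hxy : x ≤ y) (h : ∀ t, HasDerivAt u (u' t) t)
    (hB : ∀ t ∈ Icc x y, |u' t| ≤ B) : |u y - u x| ≤ B * (y - x) := by
  obtain ⟨ξ, hξ, h1⟩ := exists_eq_mul_sub hxy h
  rw [h1, abs_mul, abs_of_nonneg (sub_nonneg.2 hxy)]
  exact mul_le_mul_of_nonneg_right (hB ξ hξ) (sub_nonneg.2 hxy)

/-- Second order Taylor estimate at the left endpoint. -/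
theorem abs_sub_sub_le_left (hxy : x ≤ y) (h : ∀ t, HasDerivAt u (u' t) t)
    (h' : ∀ t, HasDerivAt u' (u'' t) t) (hB : ∀ t ∈ Icc x y, |u'' t| ≤ B) :
    |u y - u x - (y - x) * u' x| ≤ B * (y - x) ^ 2 := by
  obtain ⟨ξ, hξ, h1⟩ := exists_eq_mul_sub hxy h
  have h2 := abs_sub_le_of_deriv_bound hξ.1 h' (fun t ht => hB t ⟨ht.1, ht.2.trans hξ.2⟩)
  have hB0 : 0 ≤ B := (abs_nonneg _).trans (hB x ⟨le_rfl, hxy⟩)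
  rw [h1, show u' ξ * (y - x) - (y - x) * u' x = (u' ξ - u' x) * (y - x) by ring, abs_mul,
    abs_of_nonneg (sub_nonneg.2 hxy), sq, ← mul_assoc]
  refine mul_le_mul_of_nonneg_right (h2.trans ?_) (sub_nonneg.2 hxy)
  exact mul_le_mul_of_nonneg_left (by linarith [hξ.2]) hB0

/-- Second order Taylor estimate at the right endpoint. -/
theorem abs_sub_sub_le_right (hxy : x ≤ y) (h : ∀ t, HasDerivAt u (u' t) t)
    (h' : ∀ t, HasDerivAt u' (u'' t) t) (hB : ∀ t ∈ Icc x y, |u'' t| ≤ B) :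
    |u y - u x - (y - x) * u' y| ≤ B * (y - x) ^ 2 := by
  obtain ⟨ξ, hξ, h1⟩ := exists_eq_mul_sub hxy h
  have h2 := abs_sub_le_of_deriv_bound hξ.2 h' (fun t ht => hB t ⟨hξ.1.trans ht.1, ht.2⟩)
  have hB0 : 0 ≤ B := (abs_nonneg _).trans (hB x ⟨le_rfl, hxy⟩)
  rw [h1, show u' ξ * (y - x) - (y - x) * u' y = -((u' y - u' ξ) * (y - x)) by ring, abs_neg,
    abs_mul, abs_of_nonneg (sub_nonneg.2 hxy), sq, ← mul_assoc]
  refine mul_le_mul_of_nonneg_right (h2.trans ?_) (sub_nonneg.2 hxy)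
  exact mul_le_mul_of_nonneg_left (by linarith [hξ.1]) hB0

end meanValue

/-- The nonlinearity, that is the derivative of the logarithm of the derivative of `f^[l]`. -/
noncomputable def nonlin (f : ℝ → ℝ) (l : ℕ) : ℝ → ℝ := deriv (logD f l)

/-- The Schwarzian derivative of `f^[l]`. -/
noncomputable def schw (f : ℝ → ℝ) (l : ℕ) (x : ℝ) : ℝ :=
  deriv (nonlin f l) x - nonlin f l x ^ 2 / 2

namespace SmoothLift
variable {f : ℝ → ℝ}

theorem contDiff_nonlin (hf : SmoothLift f) (l : ℕ) : ContDiff ℝ (⊤ : ℕ∞) (nonlin f l) :=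
  (contDiff_infty_iff_deriv.1 (hf.contDiff_logD l)).2

theorem hasDerivAt_iterate (hf : SmoothLift f) (l : ℕ) (x : ℝ) :
    HasDerivAt f^[l] (deriv f^[l] x) x := ((hf.iterate l).differentiable x).hasDerivAt

theorem hasDerivAt_logD (hf : SmoothLift f) (l : ℕ) (x : ℝ) :
    HasDerivAt (logD f l) (nonlin f l x) x :=
  ((hf.contDiff_logD l).differentiable (by simp) x).hasDerivAt

theorem hasDerivAt_nonlin (hf : SmoothLift f) (l : ℕ) (x : ℝ) :
    HasDerivAt (nonlin f l) (schw f l x + nonlin f l x ^ 2 / 2) x := by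
  have := ((hf.contDiff_nonlin l).differentiable (by simp) x).hasDerivAt
  rwa [schw, sub_add_cancel]

theorem hasDerivAt_deriv_iterate (hf : SmoothLift f) (l : ℕ) (x : ℝ) :
    HasDerivAt (deriv f^[l]) (nonlin f l x * deriv f^[l] x) x := by
  have := (hf.hasDerivAt_logD l x).exp
  simp only [hf.exp_logD] at this
  rwa [mul_comm]

theorem nonlin_succ (hf : SmoothLift f) (l : ℕ) (x : ℝ) :
    nonlin f (l + 1) x = nonlin f 1 (f^[l] x) * deriv f^[l] x + nonlin f l x := by
  have h1 : logD f (l + 1) = fun x => logD f 1 (f^[l] x) + logD f l x := by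
    ext x; rw [add_comm l 1, hf.logD_add]
  have h2 := ((hf.hasDerivAt_logD 1 (f^[l] x)).comp x (hf.hasDerivAt_iterate l x)).add
    (hf.hasDerivAt_logD l x)
  rw [nonlin, h1]
  exact h2.deriv

theorem nonlin_eq_sum (hf : SmoothLift f) (l : ℕ) (x : ℝ) :
    nonlin f l x = ∑ i ∈ Finset.range l, nonlin f 1 (f^[i] x) * deriv f^[i] x := by
  induction l with
  | zero =>
    have : logD f 0 = fun _ => 0 := by ext x; simp [logD]
    simp [nonlin, this]
  | succ l ih => rw [Finset.sum_range_succ, ← ih, hf.nonlin_succ, add_comm]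

theorem schw_succ (hf : SmoothLift f) (l : ℕ) (x : ℝ) :
    schw f (l + 1) x = schw f 1 (f^[l] x) * deriv f^[l] x ^ 2 + schw f l x := by
  have h1 : nonlin f (l + 1) = fun x => nonlin f 1 (f^[l] x) * deriv f^[l] x + nonlin f l x := by
    ext x; rw [hf.nonlin_succ]
  have h2 := (((hf.hasDerivAt_nonlin 1 (f^[l] x)).comp x (hf.hasDerivAt_iterate l x)).mul
    (hf.hasDerivAt_deriv_iterate l x)).add (hf.hasDerivAt_nonlin l x)
  have h3 := h2.deriv
  change deriv (fun x => nonlin f 1 (f^[l] x) * deriv f^[l] x + nonlin f l x) x = _ at h3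
  rw [schw, hf.nonlin_succ, h1, h3]
  simp only [Function.comp]
  ring

theorem schw_eq_sum (hf : SmoothLift f) (l : ℕ) (x : ℝ) :
    schw f l x = ∑ i ∈ Finset.range l, schw f 1 (f^[i] x) * deriv f^[i] x ^ 2 := by
  induction l with
  | zero =>
    have : logD f 0 = fun _ => 0 := by ext x; simp [logD]
    have : nonlin f 0 = fun _ => 0 := by simp [nonlin, this]
    simp [schw, this]
  | succ l ih => rw [Finset.sum_range_succ, ← ih, hf.schw_succ, add_comm]

theorem contDiff_schw (hf : SmoothLift f) (l : ℕ) : ContDiff ℝ (⊤ : ℕ∞) (schw f l) :=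
  (contDiff_infty_iff_deriv.1 (hf.contDiff_nonlin l)).2.sub
    (((hf.contDiff_nonlin l).pow 2).div_const 2)

theorem nonlin_add_one (hf : SmoothLift f) (l : ℕ) (x : ℝ) :
    nonlin f l (x + 1) = nonlin f l x := by
  have := iteratedDeriv_add_one (hf.logD_add_one l) 1 x
  simp only [iteratedDeriv_one] at this
  exact this

theorem schw_add_one (hf : SmoothLift f) (l : ℕ) (x : ℝ) : schw f l (x + 1) = schw f l x := by
  have := iteratedDeriv_add_one (hf.nonlin_add_one l) 1 x
  simp only [iteratedDeriv_one] at this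
  rw [schw, schw, this, hf.nonlin_add_one]

end SmoothLift

/-- The displacement of `f^[q] - p`. -/
def gap (f : ℝ → ℝ) (q : ℕ) (p : ℤ) (x : ℝ) : ℝ := f^[q] x - p - x

/-- Two consecutive convergents of the rotation number of `f`, the first one from below. -/
structure IsPair (f : ℝ → ℝ) (ρ : ℝ) (q : ℕ) (p : ℤ) (q' : ℕ) (p' : ℤ) : Prop
    extends RotLift f ρ where
  q_pos : 1 ≤ q
  q_le : q ≤ q'
  pos : 0 < q * ρ - p
  neg : q' * ρ - p' < 0
  lt : p' - q' * ρ < q * ρ - p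
  best : ∀ (d : ℕ) (k : ℤ), d < q' → |d * ρ - k| < q * ρ - p → d = 0 ∧ k = 0

namespace IsPair

variable {f : ℝ → ℝ} {ρ : ℝ} {q q' : ℕ} {p p' : ℤ}

theorem gap_pos (h : IsPair f ρ q p q' p') (x : ℝ) : 0 < gap f q p x := by
  have := h.toRotLift.lt_iterate (d := q) (k := p) (by linarith [h.pos]) x
  rw [gap]; linarith

theorem iterate_gap (h : IsPair f ρ q p q' p') (l : ℕ) (x : ℝ) :
    f^[l] (f^[q] x - p) = f^[q] (f^[l] x) - p := by
  rw [(h.iterate l).map_sub_int, ← Function.iterate_add_apply, add_comm,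
    Function.iterate_add_apply]

theorem gap_iterate (h : IsPair f ρ q p q' p') (l : ℕ) (x : ℝ) :
    gap f q p (f^[l] x) = f^[l] (f^[q] x - p) - f^[l] x := by
  rw [gap, h.iterate_gap]

theorem eq_of_inter (h : IsPair f ρ q p q' p') {x z : ℝ} {l l' : ℕ} {k : ℤ} (hl : l < q')
    (hl' : l' < q') (h1 : z ∈ Ioo (f^[l] x) (f^[l] (f^[q] x - p)))
    (h2 : z - k ∈ Ioo (f^[l'] x) (f^[l'] (f^[q] x - p))) : l = l' ∧ k = 0 := by
  rw [(h.iterate l).map_sub_int, ← Function.iterate_add_apply] at h1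
  rw [(h.iterate l').map_sub_int, ← Function.iterate_add_apply] at h2
  have h3 : f^[l] x + (0 : ℤ) < f^[l' + q] x + ((k - p : ℤ) : ℝ) := by
    push_cast; linarith [h1.1, h2.2]
  have h4 : f^[l'] x + (k : ℝ) < f^[l + q] x + ((- p : ℤ) : ℝ) := by
    push_cast; linarith [h2.1, h1.2]
  rw [h.toRotLift.lt_iff] at h3 h4
  push_cast at h3 h4
  rcases le_total l l' with hll | hll
  · obtain ⟨d, rfl⟩ := Nat.exists_eq_add_of_le hll
    push_cast at h3 h4
    obtain ⟨hd, hk⟩ := h.best d (-k) (by omega) (by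
      rw [abs_lt]; push_cast; constructor <;> linarith)
    omega
  · obtain ⟨d, rfl⟩ := Nat.exists_eq_add_of_le hll
    push_cast at h3 h4
    obtain ⟨hd, hk⟩ := h.best d k (by omega) (by
      rw [abs_lt]; constructor <;> linarith)
    omega

theorem sum_gap_le (h : IsPair f ρ q p q' p') (x : ℝ) :
    ∑ l ∈ Finset.range q', gap f q p (f^[l] x) ≤ 1 := by
  classical
  set J : ℕ → Set ℝ := fun l => Ioo (f^[l] x) (f^[l] (f^[q] x - p)) with hJ
  set t : Set ℝ := ⋃ l ∈ Finset.range q', J l with ht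
  have hvol : MeasureTheory.volume t =
      ENNReal.ofReal (∑ l ∈ Finset.range q', gap f q p (f^[l] x)) := by
    rw [ht, MeasureTheory.measure_biUnion_finset]
    · rw [ENNReal.ofReal_sum_of_nonneg fun i _ => (h.gap_pos _).le]
      refine Finset.sum_congr rfl fun l _ => ?_
      rw [hJ, Real.volume_Ioo, h.gap_iterate]
    · intro l hl l' hl' hne
      refine Set.disjoint_left.2 fun z hz hz' => hne ?_
      simp only [Finset.coe_range, mem_Iio] at hl hl'
      exact (h.eq_of_inter (k := 0) hl hl' hz (by simpa [hJ] using hz')).1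
    · intro l _; exact measurableSet_Ioo
  by_contra hlt
  push Not at hlt
  have hdom := isAddFundamentalDomain_Ioc (T := (1 : ℝ)) one_pos 0
  have hm : MeasurableSet t := by
    rw [ht]; exact Finset.measurableSet_biUnion _ fun _ _ => measurableSet_Ioo
  obtain ⟨a, ha, b, hb, g, hg, hgab⟩ := hdom.exists_ne_zero_vadd_eq (t := t)
    hm.nullMeasurableSet (by
      rw [hvol, Real.volume_Ioc]
      exact (ENNReal.ofReal_lt_ofReal_iff (by linarith)).2 (by linarith))
  obtain ⟨g, k, rfl⟩ := g
  simp only [ht, mem_iUnion, Finset.mem_range] at ha hb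
  obtain ⟨l, hl, hal⟩ := ha
  obtain ⟨l', hl', hbl⟩ := hb
  have hab : b = a + k := by
    rw [← hgab]
    simp only [AddSubgroup.vadd_def, vadd_eq_add, zsmul_eq_mul, mul_one]
    ring
  have := h.eq_of_inter (k := -k) hl hl' hal (by
    rw [hab] at hbl; push_cast; rw [sub_neg_eq_add]; exact hbl)
  apply hg
  have hk : k = 0 := by omega
  subst hk
  ext; simp

theorem gap_le_one (h : IsPair f ρ q p q' p') (x : ℝ) : gap f q p x ≤ 1 := by
  have h1 := h.sum_gap_le x
  have h2 := Finset.single_le_sum (f := fun l => gap f q p (f^[l] x))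
    (fun i _ => (h.gap_pos _).le) (Finset.mem_range.2 (show 0 < q' from h.q_pos.trans h.q_le))
  simp only [Function.iterate_zero, id_eq] at h2
  linarith

/-- Every point is within two fundamental steps of the orbit of a given point. -/
theorem exists_near (h : IsPair f ρ q p q' p') (x y : ℝ) : ∃ l < q', ∃ k : ℤ,
    f^[l] x + k ≤ y ∧ y ≤ f^[q] (f^[q] (f^[l] x + k) - p) - p := by
  obtain ⟨l, hl, hmax⟩ := Finset.exists_max_image (Finset.range q')
    (fun l => f^[l] x + ⌊y - f^[l] x⌋) ⟨0, Finset.mem_range.2 (h.q_pos.trans h.q_le)⟩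
  rw [Finset.mem_range] at hl
  set k := ⌊y - f^[l] x⌋ with hk
  have hmax' : ∀ l' < q', ∀ k' : ℤ, f^[l'] x + k' ≤ y → f^[l'] x + k' ≤ f^[l] x + k := by
    intro l' hl' k' hk'
    refine le_trans ?_ (hmax l' (Finset.mem_range.2 hl'))
    have : k' ≤ ⌊y - f^[l'] x⌋ := Int.le_floor.2 (by linarith)
    have : (k' : ℝ) ≤ ⌊y - f^[l'] x⌋ := by exact_mod_cast this
    linarith
  refine ⟨l, hl, k, ?_, ?_⟩
  · have := Int.floor_le (y - f^[l] x)
    linarith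
  · have e1 : f^[q] (f^[l] x + k) - p = f^[l + q] x + ((k - p : ℤ) : ℝ) := by
      rw [(h.iterate q).map_add_int, ← Function.iterate_add_apply, add_comm q l]
      push_cast; ring
    have e2 : f^[q] (f^[q] (f^[l] x + k) - p) - p = f^[l + q + q] x + ((k - p - p : ℤ) : ℝ) := by
      rw [e1, (h.iterate q).map_add_int, ← Function.iterate_add_apply,
        show q + (l + q) = l + q + q by ring]
      push_cast; ring
    by_contra hy
    push Not at hy
    have hg1 := h.gap_pos (f^[q] (f^[l] x + k) - p)
    have hg0 := h.gap_pos (f^[l] x + k)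
    rw [gap] at hg1 hg0
    by_cases hlq : l + q < q'
    · have := hmax' (l + q) hlq (k - p) (by rw [← e1]; linarith)
      rw [← e1] at this
      linarith
    · obtain ⟨r, hr⟩ := Nat.exists_eq_add_of_le (not_lt.1 hlq)
      have hr' : r < q' := by have := h.q_le; have := h.q_pos; omega
      have hl' : (l : ℝ) + q = q' + r := by exact_mod_cast hr
      have c1 : f^[r] x + ((k - p + p' : ℤ) : ℝ) < f^[l + q + q] x + ((k - p - p : ℤ) : ℝ) := by
        rw [h.toRotLift.lt_iff]; push_cast
        have := h.lt
        have : (r : ℝ) * ρ = l * ρ + q * ρ - q' * ρ := by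
          rw [show (r : ℝ) = l + q - q' by linarith]; ring
        linarith
      have c2 : f^[l] x + (k : ℝ) < f^[r] x + ((k - p + p' : ℤ) : ℝ) := by
        rw [h.toRotLift.lt_iff]; push_cast
        have h1 := h.pos
        have h2 := h.neg
        have : (r : ℝ) * ρ = l * ρ + q * ρ - q' * ρ := by
          rw [show (r : ℝ) = l + q - q' by linarith]; ring
        linarith
      have := hmax' r hr' _ (by rw [← e2] at c1; linarith)
      linarith

end IsPair

theorem exists_forall_le_of_periodic {u : ℝ → ℝ} (hu : Continuous u)
    (hp : ∀ x, u (x + 1) = u x) : ∃ x₀, ∀ x, u x ≤ u x₀ := by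
  obtain ⟨x₀, -, hx₀⟩ := (isCompact_Icc (a := (0 : ℝ)) (b := 1)).exists_isMaxOn
    ⟨0, by simp⟩ hu.continuousOn
  refine ⟨x₀, fun x => ?_⟩
  have h1 : u x = u (Int.fract x) := by
    have := (show Function.Periodic u 1 from hp).sub_int_mul_eq (x := x) ⌊x⌋
    rw [mul_one] at this
    exact this.symm
  rw [h1]
  exact hx₀ ⟨Int.fract_nonneg x, (Int.fract_lt_one x).le⟩

namespace SmoothLift
variable {f : ℝ → ℝ}

theorem logD_add_int (hf : SmoothLift f) (l : ℕ) (x : ℝ) (k : ℤ) :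
    logD f l (x + k) = logD f l x := by
  have := (show Function.Periodic (logD f l) 1 from hf.logD_add_one l).int_mul k x
  rwa [mul_one] at this

theorem logD_sub_int (hf : SmoothLift f) (l : ℕ) (x : ℝ) (k : ℤ) :
    logD f l (x - k) = logD f l x := by
  have := hf.logD_add_int l (x - k) k
  rw [sub_add_cancel] at this; exact this.symm

theorem nonlin_sub_int (hf : SmoothLift f) (l : ℕ) (x : ℝ) (k : ℤ) :
    nonlin f l (x - k) = nonlin f l x := by
  have := (show Function.Periodic (nonlin f l) 1 from hf.nonlin_add_one l).sub_int_mul_eq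
    (x := x) k
  rwa [mul_one] at this

theorem nonlin_add (hf : SmoothLift f) (a b : ℕ) (x : ℝ) :
    nonlin f (a + b) x = nonlin f a (f^[b] x) * deriv f^[b] x + nonlin f b x := by
  have h1 : logD f (a + b) = fun x => logD f a (f^[b] x) + logD f b x := by
    ext x; rw [hf.logD_add]
  have h2 := ((hf.hasDerivAt_logD a (f^[b] x)).comp x (hf.hasDerivAt_iterate b x)).add
    (hf.hasDerivAt_logD b x)
  rw [nonlin, h1]
  exact h2.deriv

theorem gap_add_one (hf : SmoothLift f) (q : ℕ) (p : ℤ) (x : ℝ) :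
    gap f q p (x + 1) = gap f q p x := by
  rw [gap, gap, (hf.iterate q).map_add_one]; ring

theorem gap_add_int (hf : SmoothLift f) (q : ℕ) (p : ℤ) (x : ℝ) (k : ℤ) :
    gap f q p (x + k) = gap f q p x := by
  rw [gap, gap, (hf.iterate q).map_add_int]; ring

theorem hasDerivAt_gap (hf : SmoothLift f) (q : ℕ) (p : ℤ) (x : ℝ) :
    HasDerivAt (gap f q p) (deriv f^[q] x - 1) x :=
  ((hf.hasDerivAt_iterate q x).sub_const (p : ℝ)).sub (hasDerivAt_id x)

theorem continuous_gap (hf : SmoothLift f) (q : ℕ) (p : ℤ) : Continuous (gap f q p) :=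
  continuous_iff_continuousAt.2 fun x => (hf.hasDerivAt_gap q p x).continuousAt

end SmoothLift

/-- The function `(f^[l])' ^ (-1/2)`. -/
noncomputable def rootD (f : ℝ → ℝ) (l : ℕ) (x : ℝ) : ℝ := Real.exp (-logD f l x / 2)

theorem rootD_pos (f : ℝ → ℝ) (l : ℕ) (x : ℝ) : 0 < rootD f l x := Real.exp_pos _

namespace SmoothLift
variable {f : ℝ → ℝ}

theorem deriv_iterate_eq (hf : SmoothLift f) (l : ℕ) (x : ℝ) :
    deriv f^[l] x = 1 / rootD f l x ^ 2 := by
  rw [rootD, ← hf.exp_logD, ← Real.exp_nat_mul, one_div, ← Real.exp_neg]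
  congr 1; push_cast; ring

theorem hasDerivAt_rootD (hf : SmoothLift f) (l : ℕ) (x : ℝ) :
    HasDerivAt (rootD f l) (-nonlin f l x * rootD f l x / 2) x := by
  refine HasDerivAt.congr_deriv (f := rootD f l)
    ((hf.hasDerivAt_logD l x).neg.div_const 2).exp ?_
  simp only [rootD, Pi.neg_apply]; ring

theorem hasDerivAt_deriv_rootD (hf : SmoothLift f) (l : ℕ) (x : ℝ) :
    HasDerivAt (fun x => -nonlin f l x * rootD f l x / 2)
      (-schw f l x * rootD f l x / 2) x := by
  have := ((hf.hasDerivAt_nonlin l x).neg.mul (hf.hasDerivAt_rootD l x)).div_const 2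
  refine this.congr_deriv ?_
  simp only [Pi.neg_apply]; ring

end SmoothLift

namespace IsPair

variable {f : ℝ → ℝ} {ρ : ℝ} {q q' : ℕ} {p p' : ℤ} {V M : ℝ} {l : ℕ} {x y z : ℝ}

theorem dist_iterate_le (h : IsPair f ρ q p q' p') (hy : y ∈ Icc x (x + gap f q p x))
    (hz : z ∈ Icc x (x + gap f q p x)) : |f^[l] y - f^[l] z| ≤ gap f q p (f^[l] x) := by
  have e : x + gap f q p x = f^[q] x - p := by rw [gap]; ring
  rw [e] at hy hz
  have hm := (h.iterate l).strictMono.monotone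
  rw [h.gap_iterate, abs_le]
  constructor <;> linarith [hm hy.1, hm hy.2, hm hz.1, hm hz.2]

theorem sum_gap_le_of_le (h : IsPair f ρ q p q' p') (hl : l ≤ q') (x : ℝ) :
    ∑ i ∈ Finset.range l, gap f q p (f^[i] x) ≤ 1 :=
  (Finset.sum_le_sum_of_subset_of_nonneg (Finset.range_mono hl)
    fun _ _ _ => (h.gap_pos _).le).trans (h.sum_gap_le x)

/-- Denjoy distortion estimate. -/
theorem abs_logD_sub_le (h : IsPair f ρ q p q' p') (hV : ∀ x, |nonlin f 1 x| ≤ V) (hl : l ≤ q')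
    (hy : y ∈ Icc x (x + gap f q p x)) (hz : z ∈ Icc x (x + gap f q p x)) :
    |logD f l y - logD f l z| ≤ V := by
  have hV0 : 0 ≤ V := (abs_nonneg _).trans (hV 0)
  have hlip : ∀ a b, |logD f 1 a - logD f 1 b| ≤ V * |a - b| := by
    intro a b
    have := Convex.norm_image_sub_le_of_norm_hasDerivWithin_le (f := logD f 1) (s := univ)
      (x := b) (y := a) (C := V) (fun x _ => (h.hasDerivAt_logD 1 x).hasDerivWithinAt)
      (fun x _ => hV x) convex_univ trivial trivial
    simpa [Real.norm_eq_abs] using this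
  rw [h.logD_eq_sum, h.logD_eq_sum l z, ← Finset.sum_sub_distrib]
  calc |∑ i ∈ Finset.range l, (logD f 1 (f^[i] y) - logD f 1 (f^[i] z))|
      ≤ ∑ i ∈ Finset.range l, |logD f 1 (f^[i] y) - logD f 1 (f^[i] z)| :=
        Finset.abs_sum_le_sum_abs _ _
    _ ≤ ∑ i ∈ Finset.range l, V * gap f q p (f^[i] x) := by
        refine Finset.sum_le_sum fun i _ => (hlip _ _).trans ?_
        exact mul_le_mul_of_nonneg_left (h.dist_iterate_le hy hz) hV0
    _ ≤ V := by
        rw [← Finset.mul_sum]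
        have := h.sum_gap_le_of_le hl x
        nlinarith

theorem left_mem (h : IsPair f ρ q p q' p') (x : ℝ) : x ∈ Icc x (x + gap f q p x) :=
  ⟨le_rfl, by linarith [h.gap_pos x]⟩

theorem right_mem (h : IsPair f ρ q p q' p') (x : ℝ) :
    x + gap f q p x ∈ Icc x (x + gap f q p x) :=
  ⟨by linarith [h.gap_pos x], le_rfl⟩

theorem deriv_iterate_le_exp_mul (h : IsPair f ρ q p q' p') (hV : ∀ x, |nonlin f 1 x| ≤ V)
    (hl : l ≤ q') (hy : y ∈ Icc x (x + gap f q p x)) (hz : z ∈ Icc x (x + gap f q p x)) :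
    deriv f^[l] y ≤ Real.exp V * deriv f^[l] z := by
  rw [← h.exp_logD, ← h.exp_logD, ← Real.exp_add]
  apply Real.exp_le_exp.2
  have := (abs_le.1 (h.abs_logD_sub_le hV hl hy hz)).2
  linarith

theorem exists_deriv_iterate_eq (h : IsPair f ρ q p q' p') (l : ℕ) (x : ℝ) :
    ∃ ξ ∈ Icc x (x + gap f q p x), gap f q p (f^[l] x) = deriv f^[l] ξ * gap f q p x := by
  have hx := h.gap_pos x
  obtain ⟨ξ, hξ, h1⟩ := exists_eq_mul_sub (show x ≤ x + gap f q p x by linarith)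
    (h.hasDerivAt_iterate l)
  refine ⟨ξ, hξ, ?_⟩
  have e : x + gap f q p x = f^[q] x - p := by rw [gap]; ring
  rw [h.gap_iterate, ← e, h1]; ring

theorem deriv_iterate_le (h : IsPair f ρ q p q' p') (hV : ∀ x, |nonlin f 1 x| ≤ V)
    (hl : l ≤ q') (hy : y ∈ Icc x (x + gap f q p x)) :
    deriv f^[l] y ≤ Real.exp V * (gap f q p (f^[l] x) / gap f q p x) := by
  have hx := h.gap_pos x
  obtain ⟨ξ, hξ, h1⟩ := h.exists_deriv_iterate_eq l x
  rw [h1, mul_div_cancel_right₀ _ hx.ne']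
  exact h.deriv_iterate_le_exp_mul hV hl hy hξ

theorem sum_deriv_iterate_le (h : IsPair f ρ q p q' p') (hV : ∀ x, |nonlin f 1 x| ≤ V)
    (hl : l ≤ q') (hy : y ∈ Icc x (x + gap f q p x)) :
    ∑ i ∈ Finset.range l, deriv f^[i] y ≤ Real.exp V / gap f q p x := by
  have hx := h.gap_pos x
  calc ∑ i ∈ Finset.range l, deriv f^[i] y
      ≤ ∑ i ∈ Finset.range l, Real.exp V / gap f q p x * gap f q p (f^[i] x) := by
        refine Finset.sum_le_sum fun i hi => ?_
        refine (h.deriv_iterate_le hV ((Finset.mem_range.1 hi).le.trans hl) hy).trans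
          (le_of_eq (by ring))
    _ ≤ Real.exp V / gap f q p x := by
        rw [← Finset.mul_sum]
        exact mul_le_of_le_one_right (by positivity) (h.sum_gap_le_of_le hl x)

theorem sum_deriv_iterate_sq_le (h : IsPair f ρ q p q' p') (hV : ∀ x, |nonlin f 1 x| ≤ V)
    (hM : ∀ x, gap f q p x ≤ M)
    (hl : l ≤ q') (hy : y ∈ Icc x (x + gap f q p x)) :
    ∑ i ∈ Finset.range l, deriv f^[i] y ^ 2 ≤ Real.exp (2 * V) * M / gap f q p x ^ 2 := by
  have hx := h.gap_pos x
  have hM0 : 0 ≤ M := hx.le.trans (hM x)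
  calc ∑ i ∈ Finset.range l, deriv f^[i] y ^ 2
      ≤ ∑ i ∈ Finset.range l, (Real.exp V * M / gap f q p x) * deriv f^[i] y := by
        refine Finset.sum_le_sum fun i hi => ?_
        have h1 := h.deriv_iterate_le hV ((Finset.mem_range.1 hi).le.trans hl) hy
        have h2 := (h.iterate i).deriv_pos y
        rw [sq]
        refine mul_le_mul_of_nonneg_right (h1.trans ?_) h2.le
        rw [mul_div_assoc]
        have := hM (f^[i] x)
        gcongr
    _ ≤ (Real.exp V * M / gap f q p x) * (Real.exp V / gap f q p x) := by
        rw [← Finset.mul_sum]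
        exact mul_le_mul_of_nonneg_left (h.sum_deriv_iterate_le hV hl hy) (by positivity)
    _ = _ := by
        rw [show 2 * V = V + V by ring, Real.exp_add]; field_simp

theorem abs_nonlin_le (h : IsPair f ρ q p q' p') (hV : ∀ x, |nonlin f 1 x| ≤ V)
    (hl : l ≤ q') (hy : y ∈ Icc x (x + gap f q p x)) :
    |nonlin f l y| ≤ V * Real.exp V / gap f q p x := by
  have hV0 : 0 ≤ V := (abs_nonneg _).trans (hV 0)
  rw [h.nonlin_eq_sum]
  calc |∑ i ∈ Finset.range l, nonlin f 1 (f^[i] y) * deriv f^[i] y|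
      ≤ ∑ i ∈ Finset.range l, V * deriv f^[i] y := by
        refine (Finset.abs_sum_le_sum_abs _ _).trans (Finset.sum_le_sum fun i _ => ?_)
        rw [abs_mul, abs_of_pos ((h.iterate i).deriv_pos y)]
        exact mul_le_mul_of_nonneg_right (hV _) ((h.iterate i).deriv_pos y).le
    _ ≤ V * (Real.exp V / gap f q p x) := by
        rw [← Finset.mul_sum]
        exact mul_le_mul_of_nonneg_left (h.sum_deriv_iterate_le hV hl hy) hV0
    _ = _ := by ring

theorem abs_schw_le (h : IsPair f ρ q p q' p') (hV : ∀ x, |nonlin f 1 x| ≤ V)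
    (hV' : ∀ x, |schw f 1 x| ≤ V) (hM : ∀ x, gap f q p x ≤ M)
    (hl : l ≤ q') (hy : y ∈ Icc x (x + gap f q p x)) :
    |schw f l y| ≤ V * Real.exp (2 * V) * M / gap f q p x ^ 2 := by
  have hV0 : 0 ≤ V := (abs_nonneg _).trans (hV 0)
  rw [h.schw_eq_sum]
  calc |∑ i ∈ Finset.range l, schw f 1 (f^[i] y) * deriv f^[i] y ^ 2|
      ≤ ∑ i ∈ Finset.range l, V * deriv f^[i] y ^ 2 := by
        refine (Finset.abs_sum_le_sum_abs _ _).trans (Finset.sum_le_sum fun i _ => ?_)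
        rw [abs_mul, abs_of_nonneg (sq_nonneg (deriv f^[i] y))]
        exact mul_le_mul_of_nonneg_right (hV' _) (sq_nonneg _)
    _ ≤ V * (Real.exp (2 * V) * M / gap f q p x ^ 2) := by
        rw [← Finset.mul_sum]
        exact mul_le_mul_of_nonneg_left (h.sum_deriv_iterate_sq_le hV hM hl hy) hV0
    _ = _ := by ring

/-- Commutation of `f^[l]` with `f^[q] - p` at the level of derivatives. -/
theorem logD_cocycle (h : IsPair f ρ q p q' p') (l : ℕ) (x : ℝ) :
    logD f q (f^[l] x) + logD f l x = logD f l (x + gap f q p x) + logD f q x := by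
  have e : x + gap f q p x = f^[q] x - p := by rw [gap]; ring
  rw [e, h.logD_sub_int, ← h.logD_add, ← h.logD_add, add_comm]

theorem nonlin_cocycle (h : IsPair f ρ q p q' p') (l : ℕ) (x : ℝ) :
    nonlin f q (f^[l] x) * deriv f^[l] x + nonlin f l x
      = nonlin f l (x + gap f q p x) * deriv f^[q] x + nonlin f q x := by
  have e : x + gap f q p x = f^[q] x - p := by rw [gap]; ring
  rw [e, h.nonlin_sub_int, ← h.nonlin_add, ← h.nonlin_add, add_comm]

/-- If a function changes by at most `a` under iterates and by at most `b` along fundamental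
intervals, it is close to its value at any point. -/
theorem abs_sub_le_of_near (h : IsPair f ρ q p q' p') {T : ℝ → ℝ} {a b : ℝ}
    (hT1 : ∀ x, T (x + 1) = T x)
    (ha : ∀ l < q', ∀ x, |T (f^[l] x) - T x| ≤ a)
    (hb : ∀ x, ∀ y ∈ Icc x (x + gap f q p x), |T y - T x| ≤ b) (x y : ℝ) :
    |T y - T x| ≤ a + 2 * b := by
  obtain ⟨l, hl, k, h1, h2⟩ := h.exists_near x y
  set z := f^[l] x + k with hz
  have hTz : T z = T (f^[l] x) := by
    have := (show Function.Periodic T 1 from hT1).int_mul k (f^[l] x)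
    rwa [mul_one] at this
  have e1 : f^[q] z - p = z + gap f q p z := by rw [gap]; ring
  rw [e1] at h2
  set z' := z + gap f q p z with hz'
  have e2 : f^[q] z' - p = z' + gap f q p z' := by rw [gap]; ring
  rw [e2] at h2
  have h3 := ha l hl x
  rw [← hTz] at h3
  have hb0 : 0 ≤ b := (abs_nonneg _).trans (hb z z (h.left_mem z))
  rw [abs_le] at h3 ⊢
  rcases le_total y z' with hyz | hyz
  · have h4 := abs_le.1 (hb z y ⟨h1, hyz⟩)
    constructor <;> linarith
  · have h4 := abs_le.1 (hb z z' (h.right_mem z))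
    have h5 := abs_le.1 (hb z' y ⟨hyz, h2⟩)
    constructor <;> linarith

theorem exists_gap_min (h : IsPair f ρ q p q' p') : ∃ x₀, (∀ x, gap f q p x₀ ≤ gap f q p x) ∧
    deriv f^[q] x₀ = 1 := by
  obtain ⟨x₀, hx₀⟩ := exists_forall_le_of_periodic (h.continuous_gap q p).neg
    (fun x => by simp [h.gap_add_one])
  have hmin : ∀ x, gap f q p x₀ ≤ gap f q p x := fun x => neg_le_neg_iff.1 (hx₀ x)
  refine ⟨x₀, hmin, ?_⟩
  have := IsLocalMin.hasDerivAt_eq_zero (Filter.Eventually.of_forall hmin) (h.hasDerivAt_gap q p x₀)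
  linarith

theorem abs_logD_le (h : IsPair f ρ q p q' p') (hV : ∀ x, |nonlin f 1 x| ≤ V) (x : ℝ) :
    |logD f q x| ≤ 3 * V := by
  obtain ⟨x₀, -, hx₀⟩ := h.exists_gap_min
  have h0 : logD f q x₀ = 0 := by rw [logD, hx₀, Real.log_one]
  have := h.abs_sub_le_of_near (T := logD f q) (a := V) (b := V) (h.logD_add_one q)
    (fun l hl x => by
      have h1 := h.logD_cocycle l x
      have h2 := h.abs_logD_sub_le hV hl.le (h.right_mem x) (h.left_mem x)
      rwa [show logD f q (f^[l] x) - logD f q x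
        = logD f l (x + gap f q p x) - logD f l x by linarith])
    (fun x y hy => h.abs_logD_sub_le hV h.q_le hy (h.left_mem x)) x₀ x
  rw [h0, sub_zero] at this
  linarith

theorem gap_le_exp_mul {W : ℝ} (h : IsPair f ρ q p q' p') (hW : ∀ x, |logD f q x| ≤ W)
    (hz : z ∈ Icc y (y + gap f q p y)) :
    gap f q p z ≤ Real.exp W * gap f q p y ∧ gap f q p y ≤ Real.exp W * gap f q p z := by
  have hW0 : 0 ≤ W := (abs_nonneg _).trans (hW 0)
  obtain ⟨ξ, -, h1⟩ := exists_eq_mul_sub hz.1 (h.hasDerivAt_iterate q)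
  rw [← h.exp_logD] at h1
  have h2 : Real.exp (logD f q ξ) ≤ Real.exp W :=
    Real.exp_le_exp.2 (abs_le.1 (hW ξ)).2
  have h3 : 1 ≤ Real.exp W * Real.exp (logD f q ξ) := by
    rw [← Real.exp_add]; exact Real.one_le_exp (by linarith [(abs_le.1 (hW ξ)).1])
  have h4 : gap f q p z = (y + gap f q p y - z) + Real.exp (logD f q ξ) * (z - y) := by
    rw [← h1, gap, gap]; ring
  have h5 : 1 ≤ Real.exp W := Real.one_le_exp hW0
  have h6 : 0 ≤ z - y := by linarith [hz.1]
  have h7 : 0 ≤ y + gap f q p y - z := by linarith [hz.2]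
  constructor
  · rw [h4]
    nlinarith
  · rw [h4]
    nlinarith

end IsPair

/-- A trace-like quantity which is almost invariant along orbits. -/
noncomputable def tr (f : ℝ → ℝ) (q : ℕ) (p : ℤ) (x : ℝ) : ℝ :=
  rootD f q x + 1 / rootD f q x + gap f q p x * (-nonlin f q x * rootD f q x / 2)

theorem SmoothLift.hasDerivAt_tr {f : ℝ → ℝ} (hf : SmoothLift f) (q : ℕ) (p : ℤ) (x : ℝ) :
    HasDerivAt (tr f q p) (gap f q p x * (-schw f q x * rootD f q x / 2)) x := by
  have hw := (rootD_pos f q x).ne'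
  have h1 := hf.hasDerivAt_rootD q x
  have h2 := (h1.inv hw)
  have h3 := (hf.hasDerivAt_gap q p x).mul (hf.hasDerivAt_deriv_rootD q x)
  have h4 := (h1.add h2).add h3
  rw [hf.deriv_iterate_eq] at h4
  have : tr f q p = (rootD f q + (rootD f q)⁻¹)
      + gap f q p * (fun x => -nonlin f q x * rootD f q x / 2) := by
    ext x; simp [tr]
  rw [this]
  refine h4.congr_deriv ?_
  field_simp
  ring

theorem two_add_sq_le_exp_add (t : ℝ) : 2 + t ^ 2 ≤ Real.exp t + Real.exp (-t) := by
  have h1 : Real.exp t = Real.exp (t / 2) ^ 2 := by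
    rw [← Real.exp_nat_mul]; congr 1; push_cast; ring
  have h2 : Real.exp (-t) = Real.exp (-(t / 2)) ^ 2 := by
    rw [← Real.exp_nat_mul]; congr 1; push_cast; ring
  have h3 : Real.exp (t / 2) * Real.exp (-(t / 2)) = 1 := by
    rw [← Real.exp_add]; simp
  have h4 : Real.sinh (t / 2) = (Real.exp (t / 2) - Real.exp (-(t / 2))) / 2 := Real.sinh_eq _
  have h5 : (t / 2) ^ 2 ≤ Real.sinh (t / 2) ^ 2 := by
    rcases le_total 0 (t / 2) with h | h
    · exact pow_le_pow_left₀ h (Real.self_le_sinh_iff.2 h) 2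
    · rw [← neg_sq, ← neg_sq (Real.sinh _)]
      refine pow_le_pow_left₀ (by linarith) ?_ 2
      have := Real.sinh_le_self_iff.2 h
      linarith
  rw [h4] at h5
  rw [h1, h2]
  nlinarith

namespace IsPair

variable {f : ℝ → ℝ} {ρ : ℝ} {q q' : ℕ} {p p' : ℤ} {V M : ℝ} {l : ℕ} {x y z : ℝ}

theorem rootD_cocycle (h : IsPair f ρ q p q' p') (l : ℕ) (x : ℝ) :
    rootD f q (f^[l] x) = rootD f q x * rootD f l (x + gap f q p x) / rootD f l x := by
  have := h.logD_cocycle l x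
  rw [rootD, rootD, rootD, rootD, ← Real.exp_add, ← Real.exp_sub]
  congr 1; linarith

theorem tr_iterate_sub (h : IsPair f ρ q p q' p') (l : ℕ) (x : ℝ) {w m P₀ P₁ A₀ A₁ A mX : ℝ}
    (hw : w = rootD f q x) (hm : m = gap f q p x) (hP₀ : P₀ = rootD f l x)
    (hP₁ : P₁ = rootD f l (x + gap f q p x)) (hA₀ : A₀ = nonlin f l x)
    (hA₁ : A₁ = nonlin f l (x + gap f q p x)) (hA : A = nonlin f q x)
    (hmX : mX = gap f q p (f^[l] x)) :
    tr f q p (f^[l] x) - tr f q p x =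
      w * (P₁ - P₀ - m * (-A₀ * P₀ / 2)) / P₀ + 1 / w * (-(P₁ - P₀ - m * (-A₁ * P₁ / 2))) / P₁
      + (mX * P₁ - m / P₀) * P₀ * (-A * w / 2 - A₁ / (2 * w) + w * A₀ / 2) := by
  have hw0 : w ≠ 0 := hw ▸ (rootD_pos f q x).ne'
  have hP₀0 : P₀ ≠ 0 := hP₀ ▸ (rootD_pos f l x).ne'
  have hP₁0 : P₁ ≠ 0 := hP₁ ▸ (rootD_pos f l _).ne'
  have hm0 : m ≠ 0 := hm ▸ (h.gap_pos x).ne'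
  have hc := h.nonlin_cocycle l x
  rw [h.deriv_iterate_eq, h.deriv_iterate_eq, ← hw, ← hP₀, ← hA₀, ← hA₁, ← hA] at hc
  have hX : nonlin f q (f^[l] x) = P₀ ^ 2 * (A₁ / w ^ 2 + A - A₀) := by
    field_simp at hc ⊢
    linarith
  rw [tr, tr, h.rootD_cocycle, hX, ← hw, ← hP₀, ← hP₁, ← hm, ← hA, ← hmX]
  field_simp
  ring

end IsPair

/-- The exponential constant appearing in all distortion estimates. -/
noncomputable def bigK (V : ℝ) : ℝ := Real.exp (4 * V)

theorem one_le_bigK {V : ℝ} (hV : 1 ≤ V) : 1 ≤ bigK V := Real.one_le_exp (by linarith)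

theorem bigK_pos (V : ℝ) : 0 < bigK V := Real.exp_pos _

theorem mul_exp_le_bigK {V a : ℝ} (ha : a ≤ 3 * V) : V * Real.exp a ≤ bigK V := by
  have h1 : V ≤ Real.exp V := by linarith [Real.add_one_le_exp V]
  calc V * Real.exp a ≤ Real.exp V * Real.exp (3 * V) := by gcongr
    _ = bigK V := by rw [← Real.exp_add, bigK]; congr 1; ring

namespace IsPair

variable {f : ℝ → ℝ} {ρ : ℝ} {q q' : ℕ} {p p' : ℤ} {V M : ℝ} {l : ℕ} {x y z : ℝ}

theorem abs_nonlin_le_bigK (h : IsPair f ρ q p q' p') (hV1 : 1 ≤ V) (hV : ∀ x, |nonlin f 1 x| ≤ V)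
    (hl : l ≤ q') (hy : y ∈ Icc x (x + gap f q p x)) :
    |nonlin f l y| ≤ bigK V / gap f q p x := by
  refine (h.abs_nonlin_le hV hl hy).trans ?_
  have := h.gap_pos x
  gcongr
  exact mul_exp_le_bigK (by linarith)

theorem abs_schw_le_bigK (h : IsPair f ρ q p q' p') (hV1 : 1 ≤ V) (hV : ∀ x, |nonlin f 1 x| ≤ V)
    (hV' : ∀ x, |schw f 1 x| ≤ V) (hM : ∀ x, gap f q p x ≤ M)
    (hl : l ≤ q') (hy : y ∈ Icc x (x + gap f q p x)) :
    |schw f l y| ≤ bigK V * M / gap f q p x ^ 2 := by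
  refine (h.abs_schw_le hV hV' hM hl hy).trans ?_
  have := h.gap_pos x
  have := this.trans_le (hM x)
  gcongr
  exact mul_exp_le_bigK (by linarith)

theorem rootD_le_bigK_mul (h : IsPair f ρ q p q' p') (hV1 : 1 ≤ V) (hV : ∀ x, |nonlin f 1 x| ≤ V)
    (hl : l ≤ q') (hy : y ∈ Icc x (x + gap f q p x))
    (hz : z ∈ Icc x (x + gap f q p x)) : rootD f l y ≤ bigK V * rootD f l z := by
  have := (abs_le.1 (h.abs_logD_sub_le hV hl hy hz)).1
  rw [rootD, rootD, bigK, ← Real.exp_add]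
  exact Real.exp_le_exp.2 (by linarith)

theorem rootD_le_bigK (h : IsPair f ρ q p q' p') (hV1 : 1 ≤ V) (hV : ∀ x, |nonlin f 1 x| ≤ V)
    (x : ℝ) : rootD f q x ≤ bigK V := by
  have := (abs_le.1 (h.abs_logD_le hV x)).1
  exact Real.exp_le_exp.2 (by linarith)

theorem one_div_rootD_le_bigK (h : IsPair f ρ q p q' p') (hV1 : 1 ≤ V) (hV : ∀ x, |nonlin f 1 x| ≤ V)
    (x : ℝ) : 1 / rootD f q x ≤ bigK V := by
  have := (abs_le.1 (h.abs_logD_le hV x)).2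
  rw [rootD, one_div, ← Real.exp_neg]
  exact Real.exp_le_exp.2 (by linarith)

theorem gap_le_bigK_mul (h : IsPair f ρ q p q' p') (hV1 : 1 ≤ V) (hV : ∀ x, |nonlin f 1 x| ≤ V)
    (hz : z ∈ Icc y (y + gap f q p y)) :
    gap f q p z ≤ bigK V * gap f q p y ∧ gap f q p y ≤ bigK V * gap f q p z := by
  have h1 := h.gap_le_exp_mul (h.abs_logD_le hV) hz
  have h2 : Real.exp (3 * V) ≤ bigK V := Real.exp_le_exp.2 (by linarith)
  have := h.gap_pos z
  have := h.gap_pos y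
  exact ⟨h1.1.trans (by gcongr), h1.2.trans (by gcongr)⟩

theorem abs_schw_mul_rootD_le (h : IsPair f ρ q p q' p') (hV1 : 1 ≤ V) (hV : ∀ x, |nonlin f 1 x| ≤ V)
    (hV' : ∀ x, |schw f 1 x| ≤ V) (hM : ∀ x, gap f q p x ≤ M)
    (hl : l ≤ q') (hy : y ∈ Icc x (x + gap f q p x))
    (hz : z ∈ Icc x (x + gap f q p x)) :
    |-schw f l y * rootD f l y / 2| ≤ bigK V ^ 2 * M * rootD f l z / gap f q p x ^ 2 := by
  have h1 := h.abs_schw_le_bigK hV1 hV hV' hM hl hy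
  have h2 := h.rootD_le_bigK_mul hV1 hV hl hy hz
  have h3 := rootD_pos f l y
  have h4 := h.gap_pos x
  have h5 := h4.trans_le (hM x)
  have h6 := bigK_pos V
  rw [abs_div, abs_mul, abs_neg, abs_of_pos h3, abs_two]
  calc |schw f l y| * rootD f l y / 2 ≤ |schw f l y| * rootD f l y := by
        apply half_le_self; positivity
    _ ≤ (bigK V * M / gap f q p x ^ 2) * (bigK V * rootD f l z) := by gcongr
    _ = _ := by ring

theorem abs_tr_sub_le (h : IsPair f ρ q p q' p') (hV1 : 1 ≤ V) (hV : ∀ x, |nonlin f 1 x| ≤ V)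
    (hV' : ∀ x, |schw f 1 x| ≤ V) (hM : ∀ x, gap f q p x ≤ M)
    (hy : y ∈ Icc x (x + gap f q p x)) :
    |tr f q p y - tr f q p x| ≤ bigK V ^ 4 * M := by
  have hx := h.gap_pos x
  have hM0 := hx.trans_le (hM x)
  have hK := bigK_pos V
  have h1 := abs_sub_le_of_deriv_bound hy.1 (h.hasDerivAt_tr q p)
    (B := bigK V ^ 4 * M / gap f q p x) (fun t ht => by
      have ht' : t ∈ Icc x (x + gap f q p x) := ⟨ht.1, ht.2.trans hy.2⟩
      have h2 := h.abs_schw_mul_rootD_le hV1 hV hV' hM h.q_le ht' (h.left_mem x)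
      have h3 := (h.gap_le_bigK_mul hV1 hV ht').1
      have h4 := h.rootD_le_bigK hV1 hV x
      rw [abs_mul, abs_of_pos (h.gap_pos t)]
      calc gap f q p t * |-schw f q t * rootD f q t / 2|
          ≤ (bigK V * gap f q p x) * (bigK V ^ 2 * M * bigK V / gap f q p x ^ 2) := by
            gcongr
            exact h2.trans (by gcongr)
        _ = _ := by field_simp)
  refine h1.trans ?_
  calc bigK V ^ 4 * M / gap f q p x * (y - x)
      ≤ bigK V ^ 4 * M / gap f q p x * gap f q p x := by
        gcongr; linarith [hy.2]
    _ = _ := by field_simp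

theorem abs_gap_iterate_mul_sub_le (h : IsPair f ρ q p q' p') (hV1 : 1 ≤ V) (hV : ∀ x, |nonlin f 1 x| ≤ V)
    (hV' : ∀ x, |schw f 1 x| ≤ V) (hM : ∀ x, gap f q p x ≤ M)
    (hl : l ≤ q') (x : ℝ) :
    |gap f q p (f^[l] x) * rootD f l (x + gap f q p x) - gap f q p x / rootD f l x|
      ≤ bigK V ^ 4 * M * gap f q p x / rootD f l x := by
  have hx := h.gap_pos x
  have hM0 := hx.trans_le (hM x)
  have hK := bigK_pos V
  set m := gap f q p x with hm
  set P₀ := rootD f l x with hP₀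
  have hP₀pos : 0 < P₀ := rootD_pos f l x
  have hU : ∀ t, HasDerivAt (fun t => (f^[l] t - f^[l] x) * rootD f l t)
      (1 / rootD f l t + (f^[l] t - f^[l] x) * (-nonlin f l t * rootD f l t / 2)) t := by
    intro t
    have := ((h.hasDerivAt_iterate l t).sub_const (f^[l] x)).mul (h.hasDerivAt_rootD l t)
    refine this.congr_deriv ?_
    rw [h.deriv_iterate_eq]
    have := (rootD_pos f l t).ne'
    field_simp
  have hU' : ∀ t, HasDerivAt
      (fun t => 1 / rootD f l t + (f^[l] t - f^[l] x) * (-nonlin f l t * rootD f l t / 2))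
      ((f^[l] t - f^[l] x) * (-schw f l t * rootD f l t / 2)) t := by
    intro t
    have hne := (rootD_pos f l t).ne'
    have := ((hasDerivAt_const t (1 : ℝ)).div (h.hasDerivAt_rootD l t) hne).add
      (((h.hasDerivAt_iterate l t).sub_const (f^[l] x)).mul (h.hasDerivAt_deriv_rootD l t))
    refine this.congr_deriv ?_
    rw [h.deriv_iterate_eq]
    field_simp
    ring
  have key := abs_sub_sub_le_left (show x ≤ x + m by linarith) hU hU'
    (B := bigK V ^ 4 * M / (m * P₀)) (fun t ht => by
      have h1 := h.dist_iterate_le (l := l) ht (h.left_mem x)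
      obtain ⟨ξ, hξ, h2⟩ := h.exists_deriv_iterate_eq l x
      rw [h2, h.deriv_iterate_eq] at h1
      have h3 := h.rootD_le_bigK_mul hV1 hV hl (h.left_mem x) hξ
      have h4 := h.abs_schw_mul_rootD_le hV1 hV hV' hM hl ht (h.left_mem x)
      have h5 := rootD_pos f l ξ
      rw [← hP₀] at h3 h4
      rw [← hm] at h1 h4
      have h6 : 1 / rootD f l ξ ^ 2 ≤ bigK V ^ 2 / P₀ ^ 2 := by
        rw [div_le_div_iff₀ (by positivity) (by positivity), one_mul, ← mul_pow]
        exact pow_le_pow_left₀ hP₀pos.le h3 2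
      rw [abs_mul]
      calc |f^[l] t - f^[l] x| * |-schw f l t * rootD f l t / 2|
          ≤ (bigK V ^ 2 / P₀ ^ 2 * m) * (bigK V ^ 2 * M * P₀ / m ^ 2) := by
            refine mul_le_mul (h1.trans ?_) h4 (abs_nonneg _) (by positivity)
            gcongr
        _ = _ := by field_simp)
  have e : x + m = f^[q] x - p := by rw [hm, gap]; ring
  simp only [sub_self, zero_mul, add_zero, sub_zero, add_sub_cancel_left] at key
  rw [h.gap_iterate, ← e]
  rw [mul_one_div] at key
  refine key.trans (le_of_eq ?_)
  field_simp

theorem abs_tr_iterate_sub_le (h : IsPair f ρ q p q' p') (hV1 : 1 ≤ V) (hV : ∀ x, |nonlin f 1 x| ≤ V)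
    (hV' : ∀ x, |schw f 1 x| ≤ V) (hM : ∀ x, gap f q p x ≤ M)
    (hl : l ≤ q') (x : ℝ) :
    |tr f q p (f^[l] x) - tr f q p x| ≤ 4 * bigK V ^ 6 * M := by
  have hx := h.gap_pos x
  have hM0 := hx.trans_le (hM x)
  have hK := bigK_pos V
  have hK1 := one_le_bigK hV1
  set m := gap f q p x with hm
  set P₀ := rootD f l x with hP₀
  have hP₀pos : 0 < P₀ := rootD_pos f l x
  set P₁ := rootD f l (x + m) with hP₁
  have hP₁pos : 0 < P₁ := rootD_pos f l _
  set w := rootD f q x with hw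
  have hwpos : 0 < w := rootD_pos f q _
  rw [h.tr_iterate_sub l x hw hm hP₀ hP₁ rfl rfl rfl rfl]
  have hxm : x ≤ x + m := by linarith
  have e0 := abs_sub_sub_le_left hxm (h.hasDerivAt_rootD l) (h.hasDerivAt_deriv_rootD l)
    (fun t ht => h.abs_schw_mul_rootD_le hV1 hV hV' hM hl ht (h.left_mem x))
  have e1 := abs_sub_sub_le_right hxm (h.hasDerivAt_rootD l) (h.hasDerivAt_deriv_rootD l)
    (fun t ht => h.abs_schw_mul_rootD_le hV1 hV hV' hM hl ht (h.right_mem x))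
  rw [add_sub_cancel_left, ← hP₀, ← hP₁, ← hm] at e0 e1
  have e2 := h.abs_gap_iterate_mul_sub_le hV1 hV hV' hM hl x
  rw [← hP₀, ← hP₁, ← hm] at e2
  have hwK : w ≤ bigK V := h.rootD_le_bigK hV1 hV x
  have hwK' : 1 / w ≤ bigK V := h.one_div_rootD_le_bigK hV1 hV x
  have a0 := h.abs_nonlin_le_bigK hV1 hV hl (h.left_mem x)
  have a1 := h.abs_nonlin_le_bigK hV1 hV hl (h.right_mem x)
  have a := h.abs_nonlin_le_bigK hV1 hV h.q_le (h.left_mem x)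
  rw [← hm] at a0 a1 a
  have b0 : |w * (P₁ - P₀ - m * (-nonlin f l x * P₀ / 2)) / P₀| ≤ bigK V ^ 3 * M := by
    rw [abs_div, abs_mul, abs_of_pos hwpos, abs_of_pos hP₀pos, div_le_iff₀ hP₀pos]
    refine (mul_le_mul hwK e0 (abs_nonneg _) hK.le).trans (le_of_eq ?_)
    field_simp
  have b1 : |1 / w * (-(P₁ - P₀ - m * (-nonlin f l (x + m) * P₁ / 2))) / P₁|
      ≤ bigK V ^ 3 * M := by
    rw [abs_div, abs_mul, abs_neg, abs_of_pos (show 0 < 1 / w by positivity), abs_of_pos hP₁pos,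
      div_le_iff₀ hP₁pos]
    refine (mul_le_mul hwK' e1 (abs_nonneg _) hK.le).trans (le_of_eq ?_)
    field_simp
  have b2 : |-nonlin f q x * w / 2 - nonlin f l (x + m) / (2 * w) + w * nonlin f l x / 2|
      ≤ 2 * bigK V ^ 2 / m := by
    have c1 : |-nonlin f q x * w / 2| ≤ bigK V / m * bigK V / 2 := by
      rw [abs_div, abs_mul, abs_neg, abs_of_pos hwpos, abs_two]
      gcongr
    have c2 : |nonlin f l (x + m) / (2 * w)| ≤ bigK V / m * bigK V / 2 := by
      rw [show nonlin f l (x + m) / (2 * w) = nonlin f l (x + m) * (1 / w) / 2 by field_simp,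
        abs_div, abs_mul, abs_of_pos (show 0 < 1 / w by positivity), abs_two]
      gcongr
    have c3 : |w * nonlin f l x / 2| ≤ bigK V / m * bigK V / 2 := by
      rw [mul_comm w, abs_div, abs_mul, abs_of_pos hwpos, abs_two]
      gcongr
    have c4 : 0 ≤ bigK V / m * bigK V := by positivity
    refine (abs_add_le _ _).trans ((add_le_add_left (abs_sub _ _) _).trans ?_)
    rw [show 2 * bigK V ^ 2 / m = 2 * (bigK V / m * bigK V) by ring]
    linarith
  have b3 : |(gap f q p (f^[l] x) * P₁ - m / P₀) * P₀
      * (-nonlin f q x * w / 2 - nonlin f l (x + m) / (2 * w) + w * nonlin f l x / 2)|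
      ≤ 2 * bigK V ^ 6 * M := by
    rw [abs_mul, abs_mul, abs_of_pos hP₀pos]
    calc _ ≤ (bigK V ^ 4 * M * m / P₀) * P₀ * (2 * bigK V ^ 2 / m) := by gcongr
      _ = _ := by field_simp
  have b4 : bigK V ^ 3 ≤ bigK V ^ 6 := pow_le_pow_right₀ hK1 (by norm_num)
  refine (abs_add_le _ _).trans ((add_le_add_left (abs_add_le _ _) _).trans ?_)
  nlinarith

theorem exists_tr_le_two (h : IsPair f ρ q p q' p') : ∃ x₀, tr f q p x₀ ≤ 2 := by
  obtain ⟨x₀, hmin, hd⟩ := h.exists_gap_min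
  refine ⟨x₀, ?_⟩
  have hlog : logD f q x₀ = 0 := by rw [logD, hd, Real.log_one]
  have hw : rootD f q x₀ = 1 := by rw [rootD, hlog]; simp
  suffices 0 ≤ nonlin f q x₀ by
    rw [tr, hw]
    nlinarith [h.gap_pos x₀]
  by_contra hneg
  push Not at hneg
  have d1 : deriv (gap f q p) = fun x => deriv f^[q] x - 1 :=
    funext fun x => (h.hasDerivAt_gap q p x).deriv
  have d2 : deriv (deriv (gap f q p)) x₀ = nonlin f q x₀ := by
    rw [d1, ((h.hasDerivAt_deriv_iterate q x₀).sub_const 1).deriv, hd, mul_one]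
  have hmax := isLocalMax_of_deriv_deriv_neg (f := gap f q p) (by rw [d2]; exact hneg)
    (by rw [d1]; simp [hd]) (h.continuous_gap q p).continuousAt
  have hconst : gap f q p =ᶠ[nhds x₀] fun _ => gap f q p x₀ := by
    filter_upwards [hmax] with y hy
    exact le_antisymm hy (hmin y)
  have := hconst.deriv.deriv_eq
  rw [d2] at this
  simp at this
  linarith

theorem abs_logD_le_sqrt (h : IsPair f ρ q p q' p') (hV1 : 1 ≤ V) (hV : ∀ x, |nonlin f 1 x| ≤ V)
    (hV' : ∀ x, |schw f 1 x| ≤ V) (hM : ∀ x, gap f q p x ≤ M)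
    (x : ℝ) : |logD f q x| ≤ 5 * bigK V ^ 3 * √M := by
  have hM0 := (h.gap_pos x).trans_le (hM x)
  have hK := bigK_pos V
  have hK1 := one_le_bigK hV1
  obtain ⟨x₁, hx₁⟩ := exists_forall_le_of_periodic (u := fun x => logD f q x ^ 2)
    ((h.contDiff_logD q).continuous.pow 2) (fun x => by rw [h.logD_add_one])
  have hper : ∀ x, tr f q p (x + 1) = tr f q p x := fun x => by
    simp only [tr, rootD, h.gap_add_one, h.logD_add_one, h.nonlin_add_one]
  obtain ⟨x₀, hx₀⟩ := h.exists_tr_le_two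
  have hT := h.abs_sub_le_of_near hper
    (fun l hl x => h.abs_tr_iterate_sub_le hV1 hV hV' hM hl.le x)
    (fun x y hy => h.abs_tr_sub_le hV1 hV hV' hM hy) x₀ x₁
  have b4 : bigK V ^ 4 ≤ bigK V ^ 6 := pow_le_pow_right₀ hK1 (by norm_num)
  have hT' : tr f q p x₁ ≤ 2 + 6 * bigK V ^ 6 * M := by
    have := (abs_le.1 hT).2
    nlinarith
  have hsq : logD f q x₁ ^ 2 ≤ 24 * bigK V ^ 6 * M := by
    by_cases h0 : logD f q x₁ = 0
    · rw [h0]; nlinarith [mul_pos (pow_pos hK 6) hM0]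
    · have hd := IsLocalMax.hasDerivAt_eq_zero (Filter.Eventually.of_forall hx₁)
        ((h.hasDerivAt_logD q x₁).pow 2)
      have hA : nonlin f q x₁ = 0 := by
        simpa [h0] using hd
      rw [tr, hA] at hT'
      have h1 := two_add_sq_le_exp_add (logD f q x₁ / 2)
      have h2 : 1 / rootD f q x₁ = Real.exp (logD f q x₁ / 2) := by
        rw [rootD, one_div, ← Real.exp_neg]; congr 1; ring
      have h3 : rootD f q x₁ = Real.exp (-(logD f q x₁ / 2)) := by
        rw [rootD]; congr 1; ring
      rw [h2, h3] at hT'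
      nlinarith
  refine abs_le_of_sq_le_sq ?_ (by positivity)
  have h1 : √M ^ 2 = M := Real.sq_sqrt hM0.le
  have h2 := hx₁ x
  have h3 : (5 * bigK V ^ 3 * √M) ^ 2 = 25 * bigK V ^ 6 * M := by
    rw [mul_pow, mul_pow, h1]; ring
  rw [h3]
  nlinarith [show 0 ≤ bigK V ^ 6 * M by positivity]

theorem abs_nonlin_le_sqrt (h : IsPair f ρ q p q' p') (hV1 : 1 ≤ V) (hV : ∀ x, |nonlin f 1 x| ≤ V)
    (hV' : ∀ x, |schw f 1 x| ≤ V) (hM : ∀ x, gap f q p x ≤ M)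
    (hM1 : M ≤ 1) (hl : l ≤ q') (x : ℝ) :
    |nonlin f l x| ≤ 12 * bigK V ^ 4 * √M / gap f q p x := by
  have hx := h.gap_pos x
  have hM0 := hx.trans_le (hM x)
  have hK := bigK_pos V
  have hK1 := one_le_bigK hV1
  set m := gap f q p x with hm
  set P₀ := rootD f l x with hP₀
  have hP₀pos : 0 < P₀ := rootD_pos f l x
  obtain ⟨ξ, hξ, h1⟩ := exists_eq_mul_sub (show x ≤ x + m by linarith) (h.hasDerivAt_logD l)
  have h2 := h.logD_cocycle l x
  rw [← hm] at h2
  have h3 : |nonlin f l ξ| ≤ 10 * bigK V ^ 3 * √M / m := by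
    rw [le_div_iff₀ hx]
    have h4 : nonlin f l ξ * m = logD f q (f^[l] x) - logD f q x := by
      rw [add_sub_cancel_left] at h1; linarith
    rw [← abs_of_pos hx, ← abs_mul, h4]
    refine (abs_sub _ _).trans ?_
    have := h.abs_logD_le_sqrt hV1 hV hV' hM (f^[l] x)
    have := h.abs_logD_le_sqrt hV1 hV hV' hM x
    linarith
  have h5 := abs_sub_le_of_deriv_bound hξ.1 (h.hasDerivAt_deriv_rootD l)
    (fun t ht => h.abs_schw_mul_rootD_le hV1 hV hV' hM hl ⟨ht.1, ht.2.trans hξ.2⟩ (h.left_mem x))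
  rw [← hP₀, ← hm] at h5
  have h6 : bigK V ^ 2 * M * P₀ / m ^ 2 * (ξ - x) ≤ bigK V ^ 2 * M * P₀ / m := by
    calc bigK V ^ 2 * M * P₀ / m ^ 2 * (ξ - x) ≤ bigK V ^ 2 * M * P₀ / m ^ 2 * m := by
          gcongr; linarith [hξ.2]
      _ = _ := by field_simp
  have h7 : |-nonlin f l ξ * rootD f l ξ / 2| ≤ 5 * bigK V ^ 4 * √M * P₀ / m := by
    rw [abs_div, abs_mul, abs_neg, abs_of_pos (rootD_pos f l ξ), abs_two]
    have := h.rootD_le_bigK_mul hV1 hV hl hξ (h.left_mem x)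
    calc |nonlin f l ξ| * rootD f l ξ / 2
        ≤ (10 * bigK V ^ 3 * √M / m) * (bigK V * P₀) / 2 := by
          gcongr
          exact (rootD_pos f l ξ).le
      _ = _ := by ring
  have hMs : M ≤ √M := by
    apply Real.le_sqrt_of_sq_le; nlinarith
  have h8 : |-nonlin f l x * P₀ / 2| ≤ 6 * bigK V ^ 4 * √M * P₀ / m := by
    have h9 : |-nonlin f l x * P₀ / 2| ≤ 5 * bigK V ^ 4 * √M * P₀ / m
        + bigK V ^ 2 * M * P₀ / m := by
      have := abs_sub_abs_le_abs_sub (-nonlin f l x * P₀ / 2) (-nonlin f l ξ * rootD f l ξ / 2)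
      rw [abs_sub_comm] at this
      linarith
    have b4 : bigK V ^ 2 ≤ bigK V ^ 4 := pow_le_pow_right₀ hK1 (by norm_num)
    have : bigK V ^ 2 * M * P₀ / m ≤ bigK V ^ 4 * √M * P₀ / m := by gcongr
    refine h9.trans ((add_le_add_right this _).trans (le_of_eq ?_))
    ring
  rw [abs_div, abs_mul, abs_neg, abs_of_pos hP₀pos, abs_two] at h8
  have h9 : |nonlin f l x| * P₀ ≤ 12 * bigK V ^ 4 * √M / m * P₀ := by
    have : 12 * bigK V ^ 4 * √M / m * P₀ = 2 * (6 * bigK V ^ 4 * √M * P₀ / m) := by ring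
    rw [this]; linarith
  exact le_of_mul_le_mul_right h9 hP₀pos

end IsPair

/-- The derivatives of `u` at `x` up to order `K` are bounded by `B * L ^ k`. -/
def JetLe (K : ℕ) (u : ℝ → ℝ) (x B L : ℝ) : Prop := ∀ k ≤ K, |iteratedDeriv k u x| ≤ B * L ^ k

namespace JetLe
variable {K : ℕ} {u v : ℝ → ℝ} {x B B' L : ℝ}

theorem nonneg (h : JetLe K u x B L) : 0 ≤ B := by
  simpa using (abs_nonneg _).trans (h 0 (Nat.zero_le _))

theorem mono {K' : ℕ} (h : JetLe K u x B L) (hK : K' ≤ K) (hB : B ≤ B') (hL : 0 ≤ L) :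
    JetLe K' u x B' L := fun k hk => (h k (hk.trans hK)).trans (by gcongr)

theorem mul (hu : ContDiff ℝ (⊤ : ℕ∞) u) (hv : ContDiff ℝ (⊤ : ℕ∞) v) (hL : 0 ≤ L)
    (h : JetLe K u x B L) (h' : JetLe K v x B' L) :
    JetLe K (fun t => u t * v t) x (2 ^ K * (B * B')) L := by
  intro k hk
  have hB := h.nonneg
  have hB' := h'.nonneg
  change |iteratedDeriv k (u * v) x| ≤ _
  rw [iteratedDeriv_mul (hu.of_le (by exact_mod_cast le_top)).contDiffAt
    (hv.of_le (by exact_mod_cast le_top)).contDiffAt]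
  calc |∑ i ∈ Finset.range (k + 1), (k.choose i : ℝ) * iteratedDeriv i u x *
        iteratedDeriv (k - i) v x|
      ≤ ∑ i ∈ Finset.range (k + 1), (k.choose i : ℝ) * (B * B' * L ^ k) := by
        refine (Finset.abs_sum_le_sum_abs _ _).trans (Finset.sum_le_sum fun i hi => ?_)
        have hi : i ≤ k := Nat.lt_succ_iff.1 (Finset.mem_range.1 hi)
        rw [abs_mul, abs_mul, Nat.abs_cast, mul_assoc]
        have h1 := h i (hi.trans hk)
        have h2 := h' (k - i) ((Nat.sub_le _ _).trans hk)
        refine mul_le_mul_of_nonneg_left ?_ (Nat.cast_nonneg _)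
        calc _ ≤ (B * L ^ i) * (B' * L ^ (k - i)) := by gcongr
          _ = B * B' * L ^ k := by rw [← Nat.add_sub_of_le hi, pow_add]; simp; ring
    _ = 2 ^ k * (B * B' * L ^ k) := by
        rw [← Finset.sum_mul]
        congr 1
        exact_mod_cast Nat.sum_range_choose k
    _ ≤ 2 ^ K * (B * B' * L ^ k) := by gcongr; norm_num
    _ = _ := by ring

theorem comp {D : ℝ} (hu : ContDiff ℝ (⊤ : ℕ∞) u) (hv : ContDiff ℝ (⊤ : ℕ∞) v) (hL : 0 ≤ L)
    (hD : 1 ≤ D) (h : ∀ k ≤ K, |iteratedDeriv k u (v x)| ≤ B)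
    (h' : ∀ k, 1 ≤ k → k ≤ K → |iteratedDeriv k v x| ≤ D * L ^ k) :
    JetLe K (fun t => u (v t)) x (K.factorial * B * D ^ K) L := by
  intro k hk
  have hB := (abs_nonneg _).trans (h 0 (Nat.zero_le _))
  have := norm_iteratedFDeriv_comp_le hu hv (n := k) (by exact_mod_cast le_top) x (C := B)
    (D := D * L)
    (fun i hi => by
      rw [norm_iteratedFDeriv_eq_norm_iteratedDeriv]; exact h i (hi.trans hk))
    (fun i h1 hi => by
      rw [norm_iteratedFDeriv_eq_norm_iteratedDeriv, mul_pow]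
      refine (h' i h1 (hi.trans hk)).trans ?_
      gcongr
      exact le_self_pow₀ hD (by lia))
  rw [norm_iteratedFDeriv_eq_norm_iteratedDeriv] at this
  change |iteratedDeriv k (u ∘ v) x| ≤ _
  refine this.trans ?_
  rw [mul_pow, ← mul_assoc]
  gcongr

theorem of_deriv (h0 : |u x| ≤ B) (h : JetLe K (deriv u) x (B * L) L) : JetLe (K + 1) u x B L := by
  rintro (_ | k) hk
  · simpa using h0
  · rw [iteratedDeriv_succ']
    refine (h k (by lia)).trans_eq ?_
    ring

theorem sum {ι : Type*} {s : Finset ι} {w : ι → ℝ → ℝ} {b : ι → ℝ}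
    (hw : ∀ i ∈ s, ContDiff ℝ (⊤ : ℕ∞) (w i)) (h : ∀ i ∈ s, JetLe K (w i) x (b i) L) :
    JetLe K (fun t => ∑ i ∈ s, w i t) x (∑ i ∈ s, b i) L := by
  intro k hk
  rw [iteratedDeriv_fun_sum (fun i hi => ((hw i hi).of_le (by exact_mod_cast le_top)).contDiffAt),
    Finset.sum_mul]
  exact (Finset.abs_sum_le_sum_abs _ _).trans (Finset.sum_le_sum fun i hi => h i hi k hk)

theorem const_mul (c : ℝ) (h : JetLe K u x B L) : JetLe K (fun t => c * u t) x (|c| * B) L := by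
  intro k hk
  rw [iteratedDeriv_const_mul_field, abs_mul, mul_assoc]
  gcongr
  exact h k hk

theorem add (hu : ContDiff ℝ (⊤ : ℕ∞) u) (hv : ContDiff ℝ (⊤ : ℕ∞) v) (h : JetLe K u x B L)
    (h' : JetLe K v x B' L) : JetLe K (fun t => u t + v t) x (B + B') L := by
  intro k hk
  rw [iteratedDeriv_fun_add (hu.of_le (by exact_mod_cast le_top)).contDiffAt
    (hv.of_le (by exact_mod_cast le_top)).contDiffAt, add_mul]
  exact (abs_add_le _ _).trans (add_le_add (h k hk) (h' k hk))

/-- Jets of solutions of the linear equation `u' = a u`. -/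
theorem of_linear_ode (K : ℕ) {C : ℝ} (hC : 1 ≤ C) : ∃ C', 1 ≤ C' ∧ ∀ (u a : ℝ → ℝ) (x L : ℝ),
    ContDiff ℝ (⊤ : ℕ∞) u → ContDiff ℝ (⊤ : ℕ∞) a → 0 ≤ L → (∀ t, HasDerivAt u (a t * u t) t) →
    JetLe K a x (C * L) L → JetLe (K + 1) u x (C' * |u x|) L := by
  suffices H : ∀ J ≤ K + 1, ∃ C', 1 ≤ C' ∧ ∀ (u a : ℝ → ℝ) (x L : ℝ),
    ContDiff ℝ (⊤ : ℕ∞) u → ContDiff ℝ (⊤ : ℕ∞) a → 0 ≤ L → (∀ t, HasDerivAt u (a t * u t) t) →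
    JetLe K a x (C * L) L → JetLe J u x (C' * |u x|) L from H _ le_rfl
  intro J
  induction J with
  | zero =>
    refine fun _ => ⟨1, le_rfl, fun u a x L _ _ _ _ _ k hk => ?_⟩
    obtain rfl : k = 0 := by lia
    simp
  | succ J ih =>
    intro hJ
    obtain ⟨C₁, h1, H⟩ := ih (by lia)
    have h2 : (1 : ℝ) ≤ 2 ^ J := one_le_pow₀ (by norm_num)
    have h3 : 1 ≤ 2 ^ J * (C * C₁) := one_le_mul_of_one_le_of_one_le h2
      (one_le_mul_of_one_le_of_one_le hC h1)
    refine ⟨2 ^ J * (C * C₁), h3, fun u a x L hu ha hL hd hj => ?_⟩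
    have h4 : _root_.deriv u = fun t => a t * u t := funext fun t => (hd t).deriv
    refine of_deriv ?_ ?_
    · exact le_mul_of_one_le_left (abs_nonneg _) h3
    · rw [h4]
      refine (mul ha hu hL (hj.mono (by lia) le_rfl hL) (H u a x L hu ha hL hd hj)).mono le_rfl
        (le_of_eq (by ring)) hL

end JetLe

theorem IsPair.deriv_iterate_le_mul_sqrt {f : ℝ → ℝ} {ρ : ℝ} {q q' : ℕ} {p p' : ℤ} {V M : ℝ} {l : ℕ}
    (h : IsPair f ρ q p q' p') (hV : ∀ x, |nonlin f 1 x| ≤ V) (hM : ∀ x, gap f q p x ≤ M)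
    (hM1 : M ≤ 1) (hl : l ≤ q') (x : ℝ) :
    deriv f^[l] x ≤ Real.exp V * (√M / gap f q p x) := by
  have hx := h.gap_pos x
  refine (h.deriv_iterate_le hV hl (h.left_mem x)).trans ?_
  gcongr
  refine (hM _).trans (Real.le_sqrt_of_sq_le ?_)
  have := hx.trans_le (hM x)
  nlinarith

/-- Bounds for all derivatives of the nonlinearity of the iterates up to the next closest return
time. -/
theorem SmoothLift.exists_jetLe_nonlin {f : ℝ → ℝ} (hf : SmoothLift f) (r : ℕ) : ∃ C, 1 ≤ C ∧
    ∀ {ρ : ℝ} {q q' : ℕ} {p p' : ℤ} {M : ℝ}, IsPair f ρ q p q' p' → (∀ x, gap f q p x ≤ M) →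
    M ≤ 1 → ∀ l ≤ q', ∀ x, JetLe r (nonlin f l) x (C * (√M / gap f q p x)) (√M / gap f q p x) := by
  obtain ⟨V₀, -, hV₀⟩ := exists_bound_of_periodic (hf.contDiff_nonlin 1).continuous
    (hf.nonlin_add_one 1)
  obtain ⟨V₁, -, hV₁⟩ := exists_bound_of_periodic (hf.contDiff_schw 1).continuous
    (hf.schw_add_one 1)
  obtain ⟨V, hV1, hV, hV'⟩ : ∃ V, 1 ≤ V ∧ (∀ x, |nonlin f 1 x| ≤ V) ∧ ∀ x, |schw f 1 x| ≤ V :=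
    ⟨max 1 (max V₀ V₁), le_max_left _ _,
      fun x => (hV₀ x).trans ((le_max_left _ _).trans (le_max_right _ _)),
      fun x => (hV₁ x).trans ((le_max_right _ _).trans (le_max_right _ _))⟩
  have hK1 := one_le_bigK hV1
  have hKp := bigK_pos V
  have h12 : 1 ≤ 12 * bigK V ^ 4 := by
    have := one_le_pow₀ hK1 (n := 4); linarith
  induction r with
  | zero =>
    refine ⟨12 * bigK V ^ 4, h12, fun h hM hM1 l hl x k hk => ?_⟩
    obtain rfl : k = 0 := by lia
    simpa [mul_div_assoc] using h.abs_nonlin_le_sqrt hV1 hV hV' hM hM1 hl x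
  | succ r ih =>
    obtain ⟨C, hC, H⟩ := ih
    obtain ⟨C₁, hC₁, H₁⟩ := JetLe.of_linear_ode r hC
    choose b hb0 hb using fun k => exists_bound_iteratedDeriv (hf.contDiff_schw 1)
      (hf.schw_add_one 1) k
    obtain ⟨B, hB0, hbB⟩ : ∃ B, 0 ≤ B ∧ ∀ k ≤ r, ∀ x, |iteratedDeriv k (schw f 1) x| ≤ B := by
      refine ⟨∑ k ∈ Finset.range (r + 1), b k, Finset.sum_nonneg fun i _ => (hb0 i).le, ?_⟩
      exact fun k hk x =>
      (hb k x).trans (Finset.single_le_sum (f := b) (fun i _ => (hb0 i).le)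
        (Finset.mem_range.2 (by lia)))
    set eV := Real.exp V with heV
    have heV1 : 1 ≤ eV := Real.one_le_exp (by linarith)
    have hD1 : 1 ≤ C₁ * eV := one_le_mul_of_one_le_of_one_le hC₁ heV1
    set Q := 2 ^ r * ((r.factorial * B * (C₁ * eV) ^ r) * (2 ^ r * (C₁ * C₁))) * Real.exp (2 * V)
      with hQ
    have hQ0 : 0 ≤ Q := by positivity
    set C₂ := 12 * bigK V ^ 4 + (Q + |(1 / 2 : ℝ)| * (2 ^ r * (C * C))) with hC₂
    refine ⟨C₂, by rw [hC₂]; exact h12.trans (le_add_of_nonneg_right (by positivity)),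
      fun h hM hM1 l hl x => ?_⟩
    rename_i ρ q q' p p' M
    have hx := h.gap_pos x
    have hM0 : 0 < M := hx.trans_le (hM x)
    set L := √M / gap f q p x with hL
    have hLpos : 0 < L := by positivity
    refine JetLe.of_deriv ?_ ?_
    · refine (h.abs_nonlin_le_sqrt hV1 hV hV' hM hM1 hl x).trans ?_
      rw [mul_div_assoc, ← hL, hC₂]
      gcongr
      exact le_add_of_nonneg_right (by positivity)
    · have hE : ∀ i ≤ q', JetLe (r + 1) (deriv f^[i]) x (C₁ * deriv f^[i] x) L := fun i hi => by
        have := H₁ (deriv f^[i]) (nonlin f i) x L ((hf.iterate i).contDiff_deriv)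
          (hf.contDiff_nonlin i) hLpos.le (hf.hasDerivAt_deriv_iterate i) (H h hM hM1 i hi x)
        rwa [abs_of_pos ((hf.iterate i).deriv_pos x)] at this
      have hS : JetLe r (schw f l) x (Q * L ^ 2) L := by
        have e1 : schw f l = fun t => ∑ i ∈ Finset.range l,
            schw f 1 (f^[i] t) * (deriv f^[i] t * deriv f^[i] t) := by
          ext t; rw [hf.schw_eq_sum]; simp only [sq]
        rw [e1]
        have e2 := JetLe.sum (K := r) (x := x) (L := L) (s := Finset.range l)
          (w := fun i t => schw f 1 (f^[i] t) * (deriv f^[i] t * deriv f^[i] t))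
          (b := fun i => 2 ^ r * ((r.factorial * B * (C₁ * eV) ^ r) *
            (2 ^ r * ((C₁ * deriv f^[i] x) * (C₁ * deriv f^[i] x)))))
          (fun i _ => ((hf.contDiff_schw 1).comp (hf.iterate i).contDiff).mul
            ((hf.iterate i).contDiff_deriv.mul (hf.iterate i).contDiff_deriv))
          (fun i hi => by
            have hi : i ≤ q' := (Finset.mem_range.1 hi).le.trans hl
            refine JetLe.mul ((hf.contDiff_schw 1).comp (hf.iterate i).contDiff)
              ((hf.iterate i).contDiff_deriv.mul (hf.iterate i).contDiff_deriv) hLpos.le ?_ ?_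
            · refine JetLe.comp (hf.contDiff_schw 1) (hf.iterate i).contDiff hLpos.le hD1
                (fun k hk => hbB k hk _) ?_
              rintro (_ | k) h1 hk
              · lia
              · rw [iteratedDeriv_succ']
                refine (hE i hi k (by lia)).trans ?_
                have := h.deriv_iterate_le_mul_sqrt hV hM hM1 hi x
                rw [← hL, ← heV] at this
                calc C₁ * deriv f^[i] x * L ^ k ≤ C₁ * (eV * L) * L ^ k := by gcongr
                  _ = _ := by ring
            · exact JetLe.mul (hf.iterate i).contDiff_deriv (hf.iterate i).contDiff_deriv hLpos.le
                ((hE i hi).mono (by lia) le_rfl hLpos.le) ((hE i hi).mono (by lia) le_rfl hLpos.le))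
        refine e2.mono le_rfl ?_ hLpos.le
        have e3 := h.sum_deriv_iterate_sq_le hV hM hl (h.left_mem x)
        have e4 : Real.exp (2 * V) * M / gap f q p x ^ 2 = Real.exp (2 * V) * L ^ 2 := by
          rw [hL, div_pow, Real.sq_sqrt hM0.le]; ring
        rw [e4] at e3
        calc _ = 2 ^ r * ((r.factorial * B * (C₁ * eV) ^ r) * (2 ^ r * (C₁ * C₁))) *
              ∑ i ∈ Finset.range l, deriv f^[i] x ^ 2 := by
              rw [Finset.mul_sum]; refine Finset.sum_congr rfl fun i _ => ?_; ring
          _ ≤ 2 ^ r * ((r.factorial * B * (C₁ * eV) ^ r) * (2 ^ r * (C₁ * C₁))) *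
              (Real.exp (2 * V) * L ^ 2) := by gcongr
          _ = _ := by rw [hQ]; ring
      have hd : deriv (nonlin f l) = fun t => schw f l t + 1 / 2 * (nonlin f l t * nonlin f l t) :=
        funext fun t => by rw [(hf.hasDerivAt_nonlin l t).deriv]; ring
      rw [hd]
      have hA := H h hM hM1 l hl x
      refine (JetLe.add (hf.contDiff_schw l)
        (contDiff_const.mul ((hf.contDiff_nonlin l).mul (hf.contDiff_nonlin l))) hS
        ((JetLe.mul (hf.contDiff_nonlin l) (hf.contDiff_nonlin l) hLpos.le hA hA).const_mul
          (1 / 2))).mono le_rfl ?_ hLpos.le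
      calc _ = (Q + |(1 / 2 : ℝ)| * (2 ^ r * (C * C))) * L ^ 2 := by rw [← hL]; ring
        _ ≤ C₂ * L ^ 2 := by
          gcongr; rw [hC₂]; exact le_add_of_nonneg_left (by positivity)
        _ = _ := by ring

theorem hasDerivAt_of_contDiff {u : ℝ → ℝ} (hu : ContDiff ℝ (⊤ : ℕ∞) u) (x : ℝ) :
    HasDerivAt u (deriv u x) x := (hu.differentiable (by simp) x).hasDerivAt

/-- A function which is small at `2 ^ K` separated nodes and whose `K`-th derivative is small has
all intermediate derivatives small. -/
theorem exists_node_bound (K : ℕ) {R : ℝ} (hR : 0 ≤ R) : ∃ C, 0 ≤ C ∧ ∀ (v : ℝ → ℝ),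
    ContDiff ℝ (⊤ : ℕ∞) v → ∀ (a b d η B : ℝ) (t : ℕ → ℝ), 0 < d → b - a ≤ R * d →
    (∀ i < 2 ^ K, t i ∈ Icc a b) → (∀ i, i + 1 < 2 ^ K → t i + d ≤ t (i + 1)) →
    (∀ i < 2 ^ K, |v (t i)| ≤ η) → (∀ y ∈ Icc a b, |iteratedDeriv K v y| ≤ B) →
    ∀ j ≤ K, ∀ y ∈ Icc a b, |iteratedDeriv j v y| * d ^ j ≤ C * (η + B * d ^ K) := by
  induction K with
  | zero =>
    refine ⟨1, zero_le_one, fun v _ a b d η B t _ _ _ _ hη hB j hj y hy => ?_⟩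
    obtain rfl : j = 0 := by lia
    have h1 := (abs_nonneg _).trans (hη 0 (by simp))
    have h2 := hB y hy
    simp only [iteratedDeriv_zero, pow_zero, mul_one, one_mul] at *
    linarith
  | succ K ih =>
    obtain ⟨C, hC, H⟩ := ih
    refine ⟨1 + 2 * C * (R + 1), by positivity,
      fun v hv a b d η B t hd hab ht htd hη hB j hj y hy => ?_⟩
    have hv' : ContDiff ℝ (⊤ : ℕ∞) (deriv v) := (contDiff_infty_iff_deriv.1 hv).2
    have hη0 := (abs_nonneg _).trans (hη 0 (by positivity))
    have hB0 := (abs_nonneg _).trans (hB y hy)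
    have hlt : ∀ i < 2 ^ K, 2 * i + 1 < 2 ^ (K + 1) := fun i hi => by rw [pow_succ]; lia
    have hs : ∀ i < 2 ^ K, t (2 * i) + d ≤ t (2 * i + 1) := fun i hi => htd _ (hlt i hi)
    have hex : ∀ i, ∃ ξ, i < 2 ^ K → ξ ∈ Icc (t (2 * i)) (t (2 * i + 1)) ∧
        v (t (2 * i + 1)) - v (t (2 * i)) = deriv v ξ * (t (2 * i + 1) - t (2 * i)) := fun i => by
      by_cases hi : i < 2 ^ K
      · obtain ⟨ξ, h1, h2⟩ := exists_eq_mul_sub (x := t (2 * i)) (y := t (2 * i + 1))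
          (by linarith [hs i hi]) (hasDerivAt_of_contDiff hv)
        exact ⟨ξ, fun _ => ⟨h1, h2⟩⟩
      · exact ⟨0, fun h => absurd h hi⟩
    choose ξ hξ using hex
    have key := H (deriv v) hv' a b d (2 * η / d) B ξ hd hab
      (fun i hi => ⟨(ht _ (by have := hlt i hi; lia)).1.trans (hξ i hi).1.1,
        (hξ i hi).1.2.trans (ht _ (hlt i hi)).2⟩)
      (fun i hi => by
        have h1 := (hξ i (by lia)).1.2
        have h2 := (hξ (i + 1) hi).1.1
        have h3 := htd (2 * i + 1) (by have := hlt (i + 1) hi; lia)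
        rw [show 2 * i + 1 + 1 = 2 * (i + 1) by ring] at h3
        linarith)
      (fun i hi => by
        have h1 := (hξ i hi).2
        have h2 := hη _ (hlt i hi)
        have h3 := hη (2 * i) (by have := hlt i hi; lia)
        have h4 : |deriv v (ξ i)| * d ≤ 2 * η := by
          calc |deriv v (ξ i)| * d ≤ |deriv v (ξ i)| * |t (2 * i + 1) - t (2 * i)| := by
                gcongr; rw [le_abs]; left; linarith [hs i hi]
            _ = |v (t (2 * i + 1)) - v (t (2 * i))| := by rw [h1, abs_mul]
            _ ≤ _ := by refine (abs_sub _ _).trans ?_; linarith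
        rwa [le_div_iff₀ hd])
      (fun y hy => by rw [← iteratedDeriv_succ']; exact hB y hy)
    have e1 : (2 * η / d + B * d ^ K) * d = 2 * η + B * d ^ (K + 1) := by
      field_simp; ring
    have h0 : 0 ≤ B * d ^ (K + 1) := by positivity
    rcases j with _ | j
    · have h1 : |v y - v (t 0)| ≤ C * (2 * η / d + B * d ^ K) * |y - t 0| := by
        have := Convex.norm_image_sub_le_of_norm_deriv_le (s := Icc a b) (f := v) (x := t 0) (y := y)
          (fun x _ => hv.differentiable (by simp) x)
          (fun x hx => by simpa using key 0 (Nat.zero_le _) x hx) (convex_Icc a b)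
          (ht 0 (by positivity)) hy
        simpa using this
      have h2 : |y - t 0| ≤ R * d := by
        have h3 := ht 0 (by positivity)
        rw [abs_le]; constructor <;> linarith [h3.1, h3.2, hy.1, hy.2]
      have h3 : |v y| ≤ η + C * (2 * η / d + B * d ^ K) * (R * d) := by
        have h4 := hη 0 (by positivity)
        have h5 : |v y| ≤ |v y - v (t 0)| + |v (t 0)| := by
          simpa using abs_add_le (v y - v (t 0)) (v (t 0))
        have h6 : C * (2 * η / d + B * d ^ K) * |y - t 0| ≤
          C * (2 * η / d + B * d ^ K) * (R * d) := by gcongr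
        linarith
      have h4 : C * (2 * η / d + B * d ^ K) * (R * d) = C * R * (2 * η + B * d ^ (K + 1)) := by
        rw [← e1]; ring
      rw [h4] at h3
      simp only [iteratedDeriv_zero, pow_zero, mul_one]
      nlinarith [mul_nonneg hC h0, mul_nonneg hC hη0, mul_nonneg (mul_nonneg hC hR) h0]
    · have h1 := key j (by lia) y hy
      rw [← iteratedDeriv_succ'] at h1
      have h2 : |iteratedDeriv (j + 1) v y| * d ^ (j + 1) ≤ C * (2 * η + B * d ^ (K + 1)) := by
        rw [← e1, pow_succ, ← mul_assoc, ← mul_assoc]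
        gcongr
      nlinarith [mul_nonneg hC h0, mul_nonneg hC hη0, mul_nonneg (mul_nonneg hC hR) h0,
        mul_nonneg (mul_nonneg hC hR) hη0]

theorem Real.abs_exp_sub_one_le_mul {a c : ℝ} (h : |a| ≤ c) : |Real.exp a - 1| ≤ Real.exp c * c := by
  obtain ⟨ξ, hξ, h1⟩ : ∃ ξ, ξ ≤ c ∧ Real.exp a - 1 = Real.exp ξ * a := by
    rcases le_total 0 a with h0 | h0
    · obtain ⟨ξ, hξ, h1⟩ := exists_eq_mul_sub h0 (fun t => Real.hasDerivAt_exp t)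
      exact ⟨ξ, hξ.2.trans ((le_abs_self a).trans h), by simpa using h1⟩
    · obtain ⟨ξ, hξ, h1⟩ := exists_eq_mul_sub h0 (fun t => Real.hasDerivAt_exp t)
      refine ⟨ξ, hξ.2.trans ((abs_nonneg a).trans h), ?_⟩
      rw [Real.exp_zero] at h1
      linarith
  rw [h1, abs_mul, abs_of_pos (Real.exp_pos _)]
  gcongr

theorem SmoothLift.exists_comparison {f : ℝ → ℝ} (hf : SmoothLift f) : ∃ C, 1 ≤ C ∧
    ∀ {ρ : ℝ} {q q' : ℕ} {p p' : ℤ} {M : ℝ}, IsPair f ρ q p q' p' → (∀ x, gap f q p x ≤ M) →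
    M ≤ 1 → (∀ x, |deriv f^[q] x - 1| ≤ C * √M) ∧
    (∀ y z, z ∈ Icc y (y + gap f q p y) → gap f q p y ≤ C * gap f q p z ∧
      gap f q p z ≤ C * gap f q p y) ∧
    (∀ l ≤ q', ∀ x, deriv f^[l] x ≤ C * (gap f q p (f^[l] x) / gap f q p x)) ∧
    (∀ l ≤ q', ∀ x, gap f q p (f^[l] x) / gap f q p x ≤ C * deriv f^[l] x) := by
  obtain ⟨V₀, -, hV₀⟩ := exists_bound_of_periodic (hf.contDiff_nonlin 1).continuous
    (hf.nonlin_add_one 1)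
  obtain ⟨V₁, -, hV₁⟩ := exists_bound_of_periodic (hf.contDiff_schw 1).continuous
    (hf.schw_add_one 1)
  obtain ⟨V, hV1, hV, hV'⟩ : ∃ V, 1 ≤ V ∧ (∀ x, |nonlin f 1 x| ≤ V) ∧ ∀ x, |schw f 1 x| ≤ V :=
    ⟨max 1 (max V₀ V₁), le_max_left _ _,
      fun x => (hV₀ x).trans ((le_max_left _ _).trans (le_max_right _ _)),
      fun x => (hV₁ x).trans ((le_max_right _ _).trans (le_max_right _ _))⟩
  have hK1 := one_le_bigK hV1
  have hKp := bigK_pos V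
  set c := 5 * bigK V ^ 3 with hc
  have hc0 : 0 ≤ c := by positivity
  refine ⟨bigK V + Real.exp c * c, le_add_of_le_of_nonneg hK1 (by positivity),
    fun {ρ q q' p p' M} h hM hM1 => ⟨fun x => ?_, fun y z hz => ?_, fun l hl x => ?_,
      fun l hl x => ?_⟩⟩
  · have h1 := h.abs_logD_le_sqrt hV1 hV hV' hM x
    have h2 : √M ≤ 1 := Real.sqrt_le_one.2 hM1
    rw [← hf.exp_logD]
    refine (Real.abs_exp_sub_one_le_mul h1).trans ?_
    calc Real.exp (c * √M) * (c * √M) ≤ Real.exp c * (c * √M) := by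
          gcongr
          exact mul_le_of_le_one_right hc0 h2
      _ = Real.exp c * c * √M := by ring
      _ ≤ _ := by gcongr; linarith
  · have h1 := h.gap_le_bigK_mul hV1 hV hz
    have h3 := h.gap_pos y
    have h4 := h.gap_pos z
    have h5 : 0 ≤ Real.exp c * c := by positivity
    constructor <;> nlinarith
  · have h3 : 0 < gap f q p (f^[l] x) / gap f q p x := div_pos (h.gap_pos _) (h.gap_pos _)
    refine (h.deriv_iterate_le hV hl (h.left_mem x)).trans ?_
    gcongr
    have : Real.exp V ≤ bigK V := Real.exp_le_exp.2 (by linarith)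
    have h5 : 0 ≤ Real.exp c * c := by positivity
    linarith
  · have h3 := h.gap_pos x
    obtain ⟨ξ, hξ, h4⟩ := h.exists_deriv_iterate_eq l x
    rw [h4, mul_div_assoc, div_self h3.ne', mul_one]
    refine (h.deriv_iterate_le_exp_mul hV hl hξ (h.left_mem x)).trans ?_
    have : Real.exp V ≤ bigK V := Real.exp_le_exp.2 (by linarith)
    have h5 : 0 ≤ Real.exp c * c := by positivity
    have := (hf.iterate l).deriv_pos x
    gcongr
    linarith

namespace IsPair
variable {f : ℝ → ℝ} {ρ : ℝ} {q q' : ℕ} {p p' : ℤ} {C M : ℝ}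

theorem gap'_neg (h : IsPair f ρ q p q' p') (x : ℝ) : gap f q' p' x < 0 := by
  have := h.toRotLift.iterate_lt (d := q') (k := p') (by linarith [h.neg]) x
  rw [gap]; linarith

theorem neg_gap'_lt (h : IsPair f ρ q p q' p') (x : ℝ) :
    -gap f q' p' x < gap f q p (f^[q'] x - p') := by
  have h1 := h.toRotLift.lt_of_lt (a := 0) (b := q + q') (k := 0) (k' := -p - p')
    (by push_cast; linarith [h.lt]) x
  rw [gap, gap, (h.toSmoothLift.iterate q).map_sub_int, ← Function.iterate_add_apply]
  push_cast at h1
  simp at h1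
  linarith

/-- The commutation of the two return maps. -/
theorem gap'_return (h : IsPair f ρ q p q' p') (x : ℝ) :
    gap f q' p' (f^[q] x - p) = f^[q] (f^[q'] x - p') - f^[q] x := by
  rw [gap, (h.toSmoothLift.iterate q').map_sub_int, (h.toSmoothLift.iterate q).map_sub_int,
    ← Function.iterate_add_apply, ← Function.iterate_add_apply, add_comm]
  ring

theorem abs_gap_sub_le (h : IsPair f ρ q p q' p') {c : ℝ} (hC : ∀ x, |deriv f^[q] x - 1| ≤ c)
    {y x : ℝ} (hyx : y ≤ x) : |gap f q p x - gap f q p y| ≤ c * (x - y) :=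
  abs_sub_le_of_deriv_bound hyx (h.hasDerivAt_gap q p) (fun t _ => hC t)

theorem abs_gap'_return_sub_le (h : IsPair f ρ q p q' p') {c : ℝ}
    (hC : ∀ x, |deriv f^[q] x - 1| ≤ c) (x : ℝ) :
    |gap f q' p' (f^[q] x - p) - gap f q' p' x| ≤ c * -gap f q' p' x := by
  have h1 := h.abs_gap_sub_le hC (y := f^[q'] x - p') (x := x)
    (by have := h.gap'_neg x; rw [gap] at this; linarith)
  rw [h.gap'_return]
  rw [abs_sub_comm] at h1
  convert h1 using 2 <;> simp only [gap] <;> ring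

end IsPair

namespace IsPair
variable {f : ℝ → ℝ} {ρ : ℝ} {q q' : ℕ} {p p' : ℤ} {C M : ℝ}

/-- The points of the orbit of `x` under the first return map. -/
theorem return_iterate_succ (x : ℝ) (j : ℕ) :
    (fun t => f^[q] t - p)^[j + 1] x =
      (fun t => f^[q] t - p)^[j] x + gap f q p ((fun t => f^[q] t - p)^[j] x) := by
  rw [Function.iterate_succ_apply', gap]; ring

theorem return_monotone (h : IsPair f ρ q p q' p') (x : ℝ) :
    Monotone fun j : ℕ => (fun t => f^[q] t - p)^[j] x :=
  monotone_nat_of_le_succ fun j => by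
    rw [return_iterate_succ]; linarith [h.gap_pos ((fun t => f^[q] t - p)^[j] x)]

theorem gap_comparable (h : IsPair f ρ q p q' p') (hC1 : 1 ≤ C)
    (hC : ∀ y z, z ∈ Icc y (y + gap f q p y) → gap f q p y ≤ C * gap f q p z ∧
      gap f q p z ≤ C * gap f q p y) (N : ℕ) (x y : ℝ)
    (hy : y ∈ Icc x ((fun t => f^[q] t - p)^[N] x)) :
    gap f q p x ≤ C ^ N * gap f q p y ∧ gap f q p y ≤ C ^ N * gap f q p x := by
  induction N generalizing x with
  | zero =>
    obtain rfl : y = x := le_antisymm hy.2 hy.1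
    simp
  | succ N ih =>
    have hx := h.gap_pos x
    have hyp := h.gap_pos y
    have hC0 : 0 ≤ C := by linarith
    rcases le_total y (x + gap f q p x) with h1 | h1
    · have h2 := hC x y ⟨hy.1, h1⟩
      have h3 : C ≤ C ^ (N + 1) := le_self_pow₀ hC1 (by simp)
      exact ⟨h2.1.trans (by gcongr), h2.2.trans (by gcongr)⟩
    · have e : x + gap f q p x = f^[q] x - p := by rw [gap]; ring
      rw [e] at h1
      have h2 := ih (f^[q] x - p) ⟨h1, hy.2⟩
      have h3 := hC x (f^[q] x - p) ⟨by rw [← e]; linarith, e.ge⟩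
      constructor
      · calc _ ≤ C * _ := h3.1
          _ ≤ C * (C ^ N * gap f q p y) := by gcongr; exact h2.1
          _ = _ := by ring
      · calc _ ≤ _ := h2.2
          _ ≤ C ^ N * (C * gap f q p x) := by gcongr; exact h3.2
          _ = _ := by ring

theorem abs_gap'_iterate_sub_le (h : IsPair f ρ q p q' p') {c : ℝ} (hc : 0 ≤ c)
    (hC : ∀ x, |deriv f^[q] x - 1| ≤ c) (x : ℝ) (j : ℕ) :
    |gap f q' p' ((fun t => f^[q] t - p)^[j] x) - gap f q' p' x| ≤
      ((1 + c) ^ j - 1) * -gap f q' p' x := by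
  induction j with
  | zero => simp
  | succ j ih =>
    rw [Function.iterate_succ_apply']
    set y := (fun t => f^[q] t - p)^[j] x
    have h1 := h.abs_gap'_return_sub_le hC y
    have h2 := h.gap'_neg x
    rw [abs_le] at *
    have h3 : -gap f q' p' y ≤ (1 + c) ^ j * -gap f q' p' x := by linarith
    have h4 := mul_le_mul_of_nonneg_left h3 hc
    rw [pow_succ]
    constructor <;> nlinarith

end IsPair

theorem one_add_pow_sub_one_le {c : ℝ} (hc : 0 ≤ c) (j : ℕ) :
    (1 + c) ^ j - 1 ≤ j * (1 + c) ^ j * c := by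
  induction j with
  | zero => simp
  | succ j ih =>
    push_cast
    rw [pow_succ]
    have h1 : 1 ≤ (1 + c) ^ j := one_le_pow₀ (by linarith)
    have h2 : 0 ≤ (j : ℝ) * (1 + c) ^ j * c := by positivity
    nlinarith [mul_nonneg hc (sub_nonneg.2 h1), mul_nonneg hc h2]

/-- The displacement of the second return map is almost constant on fundamental intervals of the
first one. -/
theorem SmoothLift.exists_gap'_variation {f : ℝ → ℝ} (hf : SmoothLift f) {K : ℕ} (hK : 1 ≤ K) :
    ∃ C, 1 ≤ C ∧ ∀ {ρ : ℝ} {q q' : ℕ} {p p' : ℤ} {M : ℝ}, IsPair f ρ q p q' p' →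
    (∀ x, gap f q p x ≤ M) → M ≤ 1 → ∀ x, ∀ y ∈ Icc x (x + gap f q p x),
      |gap f q' p' y - gap f q' p' x| ≤ C * √M * -gap f q' p' x + C * √M ^ K * gap f q p x := by
  obtain ⟨C₀, hC₀, H₀⟩ := hf.exists_comparison
  obtain ⟨C₁, hC₁, H₁⟩ := hf.exists_jetLe_nonlin K
  obtain ⟨C₂, hC₂, H₂⟩ := JetLe.of_linear_ode K hC₁
  set N := 2 ^ (K + 1) with hN
  have hN1 : 1 ≤ N := Nat.one_le_two_pow
  obtain ⟨C₃, hC₃, H₃⟩ := exists_node_bound (K + 1) (R := N * (C₀ ^ N * C₀ ^ N)) (by positivity)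
  have hC0p : 0 < C₀ := by linarith
  have hCN : 1 ≤ C₀ ^ N := one_le_pow₀ hC₀
  set A := N * (1 + C₀) ^ N * C₀ with hA
  have hA0 : 0 ≤ A := by positivity
  set B := C₂ * C₀ ^ 2 * (C₀ ^ N) ^ K with hB
  have hB0 : 0 ≤ B := by positivity
  refine ⟨1 + C₃ * A + C₃ * B,
    by nlinarith [mul_nonneg hC₃ hA0, mul_nonneg hC₃ hB0], fun {ρ q q' p p' M} h hM hM1 x y hy => ?_⟩
  obtain ⟨hD, hcmp, hE, -⟩ := H₀ h hM hM1
  have hx := h.gap_pos x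
  have hu := h.gap'_neg x
  have hM0 : 0 < M := hx.trans_le (hM x)
  have hσ1 : √M ≤ 1 := Real.sqrt_le_one.2 hM1
  have hσ0 : 0 < √M := Real.sqrt_pos.2 hM0
  set σ := √M with hσ
  set m := gap f q p x with hm
  set t : ℕ → ℝ := fun j => (fun t => f^[q] t - p)^[j] x with ht
  have ht0 : t 0 = x := rfl
  have ht1 : ∀ j, t (j + 1) = t j + gap f q p (t j) := fun j => IsPair.return_iterate_succ x j
  have htm : Monotone t := h.return_monotone x
  have hcmpN := h.gap_comparable hC₀ hcmp N x
  have htj : ∀ j ≤ N, t j ∈ Icc x (t N) := fun j hj => ⟨htm (Nat.zero_le j), htm hj⟩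
  have hlen : ∀ j ≤ N, t j - x ≤ j * (C₀ ^ N * m) := by
    intro j
    induction j with
    | zero => simp [ht0]
    | succ j ih =>
      intro hj
      have h1 := ih (by lia)
      have h2 := (hcmpN (t j) (htj j (by lia))).2
      rw [ht1]; push_cast; linarith
  have hC0N : 0 < C₀ ^ N := by positivity
  have hd : 0 < m / C₀ ^ N := by positivity
  have hvc : ContDiff ℝ (⊤ : ℕ∞) (gap f q' p') := by
    unfold gap
    exact ((hf.iterate q').contDiff.sub contDiff_const).sub contDiff_id
  set v : ℝ → ℝ := fun z => -gap f q' p' x + gap f q' p' z with hv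
  have key := H₃ v (contDiff_const.add hvc) x (t N) (m / C₀ ^ N) (A * σ * -gap f q' p' x)
    (B * (σ / m) ^ K) t hd (by
      have := hlen N le_rfl
      refine this.trans_eq ?_
      field_simp)
    (fun i hi => htj i hi.le)
    (fun i hi => by
      rw [ht1, div_eq_inv_mul]
      have := (hcmpN (t i) (htj i (by lia))).1
      gcongr
      rwa [inv_mul_le_iff₀ hC0N])
    (fun i hi => by
      have h1 := h.abs_gap'_iterate_sub_le (by positivity) hD x i
      rw [hv]
      simp only
      rw [neg_add_eq_sub]
      refine h1.trans ?_
      have h2 := one_add_pow_sub_one_le (c := C₀ * σ) (by positivity) i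
      have h3 : (1 + C₀ * σ) ^ i ≤ (1 + C₀) ^ N := by
        calc (1 + C₀ * σ) ^ i ≤ (1 + C₀) ^ i := by
              gcongr; exact mul_le_of_le_one_right hC0p.le hσ1
          _ ≤ _ := pow_le_pow_right₀ (by linarith) hi.le
      have h4 : (1 + C₀ * σ) ^ i - 1 ≤ A * σ := by
        refine h2.trans ?_
        rw [hA]
        calc (i : ℝ) * (1 + C₀ * σ) ^ i * (C₀ * σ) ≤ N * (1 + C₀) ^ N * (C₀ * σ) := by
              have : (i : ℝ) ≤ N := by exact_mod_cast hi.le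
              gcongr
          _ = _ := by ring
      have : 0 ≤ -gap f q' p' x := by linarith
      gcongr)
    (fun z hz => by
      rw [hv, iteratedDeriv_const_add (by simp)]
      have hz' := hcmpN z hz
      have hzp := h.gap_pos z
      have hEz : deriv f^[q'] z ≤ C₀ ^ 2 := by
        refine (hE q' le_rfl z).trans ?_
        rw [sq]
        gcongr
        rw [div_le_iff₀ hzp]
        have h2 : gap f q p (f^[q'] z) = gap f q p (f^[q'] z - p') := by
          have := hf.gap_add_int q p (f^[q'] z - p') p'
          rwa [sub_add_cancel] at this
        rw [h2]
        refine (hcmp (f^[q'] z - p') z ⟨?_, ?_⟩).1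
        · have := h.gap'_neg z
          rw [gap] at this; linarith
        · have := h.neg_gap'_lt z
          rw [gap] at this; linarith
      obtain ⟨J, rfl⟩ : ∃ J, K = J + 1 := ⟨K - 1, by lia⟩
      have e : deriv (gap f q' p') = fun z => -1 + deriv f^[q'] z := funext fun z => by
        rw [(hf.hasDerivAt_gap q' p' z).deriv]; ring
      rw [iteratedDeriv_succ', e, iteratedDeriv_const_add (by simp)]
      have h1 := H₂ (deriv f^[q']) (nonlin f q') z (σ / gap f q p z) (hf.iterate q').contDiff_deriv
        (hf.contDiff_nonlin q') (by positivity) (hf.hasDerivAt_deriv_iterate q')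
        (H₁ h hM hM1 q' le_rfl z) (J + 1) (by lia)
      rw [abs_of_pos ((hf.iterate q').deriv_pos z)] at h1
      refine h1.trans ?_
      have h2 : σ / gap f q p z ≤ C₀ ^ N * (σ / m) := by
        rw [div_le_iff₀ hzp, mul_assoc, div_mul_eq_mul_div, ← mul_div_assoc, le_div_iff₀ hx]
        calc σ * m ≤ σ * (C₀ ^ N * gap f q p z) := by gcongr; exact hz'.1
          _ = _ := by ring
      calc C₂ * deriv f^[q'] z * (σ / gap f q p z) ^ (J + 1)
          ≤ C₂ * C₀ ^ 2 * (C₀ ^ N * (σ / m)) ^ (J + 1) := by gcongr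
        _ = _ := by rw [hB, mul_pow]; ring)
    0 (Nat.zero_le _) y ⟨hy.1, hy.2.trans (by
      have := htm hN1
      rw [← zero_add 1, ht1, ht0] at this
      exact this)⟩
  simp only [iteratedDeriv_zero, pow_zero, mul_one, hv, neg_add_eq_sub] at key
  refine key.trans ?_
  have e : (σ / m) ^ K * (m / C₀ ^ N) ^ (K + 1) ≤ σ ^ K * m := by
    rw [div_pow, div_pow, pow_succ m, div_mul_div_comm, div_le_iff₀ (by positivity)]
    have : 1 ≤ (C₀ ^ N) ^ (K + 1) := one_le_pow₀ hCN
    calc σ ^ K * (m ^ K * m) = σ ^ K * m * (m ^ K * 1) := by ring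
      _ ≤ _ := by gcongr
  have hnu : 0 ≤ -gap f q' p' x := by linarith
  calc C₃ * (A * σ * -gap f q' p' x + B * (σ / m) ^ K * (m / C₀ ^ N) ^ (K + 1))
      = C₃ * A * σ * -gap f q' p' x + C₃ * B * ((σ / m) ^ K * (m / C₀ ^ N) ^ (K + 1)) := by ring
    _ ≤ C₃ * A * σ * -gap f q' p' x + C₃ * B * (σ ^ K * m) := by gcongr
    _ ≤ (1 + C₃ * A + C₃ * B) * σ * -gap f q' p' x + (1 + C₃ * A + C₃ * B) * (σ ^ K * m) := by
      have := mul_nonneg hC₃ hA0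
      have := mul_nonneg hC₃ hB0
      gcongr <;> linarith
    _ = _ := by ring

/-- A continuous monotone semiconjugacy from the translation by `ρ` to `f`. -/
structure IsRotSemiconj (f : ℝ → ℝ) (ρ : ℝ) (χ : ℝ → ℝ) : Prop where
  continuous : Continuous χ
  monotone : Monotone χ
  surjective : Function.Surjective χ
  map_add_one : ∀ t, χ (t + 1) = χ t + 1
  map : ∀ t, f (χ t) = χ (t + ρ)

namespace IsRotSemiconj
variable {f χ : ℝ → ℝ} {ρ : ℝ}

theorem iterate (h : IsRotSemiconj f ρ χ) (n : ℕ) (t : ℝ) : f^[n] (χ t) = χ (t + n * ρ) := by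
  induction n with
  | zero => simp
  | succ n ih => rw [Function.iterate_succ_apply', ih, h.map]; congr 1; push_cast; ring

theorem map_sub_int (h : IsRotSemiconj f ρ χ) (t : ℝ) (k : ℤ) : χ (t - k) = χ t - k := by
  let X : CircleDeg1Lift := ⟨⟨χ, h.monotone⟩, h.map_add_one⟩
  exact X.map_sub_int t k

theorem gap_eq (h : IsRotSemiconj f ρ χ) (q : ℕ) (p : ℤ) (t : ℝ) :
    gap f q p (χ t) = χ (t + (q * ρ - p)) - χ t := by
  rw [gap, h.iterate, ← h.map_sub_int]; congr 2; ring

theorem reflect (h : IsRotSemiconj f ρ χ) :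
    IsRotSemiconj (fun x => -f (-x)) (-ρ) (fun t => -χ (-t)) where
  continuous := (h.continuous.comp continuous_neg).neg
  monotone := fun a b hab => neg_le_neg (h.monotone (neg_le_neg hab))
  surjective := fun x => by
    obtain ⟨t, ht⟩ := h.surjective (-x)
    exact ⟨-t, by simp [ht]⟩
  map_add_one := fun t => by
    have := h.map_add_one (-(t + 1))
    rw [show -(t + 1) + 1 = -t by ring] at this
    linarith
  map := fun t => by simp only [neg_neg, h.map, neg_add]

end IsRotSemiconj

theorem RotLift.exists_isRotSemiconj {f : ℝ → ℝ} {ρ : ℝ} (hf : RotLift f ρ)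
    (hs : ∀ ε > 0, ∃ (q : ℕ) (p : ℤ), 0 < q * ρ - p ∧ ∀ x, gap f q p x ≤ ε) :
    ∃ χ, IsRotSemiconj f ρ χ := by
  let F := hf.toSmoothLift.toLift
  have hFf : ⇑F = f := rfl
  let T : CircleDeg1Lift := CircleDeg1Lift.translate (Multiplicative.ofAdd ρ)
  have hT : ∀ x, T x = ρ + x := fun x => rfl
  have hFb : Function.Bijective F := ⟨hf.strictMono.injective,
    hf.continuous.surjective F.tendsto_atTop F.tendsto_atBot⟩
  have hTb : Function.Bijective T := by
    have : ⇑T = fun x => ρ + x := rfl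
    rw [this]
    exact (Equiv.addLeft ρ).bijective
  obtain ⟨X, hX⟩ := CircleDeg1Lift.semiconj_of_bijective_of_translationNumber_eq hTb hFb
    (by rw [hf.translationNumber]; exact CircleDeg1Lift.translationNumber_translate ρ)
  have hmap : ∀ t, f (X t) = X (t + ρ) := fun t => by
    have := hX t
    rw [hT, hFf] at this
    rw [← this, add_comm]
  have hit : ∀ (n : ℕ) t, f^[n] (X t) = X (t + n * ρ) := fun n t => by
    induction n with
    | zero => simp
    | succ n ih => rw [Function.iterate_succ_apply', ih, hmap]; congr 1; push_cast; ring
  have hcont : Continuous X := by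
    rw [Metric.continuous_iff]
    intro t ε hε
    obtain ⟨q, p, hpos, hg⟩ := hs (ε / 2) (by linarith)
    have hstep : ∀ t, X (t + (q * ρ - p)) ≤ X t + ε / 2 := fun t => by
      have := hg (X t)
      rw [gap, hit, ← X.map_sub_int] at this
      rw [show t + (q * ρ - p) = t + q * ρ - p by ring]
      linarith
    refine ⟨q * ρ - p, hpos, fun s hs => ?_⟩
    rw [Real.dist_eq, abs_lt] at *
    have h1 := X.monotone (show s ≤ t + (q * ρ - p) by linarith)
    have h2 := X.monotone (show t ≤ s + (q * ρ - p) by linarith)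
    have := hstep t
    have := hstep s
    constructor <;> linarith
  exact ⟨X, hcont, X.monotone, hcont.surjective X.tendsto_atTop X.tendsto_atBot, X.map_add_one, hmap⟩

theorem intervalIntegral.abs_integral_sub_le {u : ℝ → ℝ} (hu : Continuous u) {a b c B : ℝ}
    (hab : a ≤ b) (h : ∀ t ∈ Icc a b, |u t - c| ≤ B) :
    |(∫ t in a..b, u t) - (b - a) * c| ≤ B * (b - a) := by
  have h1 : (∫ t in a..b, u t) - (b - a) * c = ∫ t in a..b, (u t - c) := by
    rw [intervalIntegral.integral_sub (hu.intervalIntegrable _ _) (by simp)]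
    simp
  rw [h1]
  have := intervalIntegral.norm_integral_le_of_norm_le_const (a := a) (b := b) (C := B)
    (f := fun t => u t - c) (fun t ht => by
      rw [uIoc_of_le hab] at ht
      exact h t ⟨ht.1.le, ht.2⟩)
  rwa [Real.norm_eq_abs, abs_of_nonneg (sub_nonneg.2 hab)] at this

/-- Comparison of the displacements of consecutive return maps with those of the rotation. -/
theorem SmoothLift.exists_gap_ratio {f : ℝ → ℝ} (hf : SmoothLift f) {K : ℕ} (hK : 1 ≤ K) :
    ∃ C, 1 ≤ C ∧ ∀ {ρ : ℝ} {q q' : ℕ} {p p' : ℤ} {M : ℝ} {χ : ℝ → ℝ}, IsPair f ρ q p q' p' →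
    IsRotSemiconj f ρ χ → (∀ x, gap f q p x ≤ M) → M ≤ 1 → ∀ x,
    |(q * ρ - p) * -gap f q' p' x - (p' - q' * ρ) * gap f q p x| ≤
      C * √M * ((q * ρ - p) * -gap f q' p' x + (p' - q' * ρ) * gap f q p x) +
      C * √M ^ K * ((q * ρ - p) * gap f q p x) := by
  obtain ⟨C₀, hC₀, H₀⟩ := hf.exists_comparison
  obtain ⟨C₁, hC₁, H₁⟩ := hf.exists_gap'_variation hK
  refine ⟨C₁ + C₀ ^ 2, by nlinarith, fun {ρ q q' p p' M χ} h hχ hM hM1 x => ?_⟩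
  obtain ⟨hD, hcmp, -⟩ := H₀ h hM hM1
  have hx := h.gap_pos x
  have hu := h.gap'_neg x
  have hσ0 := Real.sqrt_nonneg M
  set σ := √M
  obtain ⟨t, rfl⟩ := hχ.surjective x
  set x := χ t with hxt
  have hd := h.pos
  have hd' : 0 < p' - q' * ρ := by linarith [h.neg]
  set d := q * ρ - p with hdd
  set d' := p' - q' * ρ with hdd'
  have e1 : ∀ r, gap f q p (χ r) = χ (r + d) - χ r := fun r => hχ.gap_eq q p r
  have e2 : ∀ r, -gap f q' p' (χ r) = χ r - χ (r - d') := fun r => by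
    rw [hχ.gap_eq q' p' r, hdd']; ring_nf
  have hc := hχ.continuous
  have hint : ∫ r in t..t + d, -gap f q' p' (χ r) = ∫ r in t - d'..t, gap f q p (χ r) := by
    simp only [e1, e2]
    have hc1 : Continuous fun r => χ (r - d') := hc.comp (continuous_sub_right d')
    have hc2 : Continuous fun r => χ (r + d) := hc.comp (continuous_add_const d)
    rw [intervalIntegral.integral_sub (hc.intervalIntegrable _ _)
      (hc1.intervalIntegrable _ _),
      intervalIntegral.integral_sub (hc2.intervalIntegrable _ _)
      (hc.intervalIntegrable _ _), intervalIntegral.integral_comp_sub_right (fun r => χ r),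
      intervalIntegral.integral_comp_add_right (fun r => χ r)]
    have h1 := intervalIntegral.integral_add_adjacent_intervals (μ := MeasureTheory.volume)
      (hc.intervalIntegrable (t - d') t) (hc.intervalIntegrable t (t + d))
    have h2 := intervalIntegral.integral_add_adjacent_intervals (μ := MeasureTheory.volume)
      (hc.intervalIntegrable (t - d') (t + d - d')) (hc.intervalIntegrable (t + d - d') (t + d))
    rw [show t - d' + d = t + d - d' by ring]
    linarith
  have hgc : ∀ q p, Continuous fun r => gap f q p (χ r) := fun q p =>
    (hf.continuous_gap q p).comp hc
  have b1 := intervalIntegral.abs_integral_sub_le (hgc q' p').neg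
    (show t ≤ t + d by linarith) (c := -gap f q' p' x)
    (B := C₁ * σ * -gap f q' p' x + C₁ * σ ^ K * gap f q p x) (fun r hr => by
      rw [Pi.neg_apply, ← abs_neg, neg_sub, neg_sub_neg]
      refine H₁ h hM hM1 x _ ⟨hχ.monotone hr.1, ?_⟩
      rw [e1, add_sub_cancel]
      exact hχ.monotone hr.2)
  have b2 := intervalIntegral.abs_integral_sub_le (hgc q p)
    (show t - d' ≤ t by linarith) (c := gap f q p x)
    (B := C₀ ^ 2 * σ * gap f q p x) (fun r hr => by
      have h1 := h.abs_gap_sub_le hD (hχ.monotone hr.2)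
      rw [abs_sub_comm]
      refine h1.trans ?_
      have h2 : x - χ r ≤ C₀ * gap f q p x := by
        have h3 : χ (t - d') ≤ χ r := hχ.monotone hr.1
        have h4 : χ t ≤ χ (t - d' + d) := hχ.monotone (by linarith [h.lt])
        have h5 := (hcmp (χ (t - d')) x ⟨hχ.monotone (by linarith), by
          rw [e1]; linarith⟩).1
        rw [e1] at h5
        linarith
      calc C₀ * σ * (x - χ r) ≤ C₀ * σ * (C₀ * gap f q p x) := by gcongr
        _ = _ := by ring)
  simp only [Pi.neg_apply] at b1
  rw [hint] at b1
  rw [show t + d - t = d by ring] at b1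
  rw [show t - (t - d') = d' by ring] at b2
  rw [abs_le] at *
  have n1 : 0 ≤ σ * (d * -gap f q' p' x) := mul_nonneg hσ0 (mul_nonneg hd.le (by linarith))
  have n2 : 0 ≤ σ * (d' * gap f q p x) := by positivity
  have n3 : 0 ≤ σ ^ K * (d * gap f q p x) := by positivity
  have n4 := mul_nonneg (sq_nonneg C₀) n1
  have n5 := mul_nonneg (sq_nonneg C₀) n3
  have n6 := mul_nonneg (zero_le_one.trans hC₁) n2
  constructor <;> nlinarith

theorem iterate_reflect (f : ℝ → ℝ) (n : ℕ) (x : ℝ) :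
    (fun x => -f (-x))^[n] x = -f^[n] (-x) := by
  induction n with
  | zero => simp
  | succ n ih => rw [Function.iterate_succ_apply', ih, Function.iterate_succ_apply', neg_neg]

theorem gap_reflect (f : ℝ → ℝ) (q : ℕ) (p : ℤ) (x : ℝ) :
    gap (fun x => -f (-x)) q (-p) x = -gap f q p (-x) := by
  rw [gap, gap, iterate_reflect]
  push_cast
  ring

theorem deriv_iterate_reflect (f : ℝ → ℝ) (n : ℕ) (x : ℝ) :
    deriv (fun x => -f (-x))^[n] x = deriv f^[n] (-x) := by
  have : (fun x => -f (-x))^[n] = fun x => -f^[n] (-x) := funext (iterate_reflect f n)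
  rw [this, deriv.fun_neg, deriv_comp_neg, neg_neg]

theorem nonlin_reflect (f : ℝ → ℝ) (n : ℕ) (x : ℝ) :
    nonlin (fun x => -f (-x)) n x = -nonlin f n (-x) := by
  have : logD (fun x => -f (-x)) n = fun x => logD f n (-x) := by
    funext x
    rw [logD, logD, deriv_iterate_reflect]
  rw [nonlin, this, deriv_comp_neg, nonlin]

theorem JetLe.comp_neg {u : ℝ → ℝ} {K : ℕ} {x B L : ℝ} (h : JetLe K (fun t => -u (-t)) x B L) :
    JetLe K u (-x) B L := by
  intro k hk
  have h1 := h k hk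
  rw [show (fun t => -u (-t)) = -(fun t => u (-t)) from rfl, iteratedDeriv_neg,
    iteratedDeriv_comp_neg] at h1
  simpa [abs_mul] using h1

/-- The absolute displacement of the `n`-th closest return. -/
noncomputable def ret (f : ℝ → ℝ) (q : ℕ → ℕ) (p : ℕ → ℤ) (n : ℕ) (x : ℝ) : ℝ :=
  |gap f (q n) (p n) x|

theorem Convergents.isPair_or {f : ℝ → ℝ} {ρ : ℝ} {q : ℕ → ℕ} {p : ℕ → ℤ} (hf : RotLift f ρ)
    (h : Convergents ρ q p) (n : ℕ) : IsPair f ρ (q n) (p n) (q (n + 1)) (p (n + 1)) ∨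
    IsPair (fun x => -f (-x)) (-ρ) (q n) (-p n) (q (n + 1)) (-p (n + 1)) := by
  have h1 := h.sign n
  have h2 := h.sign (n + 1)
  have h3 := h.lt n
  have h4 := h.best n
  rcases Nat.even_or_odd n with hn | hn
  · left
    rw [hn.neg_one_pow, one_mul] at h1
    rw [hn.add_one.neg_one_pow] at h2
    rw [abs_of_pos h1] at h3 h4
    rw [abs_of_neg (by linarith)] at h3
    exact ⟨hf, h.q_pos n, h.q_le n, h1, by linarith, by linarith, h4⟩
  · right
    rw [hn.neg_one_pow] at h1
    rw [hn.add_one.neg_one_pow, one_mul] at h2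
    rw [abs_of_neg (a := (q n : ℝ) * ρ - p n) (by linarith)] at h3 h4
    rw [abs_of_pos h2] at h3
    refine ⟨hf.reflect, h.q_pos n, h.q_le n, ?_, ?_, ?_, fun d k hd hk => ?_⟩
    · push_cast; linarith
    · push_cast; linarith
    · push_cast; linarith
    · obtain ⟨h5, h6⟩ := h4 d (-k) hd (by
        push_cast at hk ⊢
        rw [show (d : ℝ) * ρ - -k = -(d * -ρ - k) by ring, abs_neg]
        linarith)
      exact ⟨h5, by omega⟩

section
variable {f : ℝ → ℝ} {ρ : ℝ} {q q' : ℕ} {p p' : ℤ}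

theorem IsPair.ret_reflect (h : IsPair (fun x => -f (-x)) (-ρ) q (-p) q' (-p')) (x : ℝ) :
    |gap f q p x| = gap (fun x => -f (-x)) q (-p) (-x) ∧
    |gap f q' p' x| = -gap (fun x => -f (-x)) q' (-p') (-x) := by
  have h1 := h.gap_pos (-x)
  have h2 := h.gap'_neg (-x)
  rw [gap_reflect, neg_neg] at h1 h2 ⊢
  rw [gap_reflect, neg_neg]
  exact ⟨abs_of_neg (by linarith), by rw [neg_neg]; exact abs_of_pos (by linarith)⟩

end

theorem RotLift.exists_ret_comparison {f : ℝ → ℝ} {ρ : ℝ} (hf : RotLift f ρ) : ∃ C, 1 ≤ C ∧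
    ∀ {q : ℕ → ℕ} {p : ℕ → ℤ}, Convergents ρ q p → ∀ {n : ℕ} {M : ℝ}, (∀ x, ret f q p n x ≤ M) →
    M ≤ 1 → (∀ x, |deriv f^[q n] x - 1| ≤ C * √M) ∧
    (∀ x, ret f q p n x ≤ C * ret f q p n (f^[q n] x - p n)) ∧
    (∀ l ≤ q (n + 1), ∀ x, deriv f^[l] x ≤ C * (ret f q p n (f^[l] x) / ret f q p n x)) ∧
    (∀ l ≤ q (n + 1), ∀ x, ret f q p n (f^[l] x) / ret f q p n x ≤ C * deriv f^[l] x) := by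
  obtain ⟨C₁, h1, H1⟩ := hf.toSmoothLift.exists_comparison
  obtain ⟨C₂, h2, H2⟩ := hf.toSmoothLift.reflect.exists_comparison
  refine ⟨max C₁ C₂, h1.trans (le_max_left _ _), fun {q p} hC n M hM hM1 => ?_⟩
  rcases hC.isPair_or hf n with h | h
  · have hg : ∀ x, ret f q p n x = gap f (q n) (p n) x := fun x => abs_of_pos (h.gap_pos x)
    simp only [hg] at hM ⊢
    obtain ⟨a1, a2, a3, a4⟩ := H1 h hM hM1
    have hle : C₁ ≤ max C₁ C₂ := le_max_left _ _
    refine ⟨fun x => (a1 x).trans (by gcongr), fun x => ?_, fun l hl x => (a3 l hl x).trans ?_,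
      fun l hl x => (a4 l hl x).trans ?_⟩
    · refine ((a2 x (f^[q n] x - p n) ?_).1).trans ?_
      · convert h.right_mem x using 1
        rw [gap]; ring
      · have := h.gap_pos (f^[q n] x - p n)
        gcongr
    · have := h.gap_pos x
      have := h.gap_pos (f^[l] x)
      gcongr
    · have := (hf.toSmoothLift.iterate l).deriv_pos x
      gcongr
  · have hg : ∀ x, ret f q p n x = gap (fun x => -f (-x)) (q n) (-p n) (-x) :=
      fun x => (h.ret_reflect x).1
    simp only [hg] at hM ⊢
    obtain ⟨a1, a2, a3, a4⟩ := H2 h (fun x => by simpa using hM (-x)) hM1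
    simp only [iterate_reflect, deriv_iterate_reflect] at a1 a3 a4
    have hle : C₂ ≤ max C₁ C₂ := le_max_right _ _
    refine ⟨fun x => ?_, fun x => ?_, fun l hl x => ?_, fun l hl x => ?_⟩
    · have := a1 (-x)
      rw [neg_neg] at this
      exact this.trans (by gcongr)
    · refine ((a2 (-x) (-(f^[q n] x - p n)) ?_).1).trans ?_
      · convert h.right_mem (-x) using 1
        rw [gap_reflect, neg_neg, gap]
        ring
      · have := h.gap_pos (-(f^[q n] x - p n))
        gcongr
    · have := a3 l hl (-x)
      rw [neg_neg] at this
      have h5 := h.gap_pos (-x)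
      have h6 := h.gap_pos (-f^[l] x)
      exact this.trans (by gcongr)
    · have := a4 l hl (-x)
      rw [neg_neg] at this
      have h5 := (hf.toSmoothLift.iterate l).deriv_pos x
      exact this.trans (by gcongr)

theorem RotLift.exists_jetLe_nonlin_ret {f : ℝ → ℝ} {ρ : ℝ} (hf : RotLift f ρ) (r : ℕ) :
    ∃ C, 1 ≤ C ∧
    ∀ {q : ℕ → ℕ} {p : ℕ → ℤ}, Convergents ρ q p → ∀ {n : ℕ} {M : ℝ}, (∀ x, ret f q p n x ≤ M) →
    M ≤ 1 → ∀ l ≤ q (n + 1), ∀ x,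
    JetLe r (nonlin f l) x (C * (√M / ret f q p n x)) (√M / ret f q p n x) := by
  obtain ⟨C₁, h1, H1⟩ := hf.toSmoothLift.exists_jetLe_nonlin r
  obtain ⟨C₂, h2, H2⟩ := hf.toSmoothLift.reflect.exists_jetLe_nonlin r
  refine ⟨max C₁ C₂, h1.trans (le_max_left _ _), fun {q p} hC n M hM hM1 l hl x => ?_⟩
  rcases hC.isPair_or hf n with h | h
  · have hg : ∀ x, ret f q p n x = gap f (q n) (p n) x := fun x => abs_of_pos (h.gap_pos x)
    simp only [hg] at hM ⊢
    have := h.gap_pos x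
    refine (H1 h hM hM1 l hl x).mono le_rfl ?_ (by positivity)
    gcongr
    exact le_max_left _ _
  · have hg : ∀ x, ret f q p n x = gap (fun x => -f (-x)) (q n) (-p n) (-x) :=
      fun x => (h.ret_reflect x).1
    simp only [hg] at hM ⊢
    have h3 := H2 h (fun x => by simpa using hM (-x)) hM1 l hl (-x)
    rw [show nonlin (fun x => -f (-x)) l = fun t => -nonlin f l (-t) from
      funext (nonlin_reflect f l)] at h3
    have h4 := h3.comp_neg
    rw [neg_neg] at h4
    have := h.gap_pos (-x)
    refine h4.mono le_rfl ?_ (by positivity)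
    gcongr
    exact le_max_right _ _

theorem RotLift.exists_ret_ratio {f : ℝ → ℝ} {ρ : ℝ} (hf : RotLift f ρ) {K : ℕ} (hK : 1 ≤ K) :
    ∃ C, 1 ≤ C ∧
    ∀ {q : ℕ → ℕ} {p : ℕ → ℤ} {χ : ℝ → ℝ}, Convergents ρ q p → IsRotSemiconj f ρ χ →
    ∀ {n : ℕ} {M : ℝ}, (∀ x, ret f q p n x ≤ M) → M ≤ 1 → ∀ x,
    |(|q n * ρ - p n| * ret f q p (n + 1) x - |q (n + 1) * ρ - p (n + 1)| * ret f q p n x)| ≤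
      C * √M * (|q n * ρ - p n| * ret f q p (n + 1) x +
        |q (n + 1) * ρ - p (n + 1)| * ret f q p n x) +
      C * √M ^ K * (|q n * ρ - p n| * ret f q p n x) := by
  obtain ⟨C₁, h1, H1⟩ := hf.toSmoothLift.exists_gap_ratio hK
  obtain ⟨C₂, h2, H2⟩ := hf.toSmoothLift.reflect.exists_gap_ratio hK
  refine ⟨max C₁ C₂, h1.trans (le_max_left _ _), fun {q p χ} hC hχ n M hM hM1 x => ?_⟩
  rcases hC.isPair_or hf n with h | h
  · have hg : ∀ x, ret f q p n x = gap f (q n) (p n) x := fun x => abs_of_pos (h.gap_pos x)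
    have hg' : ret f q p (n + 1) x = -gap f (q (n + 1)) (p (n + 1)) x := abs_of_neg (h.gap'_neg x)
    simp only [hg] at hM
    rw [hg, hg', abs_of_pos h.pos, abs_of_neg h.neg, neg_sub]
    refine (H1 h hχ hM hM1 x).trans ?_
    have e1 := h.gap_pos x
    have e2 := h.gap'_neg x
    have e3 := h.pos
    have e4 := h.neg
    have e5 : 0 ≤ (q n * ρ - p n) * -gap f (q (n + 1)) (p (n + 1)) x :=
      mul_nonneg e3.le (by linarith)
    have e6 : 0 ≤ (p (n + 1) - q (n + 1) * ρ) * gap f (q n) (p n) x :=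
      mul_nonneg (by linarith) e1.le
    gcongr <;> exact le_max_left _ _
  · have hg : ∀ x, ret f q p n x = gap (fun x => -f (-x)) (q n) (-p n) (-x) :=
      fun x => (h.ret_reflect x).1
    have hg' : ret f q p (n + 1) x = -gap (fun x => -f (-x)) (q (n + 1)) (-p (n + 1)) (-x) :=
      (h.ret_reflect x).2
    simp only [hg] at hM
    have e1 := h.gap_pos (-x)
    have e2 := h.gap'_neg (-x)
    have e3 := h.pos
    have e4 := h.neg
    have h3 := H2 h hχ.reflect (fun x => by simpa using hM (-x)) hM1 (-x)
    push_cast at e3 e4 h3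
    rw [hg, hg', abs_of_neg (a := (q n : ℝ) * ρ - p n) (by linarith),
      abs_of_pos (a := (q (n + 1) : ℝ) * ρ - p (n + 1)) (by linarith)]
    rw [show (q n : ℝ) * -ρ - -p n = -(q n * ρ - p n) by ring,
      show -(p (n + 1) : ℝ) - q (n + 1) * -ρ = q (n + 1) * ρ - p (n + 1) by ring] at h3
    refine h3.trans ?_
    have e5 : 0 ≤ -(q n * ρ - p n) * -gap (fun x => -f (-x)) (q (n + 1)) (-p (n + 1)) (-x) :=
      mul_nonneg (by linarith) (by linarith)
    have e6 : 0 ≤ (q (n + 1) * ρ - p (n + 1)) * gap (fun x => -f (-x)) (q n) (-p n) (-x) :=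
      mul_nonneg (by linarith) e1.le
    have e7 : 0 ≤ -(q n * ρ - p n) * gap (fun x => -f (-x)) (q n) (-p n) (-x) :=
      mul_nonneg (by linarith) e1.le
    gcongr <;> exact le_max_right _ _

theorem exists_geometric_of_two_step {a : ℕ → ℝ} {t : ℝ} (ha : ∀ n, 0 ≤ a n) (ht : 0 < t)
    (h : ∀ n, a (n + 2) ≤ t ^ 2 * a n) : ∃ C, ∀ n, a n ≤ C * t ^ n := by
  refine ⟨a 0 + a 1 / t, fun n => ?_⟩
  have h0 := ha 0
  have h1 : 0 ≤ a 1 / t := div_nonneg (ha 1) ht.le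
  induction n using Nat.twoStepInduction with
  | zero => simpa using h1
  | one =>
    have : a 1 / t * t = a 1 := div_mul_cancel₀ _ ht.ne'
    rw [pow_one, add_mul, this]
    nlinarith
  | more n ih _ =>
    calc a (n + 2) ≤ t ^ 2 * a n := h n
      _ ≤ t ^ 2 * ((a 0 + a 1 / t) * t ^ n) := by gcongr
      _ = _ := by ring

set_option maxHeartbeats 800000 in
theorem exists_le_rpow_of_step {M a : ℕ → ℝ} {c : ℝ} {k : ℕ} (hM : ∀ n, 0 < M n)
    (hM1 : ∀ n, M n ≤ 1) (hσ : Summable fun n => √(M n)) (ha : ∀ n, 0 < a n)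
    (hanti : ∀ n, a (n + 1) ≤ a n) (ha0 : Tendsto a atTop (nhds 0)) (hc : 0 < c)
    (hdio : ∀ n, c * a n ^ (1 + k) ≤ a (n + 1))
    (hstep : ∀ K, 1 ≤ K → ∃ C, 1 ≤ C ∧ ∀ n, a n * M (n + 1) - a (n + 1) * M n ≤
      C * √(M n) * (a n * M (n + 1) + a (n + 1) * M n) + C * √(M n) ^ K * (a n * M n)) :
    ∃ s C : ℝ, 0 < s ∧ 0 < C ∧ ∀ n, M n ≤ C * a n ^ s := by
  obtain ⟨C, hC, hY⟩ := hstep (2 * k + 3) (by omega)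
  set S := ∑' n, √(M n) with hS
  have hpart : ∀ n, ∑ i ∈ Finset.range n, √(M i) ≤ S := fun n =>
    hσ.sum_le_tsum _ (fun i _ => Real.sqrt_nonneg _)
  let P : ℕ → ℝ := fun n => Real.exp (6 * C * ∑ i ∈ Finset.range n, √(M i))
  set Q := Real.exp (6 * C * S) with hQ
  have hPQ : ∀ n, P n ≤ Q := fun n => Real.exp_le_exp.2 (by have := hpart n; gcongr)
  have hP1 : ∀ n, 1 ≤ P n := fun n => Real.one_le_exp (by
    have : 0 ≤ ∑ i ∈ Finset.range n, √(M i) := Finset.sum_nonneg fun i _ => Real.sqrt_nonneg _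
    positivity)
  have hPs : ∀ n, (1 + 6 * C * √(M n)) * P n ≤ P (n + 1) := fun n => by
    simp only [P]
    rw [Finset.sum_range_succ, mul_add, Real.exp_add, mul_comm]
    gcongr
    rw [add_comm]
    exact Real.add_one_le_exp _
  have hσ0 := hσ.tendsto_atTop_zero
  have hMlim : Tendsto M atTop (nhds 0) := by
    have := hσ0.pow 2
    simp only [ne_eq, OfNat.ofNat_ne_zero, not_false_eq_true, zero_pow] at this
    exact this.congr fun n => Real.sq_sqrt (hM n).le
  set c' := min c 1 with hc'
  have hc'0 : 0 < c' := lt_min hc one_pos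
  have hQ0 : 0 < Q := Real.exp_pos _
  set μ := c' / ((1 + 6 * C) * Q ^ (1 + k)) with hμ
  have hμ0 : 0 < μ := by positivity
  have hev : ∀ᶠ n in atTop, √(M n) < 1 / (2 * C) ∧ M n < μ ∧ M n < 1 ∧ a n < 1 :=
    (hσ0.eventually (gt_mem_nhds (by positivity))).and ((hMlim.eventually (gt_mem_nhds hμ0)).and
      ((hMlim.eventually (gt_mem_nhds one_pos)).and (ha0.eventually (gt_mem_nhds one_pos))))
  obtain ⟨N, hN⟩ := eventually_atTop.1 hev
  set s := min 1 (Real.log (M N) / Real.log (a N)) with hs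
  have hlogM : Real.log (M N) < 0 := Real.log_neg (hM N) (hN N le_rfl).2.2.1
  have hloga : Real.log (a N) < 0 := Real.log_neg (ha N) (hN N le_rfl).2.2.2
  have hs0 : 0 < s := lt_min one_pos (div_pos_of_neg_of_neg hlogM hloga)
  have hs1 : s ≤ 1 := min_le_left _ _
  have hbase : M N ≤ a N ^ s := by
    rw [Real.rpow_def_of_pos (ha N), ← Real.log_le_iff_le_exp (hM N)]
    have h1 := (le_div_iff_of_neg hloga).1 (min_le_right 1 (Real.log (M N) / Real.log (a N)))
    rw [← hs] at h1
    linarith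
  have hmain : ∀ n, N ≤ n → M n ≤ P n * a n ^ s := by
    intro n hn
    induction n, hn using Nat.le_induction with
    | base => exact hbase.trans (le_mul_of_one_le_left (Real.rpow_nonneg (ha N).le _) (hP1 N))
    | succ n hn ih =>
      obtain ⟨e1, e2, e3, e4⟩ := hN n hn
      have hσn := Real.sqrt_nonneg (M n)
      have hsq : √(M n) ^ 2 = M n := Real.sq_sqrt (hM n).le
      have hy := hY n
      set σ := √(M n) with hσdef
      have hσ1 : σ ≤ 1 := Real.sqrt_le_one.2 (hM1 n)
      set r := a (n + 1) / a n with hr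
      have hr0 : 0 < r := div_pos (ha _) (ha _)
      have hr1 : r ≤ 1 := (div_le_one (ha n)).2 (hanti n)
      have har : a (n + 1) = r * a n := (div_mul_cancel₀ _ (ha n).ne').symm
      have h1 : M (n + 1) - r * M n ≤ C * σ * (M (n + 1) + r * M n) + C * σ ^ (2 * k + 3) * M n := by
        rw [har] at hy
        refine le_of_mul_le_mul_left ?_ (ha n)
        linarith
      have hCσ : C * σ ≤ 1 / 2 := by
        rw [lt_div_iff₀ (by positivity)] at e1
        linarith
      have hCσ0 : 0 ≤ C * σ := by positivity
      have hMr : 0 ≤ r * M n := mul_nonneg hr0.le (hM n).le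
      have hT : 0 ≤ C * σ ^ (2 * k + 3) * M n := mul_nonneg (by positivity) (hM n).le
      have h2 : M (n + 1) ≤ (1 + 4 * (C * σ)) * (r * M n) + 2 * (C * σ ^ (2 * k + 3) * M n) := by
        have h3 : M (n + 1) * (1 - C * σ) ≤ (1 + C * σ) * (r * M n) + C * σ ^ (2 * k + 3) * M n := by
          linarith
        refine le_of_mul_le_mul_right (h3.trans ?_) (show 0 < 1 - C * σ by linarith)
        nlinarith [mul_nonneg hCσ0 hMr, mul_nonneg hCσ0 hT,
          mul_nonneg (mul_nonneg hCσ0 hMr) (show 0 ≤ 1 / 2 - C * σ by linarith)]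
      have has : 0 < a n ^ s := Real.rpow_pos_of_pos (ha n) _
      rcases le_total (σ ^ (2 * k + 2)) r with h4 | h4
      · have h5 : σ ^ (2 * k + 3) ≤ σ * r := by
          rw [pow_succ, mul_comm]; gcongr
        have h6 : M (n + 1) ≤ (1 + 6 * C * σ) * (r * M n) := by
          have : C * σ ^ (2 * k + 3) * M n ≤ C * (σ * r) * M n := by
            have := (hM n).le
            gcongr
          nlinarith
        have h7 : r ≤ r ^ s := by
          simpa using Real.rpow_le_rpow_of_exponent_ge hr0 hr1 hs1
        calc M (n + 1) ≤ (1 + 6 * C * σ) * (r * M n) := h6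
          _ ≤ (1 + 6 * C * σ) * (r ^ s * (P n * a n ^ s)) := by
            have := (hM n).le
            gcongr
          _ = ((1 + 6 * C * σ) * P n) * (r ^ s * a n ^ s) := by ring
          _ ≤ P (n + 1) * (r ^ s * a n ^ s) := by
            gcongr
            exact hPs n
          _ = P (n + 1) * a (n + 1) ^ s := by rw [har, Real.mul_rpow hr0.le (ha n).le]
      · have h5 : σ ^ (2 * k + 2) = M n ^ (k + 1) := by
          rw [← hsq, ← pow_mul]; congr 1
        have h6 : M (n + 1) ≤ (1 + 6 * C) * (M n * M n ^ (1 + k)) := by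
          have hx : (1 + 4 * (C * σ)) * (r * M n) ≤ (1 + 4 * C) * (M n ^ (k + 1) * M n) := by
            rw [← h5]
            have := (hM n).le
            gcongr
            exact mul_le_of_le_one_right (by positivity) hσ1
          have hx2 : C * σ ^ (2 * k + 3) * M n ≤ C * (M n ^ (k + 1)) * M n := by
            rw [← h5]
            have := (hM n).le
            gcongr C * ?_ * _
            exact pow_le_pow_of_le_one hσn hσ1 (by omega)
          rw [add_comm 1 k]
          nlinarith
        have h7 : (a n ^ s) ^ (1 + k) = (a n ^ (1 + k)) ^ s := by
          rw [← Real.rpow_natCast, ← Real.rpow_mul (ha n).le, ← Real.rpow_natCast,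
            ← Real.rpow_mul (ha n).le, mul_comm]
        have h8 : c' ≤ c' ^ s := by
          simpa using Real.rpow_le_rpow_of_exponent_ge hc'0 (min_le_right _ _) hs1
        calc M (n + 1) ≤ (1 + 6 * C) * (M n * M n ^ (1 + k)) := h6
          _ ≤ (1 + 6 * C) * (μ * (Q * a n ^ s) ^ (1 + k)) := by
            have := (hM n).le
            gcongr
            exact ih.trans (by gcongr; exact hPQ n)
          _ = c' * (a n ^ (1 + k)) ^ s := by
            rw [mul_pow, h7, hμ]
            field_simp
          _ ≤ c' ^ s * (a n ^ (1 + k)) ^ s := by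
            have := Real.rpow_nonneg (pow_nonneg (ha n).le (1 + k)) s
            gcongr
          _ = (c' * a n ^ (1 + k)) ^ s :=
            (Real.mul_rpow hc'0.le (pow_nonneg (ha n).le _)).symm
          _ ≤ a (n + 1) ^ s := by
            have := (ha n).le
            refine Real.rpow_le_rpow (by positivity) (le_trans ?_ (hdio n)) hs0.le
            gcongr
            exact min_le_left _ _
          _ ≤ P (n + 1) * a (n + 1) ^ s :=
            le_mul_of_one_le_left (Real.rpow_nonneg (ha _).le _) (hP1 _)
  have haN : 0 < a N ^ s := Real.rpow_pos_of_pos (ha N) _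
  refine ⟨s, Q + 1 / a N ^ s, hs0, by positivity, fun n => ?_⟩
  have han : 0 < a n ^ s := Real.rpow_pos_of_pos (ha n) _
  rcases le_total N n with h | h
  · refine (hmain n h).trans ?_
    gcongr
    exact (hPQ n).trans (le_add_of_nonneg_right (by positivity))
  · have h1 : a N ≤ a n := antitone_nat_of_succ_le hanti h
    calc M n ≤ 1 := hM1 n
      _ ≤ 1 / a N ^ s * a n ^ s := by
        rw [one_div_mul_eq_div, one_le_div haN]
        exact Real.rpow_le_rpow (ha N).le h1 hs0.le
      _ ≤ _ := by gcongr; linarith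

/-- Two-sided control of a sequence whose successive ratios are close to `1`. -/
theorem le_exp_mul_of_ratio {R y : ℕ → ℝ} {N : ℕ} {S : ℝ} (hS : ∀ n, ∑ i ∈ Finset.range n, y i ≤ S)
    (hy : ∀ n, 0 ≤ y n) (hR : ∀ n, 0 < R n)
    (h1 : ∀ n, N ≤ n → R (n + 1) ≤ (1 + y n) * R n)
    (h2 : ∀ n, N ≤ n → R n ≤ (1 + y n) * R (n + 1)) {n : ℕ} (hn : N ≤ n) :
    R n ≤ Real.exp S * R N ∧ R N ≤ Real.exp S * R n := by
  have key : R n ≤ Real.exp (∑ i ∈ Finset.range n, y i) * R N ∧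
      R N ≤ Real.exp (∑ i ∈ Finset.range n, y i) * R n := by
    induction n, hn using Nat.le_induction with
    | base =>
      have : 1 ≤ Real.exp (∑ i ∈ Finset.range N, y i) :=
        Real.one_le_exp (Finset.sum_nonneg fun i _ => hy i)
      have := le_mul_of_one_le_left (hR N).le this
      exact ⟨this, this⟩
    | succ n hn ih =>
      have h3 : 1 + y n ≤ Real.exp (y n) := by rw [add_comm]; exact Real.add_one_le_exp _
      have h4 := hR n
      have h5 := hR (n + 1)
      have h6 := hR N
      rw [Finset.sum_range_succ, Real.exp_add]
      constructor
      · calc _ ≤ (1 + y n) * R n := h1 n hn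
          _ ≤ Real.exp (y n) * (Real.exp (∑ i ∈ Finset.range n, y i) * R N) := by
            gcongr; exact ih.1
          _ = _ := by ring
      · calc _ ≤ _ := ih.2
          _ ≤ Real.exp (∑ i ∈ Finset.range n, y i) * ((1 + y n) * R (n + 1)) := by
            gcongr; exact h2 n hn
          _ ≤ Real.exp (∑ i ∈ Finset.range n, y i) * (Real.exp (y n) * R (n + 1)) := by gcongr
          _ = _ := by ring
  have h4 := hR n
  have h6 := hR N
  exact ⟨key.1.trans (by gcongr; exact hS n), key.2.trans (by gcongr; exact hS n)⟩

namespace RotLift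
variable {f : ℝ → ℝ} {ρ : ℝ} {q : ℕ → ℕ} {p : ℕ → ℤ}

theorem ret_pos (hf : RotLift f ρ) (hC : Convergents ρ q p) (n : ℕ) (x : ℝ) :
    0 < ret f q p n x := by
  rcases hC.isPair_or hf n with h | h
  · exact abs_pos_of_pos (h.gap_pos x)
  · rw [ret, (h.ret_reflect x).1]
    exact h.gap_pos (-x)

theorem ret_le_one (hf : RotLift f ρ) (hC : Convergents ρ q p) (n : ℕ) (x : ℝ) :
    ret f q p n x ≤ 1 := by
  rcases hC.isPair_or hf n with h | h
  · rw [ret, abs_of_pos (h.gap_pos x)]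
    exact h.gap_le_one x
  · rw [ret, (h.ret_reflect x).1]
    exact h.gap_le_one (-x)

theorem continuous_ret (hf : RotLift f ρ) (n : ℕ) : Continuous (ret f q p n) :=
  (hf.toSmoothLift.continuous_gap _ _).abs

theorem ret_add_one (hf : RotLift f ρ) (n : ℕ) (x : ℝ) :
    ret f q p n (x + 1) = ret f q p n x := by
  rw [ret, ret, hf.toSmoothLift.gap_add_one]

theorem ret_add_ret_le (hf : RotLift f ρ) (hC : Convergents ρ q p) (n : ℕ) (x : ℝ) :
    ret f q p (n + 2) x + ret f q p (n + 2) (f^[q (n + 2)] x - p (n + 2)) ≤ ret f q p n x := by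
  have h1 := hC.sign n
  have h2 := hC.sign (n + 2)
  have h3 := hC.two_mul_le n
  have key : gap f (q (n + 2)) (p (n + 2)) x +
      gap f (q (n + 2)) (p (n + 2)) (f^[q (n + 2)] x - p (n + 2)) =
      f^[q (n + 2) + q (n + 2)] x - 2 * p (n + 2) - x := by
    rw [gap, gap, (hf.toSmoothLift.iterate _).map_sub_int, ← Function.iterate_add_apply]
    ring
  rw [pow_add, neg_one_sq, mul_one] at h2
  simp only [ret]
  rcases Nat.even_or_odd n with hn | hn
  · rw [hn.neg_one_pow, one_mul] at h1 h2
    rw [abs_of_pos h1, abs_of_pos h2] at h3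
    have g1 : ∀ y, 0 < gap f (q (n + 2)) (p (n + 2)) y := fun y => by
      have := hf.lt_iterate (d := q (n + 2)) (k := p (n + 2)) (by linarith) y
      rw [gap]; linarith
    have g2 : 0 < gap f (q n) (p n) x := by
      have := hf.lt_iterate (d := q n) (k := p n) (by linarith) x
      rw [gap]; linarith
    rw [abs_of_pos (g1 _), abs_of_pos (g1 _), abs_of_pos g2, key, gap]
    by_contra! hlt
    have h4 := (hf.lt_iff (a := q n) (b := q (n + 2) + q (n + 2)) (k := -p n)
      (k' := -(2 * p (n + 2))) x).1 (by push_cast; linarith)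
    push_cast at h4
    linarith
  · rw [hn.neg_one_pow] at h1 h2
    rw [abs_of_neg (by linarith), abs_of_neg (a := (q n : ℝ) * ρ - p n) (by linarith)] at h3
    have g1 : ∀ y, gap f (q (n + 2)) (p (n + 2)) y < 0 := fun y => by
      have := hf.iterate_lt (d := q (n + 2)) (k := p (n + 2)) (by linarith) y
      rw [gap]; linarith
    have g2 : gap f (q n) (p n) x < 0 := by
      have := hf.iterate_lt (d := q n) (k := p n) (by linarith) x
      rw [gap]; linarith
    rw [abs_of_neg (g1 _), abs_of_neg (g1 _), abs_of_neg g2, ← neg_add, key, gap]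
    by_contra! hlt
    have h4 := (hf.lt_iff (a := q (n + 2) + q (n + 2)) (b := q n) (k' := -p n)
      (k := -(2 * p (n + 2))) x).1 (by push_cast; linarith)
    push_cast at h4
    linarith

theorem exists_retMax (hf : RotLift f ρ) (hC : Convergents ρ q p) : ∃ M : ℕ → ℝ,
    (∀ n x, ret f q p n x ≤ M n) ∧ (∀ n, ∃ x, M n = ret f q p n x) ∧
    Summable fun n => √(M n) := by
  choose x₀ hx₀ using fun n => exists_forall_le_of_periodic (hf.continuous_ret (q := q) (p := p) n)
    (hf.ret_add_one n)
  refine ⟨fun n => ret f q p n (x₀ n), hx₀, fun n => ⟨_, rfl⟩, ?_⟩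
  obtain ⟨C, hC1, H⟩ := hf.exists_ret_comparison
  have hstep : ∀ n, ret f q p (n + 2) (x₀ (n + 2)) ≤ C / (C + 1) * ret f q p n (x₀ n) := by
    intro n
    have h1 := hf.ret_add_ret_le hC n (x₀ (n + 2))
    have h2 := (H hC (n := n + 2) (hf.ret_le_one hC _) le_rfl).2.1 (x₀ (n + 2))
    have h3 := hx₀ n (x₀ (n + 2))
    rw [div_mul_eq_mul_div, le_div_iff₀ (by positivity)]
    nlinarith
  set θ := C / (C + 1) with hθ
  have hθ0 : 0 < θ := by positivity
  have hθ1 : θ < 1 := by rw [hθ, div_lt_one (by positivity)]; linarith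
  obtain ⟨B, hB⟩ := exists_geometric_of_two_step (a := fun n => √(ret f q p n (x₀ n))) (t := √√θ)
    (fun n => Real.sqrt_nonneg _) (by positivity) (fun n => by
      rw [Real.sq_sqrt (by positivity), ← Real.sqrt_mul hθ0.le]
      exact Real.sqrt_le_sqrt (hstep n))
  refine Summable.of_nonneg_of_le (fun n => Real.sqrt_nonneg _) hB ?_
  refine (summable_geometric_of_lt_one (Real.sqrt_nonneg _) ?_).mul_left B
  rw [Real.sqrt_lt' one_pos, one_pow, Real.sqrt_lt' one_pos, one_pow]
  exact hθ1

theorem exists_isRotSemiconj_of_convergents (hf : RotLift f ρ) (hC : Convergents ρ q p)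
    {M : ℕ → ℝ} (hM : ∀ n x, ret f q p n x ≤ M n) (hσ : Summable fun n => √(M n)) :
    ∃ χ, IsRotSemiconj f ρ χ := by
  refine hf.exists_isRotSemiconj fun ε hε => ?_
  obtain ⟨N, hN⟩ := eventually_atTop.1
    (hσ.tendsto_atTop_zero.eventually (gt_mem_nhds (Real.sqrt_pos.2 hε)))
  refine ⟨q (2 * N), p (2 * N), ?_, fun x => ?_⟩
  · simpa [pow_mul] using hC.sign (2 * N)
  · exact (le_abs_self _).trans ((hM _ x).trans ((Real.sqrt_lt_sqrt_iff_of_pos hε).1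
      (hN (2 * N) (by omega))).le)

theorem _root_.Convergents.abs_pos {ρ : ℝ} (hC : Convergents ρ q p) (n : ℕ) :
    0 < |q n * ρ - p n| := by
  have := hC.sign n
  exact _root_.abs_pos.2 (right_ne_zero_of_mul this.ne')

theorem _root_.Convergents.tendsto_abs {ρ : ℝ} (hC : Convergents ρ q p) :
    Tendsto (fun n => |q n * ρ - p n|) atTop (nhds 0) := by
  obtain ⟨B, hB⟩ := exists_geometric_of_two_step (a := fun n => |q n * ρ - p n|) (t := √(1 / 2))
    (fun n => abs_nonneg _) (by positivity) (fun n => by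
      rw [Real.sq_sqrt (by positivity)]
      linarith [hC.two_mul_le n])
  have h1 : √(1 / 2 : ℝ) < 1 := by
    rw [Real.sqrt_lt' one_pos]; norm_num
  have h2 := (tendsto_pow_atTop_nhds_zero_of_lt_one (Real.sqrt_nonneg _) h1).const_mul B
  rw [mul_zero] at h2
  exact squeeze_zero (fun n => abs_nonneg _) hB h2

theorem exists_ret_le_rpow (hf : RotLift f ρ) (hC : Convergents ρ q p) {c : ℝ} {k : ℕ}
    (hc : 0 < c) (hdio : ∀ n, c * |q n * ρ - p n| ^ (1 + k) ≤ |q (n + 1) * ρ - p (n + 1)|) :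
    ∃ s C : ℝ, 0 < s ∧ 0 < C ∧ ∀ n x, ret f q p n x ≤ C * |q n * ρ - p n| ^ s := by
  obtain ⟨M, hM, hM', hσ⟩ := hf.exists_retMax hC
  obtain ⟨χ, hχ⟩ := hf.exists_isRotSemiconj_of_convergents hC hM hσ
  have hM1 : ∀ n, M n ≤ 1 := fun n => by
    obtain ⟨x, hx⟩ := hM' n
    exact hx ▸ hf.ret_le_one hC n x
  obtain ⟨s, C, hs, hC0, h⟩ := exists_le_rpow_of_step (M := M) (a := fun n => |q n * ρ - p n|)
    (k := k) (fun n => (hf.ret_pos hC n 0).trans_le (hM n 0)) hM1 hσ hC.abs_pos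
    (fun n => (hC.lt n).le) hC.tendsto_abs hc hdio (fun K hK => by
      obtain ⟨C, hC1, H⟩ := hf.exists_ret_ratio hK
      refine ⟨C, hC1, fun n => ?_⟩
      obtain ⟨x, hx⟩ := hM' (n + 1)
      have h1 := (le_abs_self _).trans (H hC hχ (hM n) (hM1 n) x)
      have h2 := hM n x
      rw [hx]
      have h3 := hf.ret_pos hC n x
      have h4 := hC.abs_pos n
      have h5 := hC.abs_pos (n + 1)
      calc _ ≤ |q n * ρ - p n| * ret f q p (n + 1) x -
            |q (n + 1) * ρ - p (n + 1)| * ret f q p n x := by gcongr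
        _ ≤ _ := h1
        _ ≤ _ := by gcongr)
  exact ⟨s, C, hs, hC0, fun n x => (hM n x).trans (h n)⟩

theorem exists_ret_bounds_of_le (hf : RotLift f ρ) (hC : Convergents ρ q p) (N : ℕ) :
    ∃ C, 1 ≤ C ∧ ∀ n ≤ N, ∀ x, |q n * ρ - p n| ≤ C * ret f q p n x ∧
      ret f q p n x ≤ C * |q n * ρ - p n| := by
  have hone : ∀ n, ∃ C, 1 ≤ C ∧ ∀ x, |q n * ρ - p n| ≤ C * ret f q p n x ∧
      ret f q p n x ≤ C * |q n * ρ - p n| := by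
    intro n
    obtain ⟨x₀, hx₀⟩ := exists_forall_le_of_periodic (hf.continuous_ret (q := q) (p := p) n).neg
      (fun x => by rw [Pi.neg_apply, Pi.neg_apply, hf.ret_add_one])
    have h1 := hf.ret_pos hC n x₀
    have h2 := hC.abs_pos n
    refine ⟨1 + |q n * ρ - p n| / ret f q p n x₀ + 1 / |q n * ρ - p n|, ?_, fun x => ⟨?_, ?_⟩⟩
    · have : 0 ≤ |q n * ρ - p n| / ret f q p n x₀ + 1 / |q n * ρ - p n| := by positivity
      linarith
    · have h3 : ret f q p n x₀ ≤ ret f q p n x := neg_le_neg_iff.1 (hx₀ x)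
      have h4 := hf.ret_pos hC n x
      calc |q n * ρ - p n| = |q n * ρ - p n| / ret f q p n x₀ * ret f q p n x₀ := by field_simp
        _ ≤ |q n * ρ - p n| / ret f q p n x₀ * ret f q p n x := by gcongr
        _ ≤ _ := by
          gcongr
          have : 0 ≤ 1 / |q n * ρ - p n| := by positivity
          linarith
    · calc ret f q p n x ≤ 1 := hf.ret_le_one hC n x
        _ = 1 / |q n * ρ - p n| * |q n * ρ - p n| := by field_simp
        _ ≤ _ := by
          gcongr
          have : 0 ≤ |q n * ρ - p n| / ret f q p n x₀ := by positivity
          linarith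
  induction N with
  | zero =>
    obtain ⟨C, h1, h⟩ := hone 0
    exact ⟨C, h1, fun n hn x => by rw [Nat.le_zero.1 hn]; exact h x⟩
  | succ N ih =>
    obtain ⟨C, h1, h⟩ := ih
    obtain ⟨C', h1', h'⟩ := hone (N + 1)
    refine ⟨C + C', by linarith, fun n hn x => ?_⟩
    have h2 := hC.abs_pos n
    have h3 := hf.ret_pos hC n x
    rcases Nat.le_succ_iff.1 hn with h4 | rfl
    · obtain ⟨a, b⟩ := h n h4 x
      constructor <;> nlinarith
    · obtain ⟨a, b⟩ := h' x
      constructor <;> nlinarith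

theorem exists_ret_bounds (hf : RotLift f ρ) (hC : Convergents ρ q p) {c : ℝ} {k : ℕ}
    (hc : 0 < c) (hdio : ∀ n, c * |q n * ρ - p n| ^ (1 + k) ≤ |q (n + 1) * ρ - p (n + 1)|) :
    ∃ C, 1 ≤ C ∧ ∀ n x, |q n * ρ - p n| ≤ C * ret f q p n x ∧
      ret f q p n x ≤ C * |q n * ρ - p n| := by
  obtain ⟨M, hM, hM', hσ⟩ := hf.exists_retMax hC
  obtain ⟨χ, hχ⟩ := hf.exists_isRotSemiconj_of_convergents hC hM hσ
  have hM1 : ∀ n, M n ≤ 1 := fun n => by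
    obtain ⟨x, hx⟩ := hM' n
    exact hx ▸ hf.ret_le_one hC n x
  have hM0 : ∀ n, 0 < M n := fun n => (hf.ret_pos hC n 0).trans_le (hM n 0)
  obtain ⟨s, C₁, hs, hC₁, hpow⟩ := hf.exists_ret_le_rpow hC hc hdio
  have ha1 : ∀ n, |q n * ρ - p n| ≤ 1 := fun n => by
    have h1 := hC.mul_le n
    have h2 : (1 : ℝ) ≤ q (n + 1) := by exact_mod_cast hC.q_pos _
    nlinarith [abs_nonneg (q n * ρ - p n)]
  obtain ⟨m, hm⟩ := exists_nat_ge (k / s)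
  have hm' : (k : ℝ) ≤ s * m := by rwa [div_le_iff₀' hs] at hm
  obtain ⟨C, hC1, H⟩ := hf.exists_ret_ratio (K := 1 + 2 * m) (by omega)
  -- the error term of the ratio estimate is dominated by the next displacement
  have herr : ∀ n, √(M n) ^ (1 + 2 * m) * |q n * ρ - p n| ≤
      C₁ ^ m / c * (√(M n) * |q (n + 1) * ρ - p (n + 1)|) := by
    intro n
    have h1 : M n ≤ C₁ * |q n * ρ - p n| ^ s := by
      obtain ⟨x, hx⟩ := hM' n
      exact hx ▸ hpow n x
    have h0 := hC.abs_pos n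
    have hd := hdio n
    have ha := ha1 n
    set a := |q n * ρ - p n|
    have h2 : (a ^ s) ^ m ≤ a ^ k := by
      rw [← Real.rpow_natCast, ← Real.rpow_mul h0.le, ← Real.rpow_natCast]
      exact Real.rpow_le_rpow_of_exponent_ge h0 ha hm'
    have h3 : M n ^ m ≤ C₁ ^ m * a ^ k := by
      calc M n ^ m ≤ (C₁ * a ^ s) ^ m := pow_le_pow_left₀ (hM0 n).le h1 m
        _ = C₁ ^ m * (a ^ s) ^ m := mul_pow _ _ _
        _ ≤ _ := by gcongr
    calc √(M n) ^ (1 + 2 * m) * a = √(M n) * (M n ^ m * a) := by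
          rw [pow_add, pow_mul, Real.sq_sqrt (hM0 n).le]; ring
      _ ≤ √(M n) * (C₁ ^ m * a ^ k * a) := by gcongr
      _ = √(M n) * (C₁ ^ m / c * (c * a ^ (1 + k))) := by field_simp; ring
      _ ≤ √(M n) * (C₁ ^ m / c * |q (n + 1) * ρ - p (n + 1)|) := by gcongr
      _ = _ := by ring
  set B := C + C * (C₁ ^ m / c) with hB
  have hB0 : 0 < B := by positivity
  have hratio : ∀ n x, |(|q n * ρ - p n| * ret f q p (n + 1) x -
      |q (n + 1) * ρ - p (n + 1)| * ret f q p n x)| ≤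
      B * √(M n) * (|q n * ρ - p n| * ret f q p (n + 1) x +
        |q (n + 1) * ρ - p (n + 1)| * ret f q p n x) := by
    intro n x
    refine (H hC hχ (hM n) (hM1 n) x).trans ?_
    have h1 := hC.abs_pos n
    have h2 := hC.abs_pos (n + 1)
    have h3 := hf.ret_pos hC n x
    have h4 := hf.ret_pos hC (n + 1) x
    have h5 : C * √(M n) ^ (1 + 2 * m) * (|q n * ρ - p n| * ret f q p n x) ≤
        C * (C₁ ^ m / c * (√(M n) * |q (n + 1) * ρ - p (n + 1)|)) * ret f q p n x := by
      calc _ = C * (√(M n) ^ (1 + 2 * m) * |q n * ρ - p n|) * ret f q p n x := by ring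
        _ ≤ _ := mul_le_mul_of_nonneg_right
          (mul_le_mul_of_nonneg_left (herr n) (by linarith)) h3.le
    have h6 : 0 ≤ C * (C₁ ^ m / c) * √(M n) * (|q n * ρ - p n| * ret f q p (n + 1) x) := by
      positivity
    rw [hB]
    linarith
  obtain ⟨N, hN⟩ := eventually_atTop.1
    (hσ.tendsto_atTop_zero.eventually (gt_mem_nhds (show 0 < 1 / (2 * B) by positivity)))
  obtain ⟨C₂, hC₂, hbase⟩ := hf.exists_ret_bounds_of_le hC N
  set S := 4 * B * ∑' n, √(M n) with hS
  have hsum : ∀ n, ∑ i ∈ Finset.range n, 4 * B * √(M i) ≤ S := fun n => by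
    rw [← Finset.mul_sum]
    have := hσ.sum_le_tsum (Finset.range n) (fun i _ => Real.sqrt_nonneg _)
    exact mul_le_mul_of_nonneg_left this (by positivity)
  have hS1 : 1 ≤ Real.exp S := Real.one_le_exp (by simpa using hsum 0)
  refine ⟨Real.exp S * C₂, by nlinarith, fun n x => ?_⟩
  have h2 := hC.abs_pos n
  have h3 := hf.ret_pos hC n x
  rcases le_total n N with hn | hn
  · obtain ⟨e1, e2⟩ := hbase n hn x
    exact ⟨e1.trans (by gcongr; nlinarith), e2.trans (by gcongr; nlinarith)⟩
  have hstep : ∀ n, N ≤ n →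
      ret f q p (n + 1) x / |q (n + 1) * ρ - p (n + 1)| ≤
        (1 + 4 * B * √(M n)) * (ret f q p n x / |q n * ρ - p n|) ∧
      ret f q p n x / |q n * ρ - p n| ≤
        (1 + 4 * B * √(M n)) * (ret f q p (n + 1) x / |q (n + 1) * ρ - p (n + 1)|) := by
    intro n hn
    have h1 := hC.abs_pos n
    have h2 := hC.abs_pos (n + 1)
    have h3 := hf.ret_pos hC n x
    have h4 := hf.ret_pos hC (n + 1) x
    have h5 := abs_le.1 (hratio n x)
    have h6 := hN n hn
    rw [lt_div_iff₀ (by positivity)] at h6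
    have h7 := Real.sqrt_nonneg (M n)
    set y := B * √(M n) with hy
    have hy0 : 0 ≤ y := by positivity
    have hy1 : y ≤ 1 / 2 := by rw [hy]; linarith
    have h8 : 0 < |q n * ρ - p n| * ret f q p (n + 1) x := by positivity
    have h9 : 0 < |q (n + 1) * ρ - p (n + 1)| * ret f q p n x := by positivity
    set u := |q n * ρ - p n| * ret f q p (n + 1) x with hu
    set v := |q (n + 1) * ρ - p (n + 1)| * ret f q p n x with hv
    have key : ∀ {u v : ℝ}, 0 < u → 0 < v → u - v ≤ y * (u + v) → u ≤ (1 + 4 * y) * v := by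
      intro u v hu hv h
      refine le_of_mul_le_mul_right ?_ (show 0 < 1 - y by linarith)
      nlinarith [mul_nonneg (mul_nonneg hy0 hv.le) (show 0 ≤ 1 / 2 - y by linarith)]
    rw [div_le_iff₀ h2, div_le_iff₀ h1, mul_assoc 4 B, ← hy]
    constructor
    · rw [mul_assoc, div_mul_eq_mul_div, ← mul_div_assoc, le_div_iff₀ h1]
      have := key h8 h9 (by linarith)
      rw [hu, hv] at this
      linarith
    · rw [mul_assoc, div_mul_eq_mul_div, ← mul_div_assoc, le_div_iff₀ h2]
      have := key h9 h8 (by linarith)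
      rw [hu, hv] at this
      linarith
  obtain ⟨e1, e2⟩ := le_exp_mul_of_ratio (R := fun n => ret f q p n x / |q n * ρ - p n|)
    hsum (fun n => by have := Real.sqrt_nonneg (M n); positivity)
    (fun n => div_pos (hf.ret_pos hC n x) (hC.abs_pos n)) (fun n hn => (hstep n hn).1)
    (fun n hn => (hstep n hn).2) hn
  obtain ⟨b1, b2⟩ := hbase N le_rfl x
  have h4 := hC.abs_pos N
  have h5 := hf.ret_pos hC N x
  have b1' : 1 ≤ C₂ * (ret f q p N x / |q N * ρ - p N|) := by
    rw [← mul_div_assoc, one_le_div h4]; exact b1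
  have b2' : ret f q p N x / |q N * ρ - p N| ≤ C₂ := by rwa [div_le_iff₀ h4]
  constructor
  · have : 1 ≤ Real.exp S * C₂ * (ret f q p n x / |q n * ρ - p n|) := by
      calc 1 ≤ _ := b1'
        _ ≤ C₂ * (Real.exp S * (ret f q p n x / |q n * ρ - p n|)) := by gcongr
        _ = _ := by ring
    rwa [← mul_div_assoc, one_le_div h2] at this
  · rw [← div_le_iff₀ h2]
    exact e1.trans (by gcongr)

end RotLift

/-- The a priori bounds satisfied by a lift with Diophantine rotation number. -/
structure AprioriBounds (f : ℝ → ℝ) (ρ : ℝ) (q : ℕ → ℕ) (p : ℕ → ℤ) : Prop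
    extends RotLift f ρ where
  convergents : Convergents ρ q p
  exists_q_le : ∃ (C : ℝ) (k : ℕ), 1 ≤ C ∧ 1 ≤ k ∧ ∀ n, (q (n + 1) : ℝ) ≤ C * (q n : ℝ) ^ k
  exists_deriv_le : ∃ C, 1 ≤ C ∧ ∀ l x, deriv f^[l] x ≤ C ∧ 1 ≤ C * deriv f^[l] x
  exists_iteratedDeriv_le : ∀ r, ∃ C, 1 ≤ C ∧ ∀ n, ∀ l ≤ q (n + 1), ∀ k ≤ r, ∀ x,
    |iteratedDeriv k (nonlin f l) x| ≤ C * √(q (n + 1)) ^ (k + 1)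
  exists_gap_le : ∃ C, 1 ≤ C ∧ ∀ n x, |gap f (q n) (p n) x| ≤ C / q (n + 1)

theorem Convergents.tendsto_q {ρ : ℝ} {q : ℕ → ℕ} {p : ℕ → ℤ} (hC : Convergents ρ q p) :
    Tendsto q atTop atTop := by
  have h1 : ∀ n, n ≤ q (2 * n) := by
    intro n
    induction n with
    | zero => simp
    | succ n ih =>
      have h2 := hC.two_q_le (2 * n)
      have h3 := hC.q_pos (2 * n)
      rw [show 2 * (n + 1) = 2 * n + 2 by ring]
      omega
  exact tendsto_atTop_mono' atTop (Eventually.of_forall fun n => show n / 2 ≤ q n from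
    (h1 (n / 2)).trans (monotone_nat_of_le_succ hC.q_le (by omega)))
    (tendsto_atTop.2 fun b => (eventually_ge_atTop (2 * b)).mono fun n hn => by omega)

theorem DiophantineWith.le_mul {c β ρ : ℝ} (h : DiophantineWith c β ρ) {q : ℕ} (hq : 1 ≤ q)
    (p : ℤ) {k : ℕ} (hk : 1 + β ≤ k) : c ≤ |q * ρ - p| * (q : ℝ) ^ k := by
  have hq0 : (0 : ℝ) < q := by exact_mod_cast hq
  have hq1 : (1 : ℝ) ≤ q := by exact_mod_cast hq
  have h1 := h p q hq
  have h2 : |(q : ℝ) * ρ - p| = q * |ρ - p / q| := by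
    rw [← abs_of_pos hq0, ← abs_mul, abs_of_pos hq0]
    congr 1
    field_simp
  rw [div_le_iff₀ (by positivity), show (2 : ℝ) + β = 1 + (1 + β) by ring,
    Real.rpow_add hq0, Real.rpow_one] at h1
  rw [h2]
  have h3 : (q : ℝ) ^ (1 + β) ≤ (q : ℝ) ^ k := by
    rw [← Real.rpow_natCast]
    exact Real.rpow_le_rpow_of_exponent_le hq1 hk
  calc c ≤ _ := h1
    _ = q * |ρ - p / q| * (q : ℝ) ^ (1 + β) := by ring
    _ ≤ _ := by gcongr

theorem RotLift.exists_aprioriBounds {f : ℝ → ℝ} {ρ : ℝ} (hf : RotLift f ρ)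
    (hdio : Diophantine ρ) : ∃ q p, AprioriBounds f ρ q p := by
  obtain ⟨q, p, hC⟩ := exists_convergents hf.irrational
  obtain ⟨c, hc, β, hβ, hd⟩ := hdio
  obtain ⟨k, hk⟩ := exists_nat_ge β
  have hk' : 1 + β ≤ (1 + k : ℕ) := by push_cast; linarith
  have ha := hC.abs_pos
  have hq1 : ∀ n, (1 : ℝ) ≤ q n := fun n => by exact_mod_cast hC.q_pos n
  have hstep : ∀ n, c * |q n * ρ - p n| ^ (1 + k) ≤ |q (n + 1) * ρ - p (n + 1)| := by
    intro n
    have h1 := hd.le_mul (hC.q_pos (n + 1)) (p (n + 1)) hk'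
    have h2 := hC.mul_le n
    have := ha n
    have := hq1 (n + 1)
    calc c * |q n * ρ - p n| ^ (1 + k)
        ≤ |q (n + 1) * ρ - p (n + 1)| * (q (n + 1) : ℝ) ^ (1 + k) * |q n * ρ - p n| ^ (1 + k) := by
          gcongr
      _ = |q (n + 1) * ρ - p (n + 1)| * (q (n + 1) * |q n * ρ - p n|) ^ (1 + k) := by
          rw [mul_pow]; ring
      _ ≤ |q (n + 1) * ρ - p (n + 1)| * 1 := by
          gcongr
          exact pow_le_one₀ (by positivity) h2
      _ = _ := mul_one _
  obtain ⟨C, hC1, hret⟩ := hf.exists_ret_bounds hC hc hstep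
  have hle : ∀ n x, ret f q p n x ≤ 1 := fun n x => hf.ret_le_one hC n x
  refine ⟨q, p, hf, hC, ⟨1 / c + 1, 1 + k, ?_, by omega, fun n => ?_⟩, ?_, fun r => ?_,
    ⟨C, hC1, fun n x => ?_⟩⟩
  · have : 0 < 1 / c := by positivity
    linarith
  · have h1 := hd.le_mul (hC.q_pos n) (p n) hk'
    have h2 := hC.mul_le n
    have := hq1 n
    calc (q (n + 1) : ℝ) = 1 / c * (c * q (n + 1)) := by field_simp
      _ ≤ 1 / c * (|q n * ρ - p n| * (q n : ℝ) ^ (1 + k) * q (n + 1)) := by gcongr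
      _ = 1 / c * (q n : ℝ) ^ (1 + k) * (q (n + 1) * |q n * ρ - p n|) := by ring
      _ ≤ 1 / c * (q n : ℝ) ^ (1 + k) * 1 := by gcongr
      _ ≤ _ := by
        rw [mul_one]
        gcongr
        linarith
  · obtain ⟨B, hB, H⟩ := hf.exists_ret_comparison
    refine ⟨B * C ^ 2, by nlinarith [mul_pos (show 0 < B by linarith) (show 0 < C by linarith)],
      fun l x => ?_⟩
    obtain ⟨n, hn⟩ := ((hC.tendsto_q.comp (tendsto_add_atTop_nat 1)).eventually_ge_atTop l).exists
    obtain ⟨-, -, h3, h4⟩ := H hC (n := n) (hle n) le_rfl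
    have e1 := hret n x
    have e2 := hret n (f^[l] x)
    have e3 := hf.ret_pos hC n x
    have e4 := hf.ret_pos hC n (f^[l] x)
    have key : ∀ y z, ret f q p n y ≤ C ^ 2 * ret f q p n z := fun y z => by
      have := (hret n y).2
      have := (hret n z).1
      nlinarith
    have hd := (hf.toSmoothLift.iterate l).deriv_pos x
    constructor
    · refine (h3 l hn x).trans ?_
      gcongr
      rw [div_le_iff₀ e3]
      exact key _ _
    · have h5 := h4 l hn x
      rw [div_le_iff₀ e3] at h5
      have h6 := key x (f^[l] x)
      refine le_of_mul_le_mul_right ?_ e3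
      calc 1 * ret f q p n x ≤ C ^ 2 * ret f q p n (f^[l] x) := by linarith
        _ ≤ C ^ 2 * (B * deriv f^[l] x * ret f q p n x) := by gcongr
        _ = _ := by ring
  · obtain ⟨B, hB, H⟩ := hf.exists_jetLe_nonlin_ret r
    refine ⟨B * (2 * C ^ 2) ^ (r + 1), one_le_mul_of_one_le_of_one_le hB
      (one_le_pow₀ (by nlinarith)), fun n l hl j hj x => ?_⟩
    set a := |q n * ρ - p n| with ha'
    have ha0 : 0 < a := ha n
    have h0 := hf.ret_pos hC n x
    have hM : ∀ y, ret f q p n y ≤ min 1 (C * a) := fun y => le_min (hle n y) (hret n y).2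
    have h1 := H hC hM (min_le_left _ _) l hl x j hj
    have h2 : √(min 1 (C * a)) / ret f q p n x ≤ 2 * C ^ 2 * √(q (n + 1)) := by
      have e1 : √(min 1 (C * a)) ≤ C * √a := by
        refine (Real.sqrt_le_sqrt (min_le_right _ _)).trans ?_
        rw [Real.sqrt_mul (by positivity)]
        gcongr
        rw [Real.sqrt_le_left (by linarith)]
        nlinarith
      have e2 : 1 ≤ 2 * (√a * √(q (n + 1))) := by
        have e3 := hC.le_mul n
        rw [← Real.sqrt_mul ha0.le]
        have e4 : 1 / 2 ≤ √(a * q (n + 1)) := by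
          apply Real.le_sqrt_of_sq_le
          rw [mul_comm]
          linarith
        linarith
      have e5 := (hret n x).1
      have e6 : √a * √a = a := Real.mul_self_sqrt ha0.le
      have e7 : 0 < √a := Real.sqrt_pos.2 ha0
      rw [div_le_iff₀ h0]
      calc √(min 1 (C * a)) ≤ C * √a * 1 := by rw [mul_one]; exact e1
        _ ≤ C * √a * (2 * (√a * √(q (n + 1)))) := by gcongr
        _ = 2 * C * √(q (n + 1)) * (√a * √a) := by ring
        _ ≤ 2 * C * √(q (n + 1)) * (C * ret f q p n x) := by rw [e6]; gcongr
        _ = _ := by ring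
    have hq0 := Real.sqrt_nonneg (q (n + 1))
    have h4 : 0 ≤ √(min 1 (C * a)) / ret f q p n x := by positivity
    calc _ ≤ _ := h1
      _ = B * (√(min 1 (C * a)) / ret f q p n x) ^ (j + 1) := by ring
      _ ≤ B * (2 * C ^ 2 * √(q (n + 1))) ^ (j + 1) := by gcongr
      _ = B * (2 * C ^ 2) ^ (j + 1) * √(q (n + 1)) ^ (j + 1) := by ring
      _ ≤ _ := by
        gcongr
        nlinarith
  · have h1 := (hret n x).2
    have h2 := hC.mul_le n
    have h3 := hq1 (n + 1)
    rw [le_div_iff₀ (by linarith)]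
    calc _ ≤ C * |q n * ρ - p n| * q (n + 1) := by
          have := h1
          rw [ret] at this
          gcongr
      _ = C * (q (n + 1) * |q n * ρ - p n|) := by ring
      _ ≤ C * 1 := by gcongr
      _ = C := mul_one C

/-- The derivatives up to order `r` of the family `u` are bounded by `w * φ ^ ε` for every
`ε > 0`, up to a constant. -/
def SubpolyJets {ι : Type*} (φ w : ι → ℝ) (r : ℕ) (u : ι → ℝ → ℝ) : Prop :=
  ∀ ε : ℝ, 0 < ε → ∃ C, 0 ≤ C ∧ ∀ i, ∀ k ≤ r, ∀ x, |iteratedDeriv k (u i) x| ≤ C * w i * φ i ^ ε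

namespace SubpolyJets
variable {ι κ : Type*} {φ w w' : ι → ℝ} {r : ℕ} {u v : ι → ℝ → ℝ}

theorem mono {r' : ℕ} (h : SubpolyJets φ w r u) (hr : r' ≤ r) : SubpolyJets φ w r' u := by
  intro ε hε
  obtain ⟨C, hC, H⟩ := h ε hε
  exact ⟨C, hC, fun i k hk => H i k (hk.trans hr)⟩

theorem congr (h : SubpolyJets φ w r u) (huv : ∀ i x, v i x = u i x) : SubpolyJets φ w r v := by
  rwa [show v = u from funext fun i => funext (huv i)]

theorem mono_weight (h : SubpolyJets φ w r u) (hφ : ∀ i, 1 ≤ φ i) {A : ℝ} (hA : 0 ≤ A)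
    (hw : ∀ i, w i ≤ A * w' i) : SubpolyJets φ w' r u := by
  intro ε hε
  obtain ⟨C, hC, H⟩ := h ε hε
  refine ⟨C * A, by positivity, fun i k hk x => (H i k hk x).trans ?_⟩
  have : 0 ≤ φ i ^ ε := Real.rpow_nonneg (by linarith [hφ i]) _
  rw [mul_assoc C A]
  gcongr
  exact hw i

theorem reindex (h : SubpolyJets φ w r u) (hφ : ∀ i, 1 ≤ φ i) (hw : ∀ i, 0 ≤ w i) (g : κ → ι)
    {ψ : κ → ℝ} {A : ℝ} {m : ℕ} (hA : 0 ≤ A) (hψ : ∀ j, 0 ≤ ψ j)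
    (hm : 1 ≤ m) (hg : ∀ j, φ (g j) ≤ A * ψ j ^ m) :
    SubpolyJets ψ (fun j => w (g j)) r (fun j => u (g j)) := by
  intro ε hε
  have hm0 : (0 : ℝ) < m := by exact_mod_cast hm
  obtain ⟨C, hC, H⟩ := h (ε / m) (by positivity)
  refine ⟨C * A ^ (ε / m), by positivity, fun j k hk x => (H (g j) k hk x).trans ?_⟩
  have h1 : φ (g j) ^ (ε / m) ≤ A ^ (ε / m) * ψ j ^ ε := by
    calc φ (g j) ^ (ε / m) ≤ (A * ψ j ^ m) ^ (ε / m) :=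
          Real.rpow_le_rpow (by linarith [hφ (g j)]) (hg j) (by positivity)
      _ = A ^ (ε / m) * (ψ j ^ m) ^ (ε / m) := Real.mul_rpow hA (pow_nonneg (hψ j) _)
      _ = _ := by
        rw [← Real.rpow_natCast, ← Real.rpow_mul (hψ j), mul_div_cancel₀ _ hm0.ne']
  have := hw (g j)
  calc _ ≤ C * w (g j) * (A ^ (ε / m) * ψ j ^ ε) := by gcongr
    _ = _ := by ring

theorem of_bound (hφ : ∀ i, 1 ≤ φ i) (hw : ∀ i, 0 ≤ w i) {C : ℝ} (hC : 0 ≤ C)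
    (h : ∀ i, ∀ k ≤ r, ∀ x, |iteratedDeriv k (u i) x| ≤ C * w i) : SubpolyJets φ w r u :=
  fun _ hε => ⟨C, hC, fun i k hk x => (h i k hk x).trans (le_mul_of_one_le_right
    (mul_nonneg hC (hw i)) (Real.one_le_rpow (hφ i) hε.le))⟩

theorem deriv (h : SubpolyJets φ w (r + 1) u) : SubpolyJets φ w r (fun i => deriv (u i)) := by
  intro ε hε
  obtain ⟨C, hC, H⟩ := h ε hε
  refine ⟨C, hC, fun i k hk x => ?_⟩
  rw [← iteratedDeriv_succ']
  exact H i (k + 1) (by omega) x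

theorem of_deriv (h0 : SubpolyJets φ w 0 u) (h : SubpolyJets φ w r (fun i => _root_.deriv (u i)))
    (hφ : ∀ i, 1 ≤ φ i) (hw : ∀ i, 0 ≤ w i) : SubpolyJets φ w (r + 1) u := by
  intro ε hε
  obtain ⟨C₀, hC₀, H₀⟩ := h0 ε hε
  obtain ⟨C, hC, H⟩ := h ε hε
  refine ⟨C₀ + C, by positivity, fun i k hk x => ?_⟩
  have h1 : 0 ≤ w i * φ i ^ ε := mul_nonneg (hw i) (Real.rpow_nonneg (by linarith [hφ i]) _)
  rcases k with _ | k
  · refine (H₀ i 0 le_rfl x).trans ?_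
    nlinarith [mul_nonneg hC h1]
  · rw [iteratedDeriv_succ']
    refine (H i k (by omega) x).trans ?_
    nlinarith [mul_nonneg hC₀ h1]

theorem mul (h : SubpolyJets φ w r u) (h' : SubpolyJets φ w' r v) (hφ : ∀ i, 1 ≤ φ i)
    (hu : ∀ i, ContDiff ℝ (⊤ : ℕ∞) (u i)) (hv : ∀ i, ContDiff ℝ (⊤ : ℕ∞) (v i)) :
    SubpolyJets φ (fun i => w i * w' i) r (fun i x => u i x * v i x) := by
  intro ε hε
  obtain ⟨C, hC, H⟩ := h (ε / 2) (by positivity)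
  obtain ⟨C', hC', H'⟩ := h' (ε / 2) (by positivity)
  refine ⟨2 ^ r * (C * C'), by positivity, fun i k hk x => ?_⟩
  have h1 := JetLe.mul (K := r) (x := x) (L := 1) (B := C * w i * φ i ^ (ε / 2))
    (B' := C' * w' i * φ i ^ (ε / 2)) (hu i) (hv i) zero_le_one
    (fun k hk => by simpa using H i k hk x) (fun k hk => by simpa using H' i k hk x) k hk
  refine h1.trans_eq ?_
  rw [show φ i ^ ε = φ i ^ (ε / 2) * φ i ^ (ε / 2) by
    rw [← Real.rpow_add (by linarith [hφ i])]; ring_nf]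
  ring

theorem add (h : SubpolyJets φ w r u) (h' : SubpolyJets φ w r v)
    (hu : ∀ i, ContDiff ℝ (⊤ : ℕ∞) (u i)) (hv : ∀ i, ContDiff ℝ (⊤ : ℕ∞) (v i)) :
    SubpolyJets φ w r (fun i x => u i x + v i x) := by
  intro ε hε
  obtain ⟨C, hC, H⟩ := h ε hε
  obtain ⟨C', hC', H'⟩ := h' ε hε
  refine ⟨C + C', by positivity, fun i k hk x => ?_⟩
  rw [iteratedDeriv_fun_add ((hu i).of_le (by exact_mod_cast le_top)).contDiffAt
    ((hv i).of_le (by exact_mod_cast le_top)).contDiffAt]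
  refine (abs_add_le _ _).trans ((add_le_add (H i k hk x) (H' i k hk x)).trans_eq (by ring))

theorem comp (h : SubpolyJets φ w r u) {g : ι → ℝ → ℝ}
    (hg : SubpolyJets φ (fun _ => 1) (r - 1) (fun i => _root_.deriv (g i))) (hφ : ∀ i, 1 ≤ φ i)
    (hw : ∀ i, 0 ≤ w i) (hu : ∀ i, ContDiff ℝ (⊤ : ℕ∞) (u i))
    (hgs : ∀ i, ContDiff ℝ (⊤ : ℕ∞) (g i)) :
    SubpolyJets φ w r (fun i x => u i (g i x)) := by
  have h0 : ∀ {u : ι → ℝ → ℝ} {r}, SubpolyJets φ w r u →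
      SubpolyJets φ w 0 (fun i x => u i (g i x)) := by
    intro u r h ε hε
    obtain ⟨C, hC, H⟩ := h ε hε
    refine ⟨C, hC, fun i k hk x => ?_⟩
    obtain rfl := Nat.le_zero.1 hk
    simpa using H i 0 (Nat.zero_le _) (g i x)
  induction r generalizing u with
  | zero => exact h0 h
  | succ r ih =>
    refine of_deriv (h0 h) ?_ hφ hw
    have h1 := (ih (u := fun i => _root_.deriv (u i)) h.deriv (hg.mono (by omega))
      (fun i => (contDiff_infty_iff_deriv.1 (hu i)).2)).mul hg hφ
      (fun i => (contDiff_infty_iff_deriv.1 (hu i)).2.comp (hgs i))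
      (fun i => (contDiff_infty_iff_deriv.1 (hgs i)).2)
    simp only [mul_one] at h1
    refine h1.congr fun i x => ?_
    exact (((hu i).differentiable (by simp) _).hasDerivAt.comp x
      ((hgs i).differentiable (by simp) x).hasDerivAt).deriv

theorem exp (h : SubpolyJets φ (fun _ => 1) r u)
    (h0 : SubpolyJets φ (fun _ => 1) 0 (fun i x => Real.exp (u i x))) (hφ : ∀ i, 1 ≤ φ i)
    (hu : ∀ i, ContDiff ℝ (⊤ : ℕ∞) (u i)) :
    SubpolyJets φ (fun _ => 1) r (fun i x => Real.exp (u i x)) := by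
  induction r with
  | zero => exact h0
  | succ r ih =>
    refine of_deriv h0 ?_ hφ (fun _ => zero_le_one)
    have h1 := (ih (h.mono (Nat.le_succ r))).mul h.deriv hφ (fun i => (hu i).exp)
      (fun i => (contDiff_infty_iff_deriv.1 (hu i)).2)
    simp only [mul_one] at h1
    refine h1.congr fun i x => ?_
    exact ((hu i).differentiable (by simp) x).hasDerivAt.exp.deriv

theorem comp_add_sub (hφ : ∀ i, 1 ≤ φ i) (hw : ∀ i, 0 ≤ w i) (hw1 : ∀ i, w i ≤ 1)
    {δ : ι → ℝ → ℝ} (hu : ∀ i, ContDiff ℝ (⊤ : ℕ∞) (u i)) (hδ : ∀ i, ContDiff ℝ (⊤ : ℕ∞) (δ i))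
    (h : SubpolyJets φ (fun _ => 1) (r + 1) u) (hd : SubpolyJets φ w r δ) :
    SubpolyJets φ w r (fun i x => u i (x + δ i x) - u i x) := by
  have h0 : ∀ {u : ι → ℝ → ℝ} {r s : ℕ}, (∀ i, ContDiff ℝ (⊤ : ℕ∞) (u i)) →
      SubpolyJets φ (fun _ => 1) (r + 1) u →
      SubpolyJets φ w s δ → SubpolyJets φ w 0 (fun i x => u i (x + δ i x) - u i x) := by
    intro u r s hu h hd ε hε
    obtain ⟨C, hC, H⟩ := h (ε / 2) (by positivity)
    obtain ⟨C', hC', H'⟩ := hd (ε / 2) (by positivity)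
    refine ⟨C * C', by positivity, fun i k hk x => ?_⟩
    obtain rfl := Nat.le_zero.1 hk
    have h1 : |u i (x + δ i x) - u i x| ≤ C * 1 * φ i ^ (ε / 2) * |x + δ i x - x| := by
      have := Convex.norm_image_sub_le_of_norm_deriv_le (s := univ) (f := u i)
        (x := x) (y := x + δ i x) (fun y _ => (hu i).differentiable (by simp) y)
        (fun y _ => by simpa using H i 1 (by omega) y) convex_univ trivial trivial
      simpa using this
    have h2 := H' i 0 (Nat.zero_le _) x
    have h3 : 0 ≤ φ i ^ (ε / 2) := Real.rpow_nonneg (by linarith [hφ i]) _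
    simp only [iteratedDeriv_zero] at h2 ⊢
    rw [add_sub_cancel_left] at h1
    calc _ ≤ _ := h1
      _ ≤ C * 1 * φ i ^ (ε / 2) * (C' * w i * φ i ^ (ε / 2)) := by gcongr
      _ = C * C' * w i * (φ i ^ (ε / 2) * φ i ^ (ε / 2)) := by ring
      _ = _ := by
        rw [← Real.rpow_add (by linarith [hφ i])]; ring_nf
  induction r generalizing u with
  | zero => exact h0 hu h hd
  | succ r ih =>
    refine of_deriv (h0 hu h hd) ?_ hφ hw
    have hu' : ∀ i, ContDiff ℝ (⊤ : ℕ∞) (_root_.deriv (u i)) := fun i =>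
      (contDiff_infty_iff_deriv.1 (hu i)).2
    have hδ' : ∀ i, ContDiff ℝ (⊤ : ℕ∞) (_root_.deriv (δ i)) := fun i =>
      (contDiff_infty_iff_deriv.1 (hδ i)).2
    have h1 : SubpolyJets φ (fun _ => 1) r (fun i x => 1 + _root_.deriv (δ i) x) := by
      refine SubpolyJets.add (u := fun _ _ => 1) ?_
        (hd.deriv.mono_weight hφ zero_le_one (fun i => by simpa using hw1 i))
        (fun i => contDiff_const) hδ'
      refine of_bound hφ (fun _ => zero_le_one) zero_le_one fun i k _ x => ?_
      rw [iteratedDeriv_const]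
      split_ifs <;> simp
    have hsm : ∀ i, ContDiff ℝ (⊤ : ℕ∞) (fun x => x + δ i x) := fun i => contDiff_id.add (hδ i)
    have h2 := (ih hu' h.deriv (hd.mono (Nat.le_succ r))).mul h1 hφ
      (fun i => ((hu' i).comp (hsm i)).sub (hu' i)) (fun i => contDiff_const.add (hδ' i))
    have h3 := ((h.deriv.mono (Nat.le_succ r)).mul hd.deriv hφ hu' hδ')
    simp only [mul_one, one_mul] at h2 h3
    refine (h2.add h3 (fun i => (((hu' i).comp (hsm i)).sub (hu' i)).mul
      (contDiff_const.add (hδ' i))) (fun i => (hu' i).mul (hδ' i))).congr fun i x => ?_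
    have e1 := ((hδ i).differentiable (by simp) x).hasDerivAt
    have e2 := ((hu i).differentiable (by simp) (x + δ i x)).hasDerivAt.comp x
      ((hasDerivAt_id x).add e1)
    have e3 := (e2.sub ((hu i).differentiable (by simp) x).hasDerivAt).deriv
    refine Eq.trans ?_ (e3.trans ?_)
    · rfl
    · ring

end SubpolyJets

theorem iteratedDeriv_iteratedDeriv (u : ℝ → ℝ) (m n : ℕ) :
    iteratedDeriv m (iteratedDeriv n u) = iteratedDeriv (n + m) u := by
  rw [iteratedDeriv_eq_iterate, iteratedDeriv_eq_iterate, iteratedDeriv_eq_iterate,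
    ← Function.iterate_add_apply, add_comm]

namespace AprioriBounds
variable {f : ℝ → ℝ} {ρ : ℝ} {q : ℕ → ℕ} {p : ℕ → ℤ}

theorem one_le_q (hA : AprioriBounds f ρ q p) (n : ℕ) : (1 : ℝ) ≤ q n := by
  exact_mod_cast hA.convergents.q_pos n

theorem contDiff_gap (hA : AprioriBounds f ρ q p) (n : ℕ) :
    ContDiff ℝ (⊤ : ℕ∞) (gap f (q n) (p n)) :=
  show ContDiff ℝ (⊤ : ℕ∞) fun x => f^[q n] x - (p n : ℝ) - x from
    ((hA.toSmoothLift.iterate (q n)).contDiff.sub contDiff_const).sub contDiff_fun_id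

theorem deriv_gap (hA : AprioriBounds f ρ q p) (n : ℕ) (x : ℝ) :
    deriv (gap f (q n) (p n)) x = deriv f^[q n] x - 1 := (hA.hasDerivAt_gap (q n) (p n) x).deriv

theorem exists_jet_nonlin_le (hA : AprioriBounds f ρ q p) (r : ℕ) : ∃ C, 1 ≤ C ∧ ∀ n, ∀ k ≤ r, ∀ x,
    |iteratedDeriv k (nonlin f (q n)) x| ≤ C * √(q n) ^ (k + 1) := by
  obtain ⟨C, hC, H⟩ := hA.exists_iteratedDeriv_le r
  have h1 : ∀ n, 1 ≤ √(q n : ℝ) := fun n => Real.one_le_sqrt.2 (hA.one_le_q n)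
  refine ⟨C * √(q 1) ^ (r + 1), by nlinarith [one_le_pow₀ (h1 1) (n := r + 1)],
    fun n k hk x => ?_⟩
  rcases n with _ | n
  · refine (H 0 (q 0) (hA.convergents.q_le 0) k hk x).trans ?_
    rw [mul_assoc]
    gcongr
    exact (pow_le_pow_right₀ (h1 1) (by lia)).trans
      (le_mul_of_one_le_right (by positivity) (one_le_pow₀ (h1 0)))
  · refine (H n (q (n + 1)) le_rfl k hk x).trans ?_
    gcongr
    exact le_mul_of_one_le_right (by linarith) (one_le_pow₀ (h1 1))

theorem exists_iteratedDeriv_gap_le (hA : AprioriBounds f ρ q p) (m : ℕ) : ∃ C, 0 ≤ C ∧ ∀ n x,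
    |iteratedDeriv m (gap f (q n) (p n)) x| ≤ C * √(q n) ^ m := by
  have h1 : ∀ n, 1 ≤ √(q n : ℝ) := fun n => Real.one_le_sqrt.2 (hA.one_le_q n)
  obtain ⟨C, hC, hd⟩ := hA.exists_deriv_le
  rcases m with _ | m
  · obtain ⟨C, hC, H⟩ := hA.exists_gap_le
    refine ⟨C, by linarith, fun n x => ?_⟩
    simp only [iteratedDeriv_zero, pow_zero, mul_one]
    exact (H n x).trans (div_le_self (by linarith) (hA.one_le_q _))
  obtain ⟨C₁, hC₁, hn⟩ := hA.exists_jet_nonlin_le m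
  obtain ⟨C₂, hC₂, ho⟩ := JetLe.of_linear_ode m hC₁
  refine ⟨C₂ * C + 1, by positivity, fun n x => ?_⟩
  have hq := h1 n
  have hpos := (hA.toSmoothLift.iterate (q n)).deriv_pos x
  have hj := ho (deriv f^[q n]) (nonlin f (q n)) x (√(q n))
    (hA.toSmoothLift.iterate (q n)).contDiff_deriv (hA.contDiff_nonlin _) (by positivity)
    (fun t => hA.hasDerivAt_deriv_iterate _ t)
    (fun k hk => (hn n k hk x).trans_eq (by ring)) m (by lia)
  have hj' : |iteratedDeriv m (deriv f^[q n]) x| ≤ C₂ * C * √(q n) ^ (m + 1) := by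
    refine hj.trans ?_
    rw [abs_of_pos hpos]
    have := (hd (q n) x).1
    have : √(q n : ℝ) ^ m ≤ √(q n : ℝ) ^ (m + 1) := pow_le_pow_right₀ hq (by lia)
    gcongr
  rw [iteratedDeriv_succ', show deriv (gap f (q n) (p n)) = fun x => deriv f^[q n] x - 1 from
    funext fun x => hA.deriv_gap n x]
  have hp : 1 ≤ √(q n : ℝ) ^ (m + 1) := one_le_pow₀ hq
  rw [iteratedDeriv_fun_sub (((hA.toSmoothLift.iterate (q n)).contDiff_deriv.of_le
    (by exact_mod_cast le_top)).contDiffAt) contDiffAt_const]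
  refine (abs_sub _ _).trans ?_
  have : |iteratedDeriv m (fun _ : ℝ => (1 : ℝ)) x| ≤ 1 := by
    rw [iteratedDeriv_const]; split_ifs <;> simp
  linarith

theorem subpolyJets_gap_zero (hA : AprioriBounds f ρ q p) :
    SubpolyJets (fun n => (q n : ℝ)) (fun n => 1 / (q (n + 1) : ℝ)) 0
      (fun n => gap f (q n) (p n)) := by
  obtain ⟨C, hC, H⟩ := hA.exists_gap_le
  refine .of_bound hA.one_le_q (fun n => by positivity) (by linarith : 0 ≤ C) fun n k hk x => ?_
  obtain rfl := Nat.le_zero.1 hk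
  simpa [div_eq_mul_inv] using H n x

theorem subpolyJets_logD_zero (hA : AprioriBounds f ρ q p) :
    SubpolyJets (fun l : ℕ => (l : ℝ) + 1) (fun _ => 1) 0 (logD f) := by
  obtain ⟨C, hC, H⟩ := hA.exists_deriv_le
  refine .of_bound (fun l => by simp) (fun n => zero_le_one) (Real.log_nonneg hC)
    fun l k hk x => ?_
  obtain rfl := Nat.le_zero.1 hk
  have hpos := (hA.toSmoothLift.iterate l).deriv_pos x
  obtain ⟨h1, h2⟩ := H l x
  have h3 := Real.log_le_log hpos h1
  have h4 := Real.log_nonneg h2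
  rw [Real.log_mul (by positivity) hpos.ne'] at h4
  simp only [iteratedDeriv_zero, mul_one, logD]
  exact abs_le.2 ⟨by linarith, h3⟩

theorem subpolyJets_gap_add_two (hA : AprioriBounds f ρ q p) {r : ℕ}
    (h : SubpolyJets (fun n => (q n : ℝ)) (fun n => 1 / (q (n + 1) : ℝ)) r
      (fun n => gap f (q n) (p n))) :
    SubpolyJets (fun n => (q n : ℝ)) (fun n => (q n : ℝ) / q (n + 1)) (r + 2)
      (fun n => gap f (q n) (p n)) := by
  intro ε hε
  obtain ⟨C₀, k, hC₀, hk, hq⟩ := hA.exists_q_le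
  obtain ⟨C₁, hC₁, H₁⟩ := h (ε / 2) (by positivity)
  obtain ⟨K, hK⟩ := exists_nat_ge ((k + r / 2 : ℝ) / (ε / 4) + 2)
  have hKpos : (0 : ℝ) ≤ (k + r / 2 : ℝ) / (ε / 4) := by positivity
  have hK2 : 2 ≤ K := by
    have : (2 : ℝ) ≤ K := by linarith
    exact_mod_cast this
  have hKk : (k : ℝ) + r / 2 ≤ ε / 4 * K := by
    rw [← div_le_iff₀' (by positivity)]
    linarith
  obtain ⟨C₂, hC₂, H₂⟩ := hA.exists_iteratedDeriv_gap_le (r + K)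
  obtain ⟨C, hC, H⟩ := exists_node_bound K (R := 2 ^ K) (by positivity)
  refine ⟨C₁ + C * (C₁ + C₂ * C₀), by positivity, fun n m hm x => ?_⟩
  have hq1 := hA.one_le_q n
  have hq1' := hA.one_le_q (n + 1)
  have hq0 : (0 : ℝ) < q n := by linarith
  have hq0' : (0 : ℝ) < q (n + 1) := by linarith
  by_cases hmr : m ≤ r
  · refine (H₁ n m hmr x).trans ?_
    have e1 : (q n : ℝ) ^ (ε / 2) ≤ (q n : ℝ) ^ ε :=
      Real.rpow_le_rpow_of_exponent_le hq1 (by linarith)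
    have : 0 ≤ C * (C₁ + C₂ * C₀) := by positivity
    have e2 : 1 / (q (n + 1) : ℝ) ≤ q n / q (n + 1) := by gcongr
    dsimp only
    gcongr
    linarith
  obtain ⟨j, rfl⟩ : ∃ j, m = r + j := ⟨m - r, by lia⟩
  have hj : j ≤ 2 := by lia
  set d : ℝ := (q n : ℝ) ^ (-(1 / 2 + ε / 4)) with hd
  have hd0 : 0 < d := Real.rpow_pos_of_pos hq0 _
  have hv := contDiff_iteratedDeriv_infty (hA.contDiff_gap n) r
  have hbd := H (iteratedDeriv r (gap f (q n) (p n))) hv x (x + 2 ^ K * d) d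
    (C₁ * (1 / (q (n + 1) : ℝ)) * (q n : ℝ) ^ (ε / 2)) (C₂ * √(q n) ^ (r + K))
    (fun i => x + i * d) hd0 (by linarith) (fun i hi => ⟨by simp; positivity, by
      have : (i : ℝ) ≤ 2 ^ K := by exact_mod_cast hi.le
      gcongr⟩) (fun i hi => by push_cast; linarith)
    (fun i hi => H₁ n r le_rfl _) (fun y _ => by
      rw [iteratedDeriv_iteratedDeriv]
      exact H₂ n y) j (by lia) x ⟨le_rfl, by simp; positivity⟩
  rw [iteratedDeriv_iteratedDeriv] at hbd
  have e1 : √(q n : ℝ) ^ (r + K) * d ^ K ≤ C₀ * (1 / (q (n + 1) : ℝ)) * (q n : ℝ) ^ (ε / 2) := by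
    have h1 : √(q n : ℝ) ^ (r + K) * d ^ K = (q n : ℝ) ^ ((r : ℝ) / 2 - ε / 4 * K) := by
      rw [hd, Real.sqrt_eq_rpow, ← Real.rpow_natCast, ← Real.rpow_natCast, ← Real.rpow_mul hq0.le,
        ← Real.rpow_mul hq0.le, ← Real.rpow_add hq0]
      push_cast
      ring_nf
    have h2 : (q n : ℝ) ^ ((r : ℝ) / 2 - ε / 4 * K) ≤ (q n : ℝ) ^ (-(k : ℝ)) :=
      Real.rpow_le_rpow_of_exponent_le hq1 (by linarith)
    have h3 : (q n : ℝ) ^ (-(k : ℝ)) ≤ C₀ * (1 / (q (n + 1) : ℝ)) := by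
      rw [Real.rpow_neg hq0.le, Real.rpow_natCast, ← one_div, mul_one_div,
        div_le_div_iff₀ (by positivity) hq0', one_mul]
      exact hq n
    rw [h1]
    exact (h2.trans h3).trans (le_mul_of_one_le_right (by positivity)
      (Real.one_le_rpow hq1 (by positivity)))
  have e2 : 1 ≤ d ^ j * (q n * (q n : ℝ) ^ (ε / 2)) := by
    have hj' : (j : ℝ) ≤ 2 := by exact_mod_cast hj
    have h1 : d ^ j * (q n * (q n : ℝ) ^ (ε / 2)) =
        (q n : ℝ) ^ (-(1 / 2 + ε / 4) * j + (1 + ε / 2)) := by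
      rw [Real.rpow_add hq0, Real.rpow_add hq0, Real.rpow_one, hd, ← Real.rpow_natCast,
        ← Real.rpow_mul hq0.le]
    rw [h1]
    exact Real.one_le_rpow hq1 (by nlinarith)
  have e3 : (q n : ℝ) ^ ε = (q n : ℝ) ^ (ε / 2) * (q n : ℝ) ^ (ε / 2) := by
    rw [← Real.rpow_add hq0]
    ring_nf
  have e4 : (0 : ℝ) ≤ q n * (q n : ℝ) ^ (ε / 2) := by positivity
  calc |iteratedDeriv (r + j) (gap f (q n) (p n)) x|
      ≤ |iteratedDeriv (r + j) (gap f (q n) (p n)) x| * (d ^ j * (q n * (q n : ℝ) ^ (ε / 2))) :=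
        le_mul_of_one_le_right (abs_nonneg _) e2
    _ = |iteratedDeriv (r + j) (gap f (q n) (p n)) x| * d ^ j * (q n * (q n : ℝ) ^ (ε / 2)) := by
        ring
    _ ≤ C * (C₁ * (1 / (q (n + 1) : ℝ)) * (q n : ℝ) ^ (ε / 2) +
        C₂ * (C₀ * (1 / (q (n + 1) : ℝ)) * (q n : ℝ) ^ (ε / 2))) *
        (q n * (q n : ℝ) ^ (ε / 2)) := by
        refine (mul_le_mul_of_nonneg_right hbd e4).trans ?_
        rw [mul_assoc C₂]
        gcongr
    _ = C * (C₁ + C₂ * C₀) * (q n / q (n + 1)) * (q n : ℝ) ^ ε := by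
        rw [e3]; ring
    _ ≤ _ := by
        dsimp only
        gcongr
        linarith

end AprioriBounds

namespace AprioriBounds
variable {f : ℝ → ℝ} {ρ : ℝ} {q : ℕ → ℕ} {p : ℕ → ℤ} {r : ℕ}

theorem exists_succ_le (hA : AprioriBounds f ρ q p) : ∃ (A : ℝ) (m : ℕ), 0 ≤ A ∧ 1 ≤ m ∧
    ∀ n, ∀ l ≤ q (n + 1) ^ 2, (l : ℝ) + 1 ≤ A * (q n : ℝ) ^ m := by
  obtain ⟨C, k, hC, hk, H⟩ := hA.exists_q_le
  refine ⟨2 * C ^ 2, 2 * k, by positivity, by lia, fun n l hl => ?_⟩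
  have h1 : (l : ℝ) ≤ (q (n + 1) : ℝ) ^ 2 := by exact_mod_cast hl
  have h2 := one_le_pow₀ (hA.one_le_q (n + 1)) (n := 2)
  have h3 := pow_le_pow_left₀ (by positivity) (H n) 2
  calc (l : ℝ) + 1 ≤ 2 * (q (n + 1) : ℝ) ^ 2 := by linarith
    _ ≤ 2 * (C * (q n : ℝ) ^ k) ^ 2 := by linarith
    _ = _ := by ring

theorem subpolyJets_deriv_iterate (hA : AprioriBounds f ρ q p)
    (h : SubpolyJets (fun l : ℕ => (l : ℝ) + 1) (fun _ => 1) r (logD f)) :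
    SubpolyJets (fun l : ℕ => (l : ℝ) + 1) (fun _ => 1) r (fun l => deriv f^[l]) := by
  obtain ⟨C, hC, H⟩ := hA.exists_deriv_le
  have hφ : ∀ l : ℕ, (1 : ℝ) ≤ l + 1 := fun l => by simp
  refine (h.exp ?_ hφ hA.contDiff_logD).congr fun l x => (hA.exp_logD l x).symm
  refine .of_bound hφ (fun n => zero_le_one) (by linarith : 0 ≤ C) fun l k hk x => ?_
  obtain rfl := Nat.le_zero.1 hk
  rw [iteratedDeriv_zero, Real.abs_exp, hA.exp_logD, mul_one]
  exact (H l x).1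

theorem subpolyJets_comp_iterate (hA : AprioriBounds f ρ q p) {ι : Type*} {φ w : ι → ℝ}
    {u : ι → ℝ → ℝ} {g : ι → ℕ} {A : ℝ} {m : ℕ} (hm : 1 ≤ m) (hA0 : 0 ≤ A) (hφ : ∀ i, 1 ≤ φ i)
    (hw : ∀ i, 0 ≤ w i)
    (hg : ∀ i, (g i : ℝ) + 1 ≤ A * φ i ^ m) (hu : ∀ i, ContDiff ℝ (⊤ : ℕ∞) (u i))
    (hr : SubpolyJets φ w r u)
    (h : SubpolyJets (fun l : ℕ => (l : ℝ) + 1) (fun _ => 1) (r - 1) (logD f)) :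
    SubpolyJets φ w r (fun i x => u i (f^[g i] x)) :=
  hr.comp ((hA.subpolyJets_deriv_iterate h).reindex (fun l => by simp) (fun _ => zero_le_one) g hA0
    (fun i => by linarith [hφ i]) hm hg) hφ hw hu
    (fun i => (hA.toSmoothLift.iterate (g i)).contDiff)

theorem subpolyJets_logD_q (hA : AprioriBounds f ρ q p)
    (hD : SubpolyJets (fun n => (q n : ℝ)) (fun n => 1 / (q (n + 1) : ℝ)) r
      (fun n => gap f (q n) (p n)))
    (hW : SubpolyJets (fun l : ℕ => (l : ℝ) + 1) (fun _ => 1) r (logD f)) :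
    SubpolyJets (fun n => (q n : ℝ)) (fun n => (q n : ℝ) / q (n + 1)) (r + 1)
      (fun n => logD f (q n)) := by
  obtain ⟨C, hC, H⟩ := hA.exists_deriv_le
  have hd := hA.subpolyJets_gap_add_two hD
  have hw : ∀ n, 0 ≤ (q n : ℝ) / q (n + 1) := fun n => by positivity
  refine .of_deriv ?_ ?_ hA.one_le_q hw
  · intro ε hε
    obtain ⟨B, hB, hb⟩ := (hd.deriv.mono (Nat.zero_le (r + 1))) ε hε
    refine ⟨C * B, by positivity, fun n k hk x => ?_⟩
    obtain rfl := Nat.le_zero.1 hk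
    have hpos := (hA.toSmoothLift.iterate (q n)).deriv_pos x
    have h1 := hb n 0 le_rfl x
    rw [iteratedDeriv_zero] at h1
    dsimp only at h1
    rw [hA.deriv_gap] at h1
    have h2 : |Real.log (deriv f^[q n] x)| ≤ C * |deriv f^[q n] x - 1| := by
      have e1 := Real.log_le_sub_one_of_pos hpos
      have e2 := Real.log_le_sub_one_of_pos (inv_pos.2 hpos)
      rw [Real.log_inv] at e2
      have e3 : (deriv f^[q n] x)⁻¹ ≤ C := by
        rw [inv_le_iff_one_le_mul₀ hpos]
        exact (H _ _).2
      have e4 : (deriv f^[q n] x)⁻¹ - 1 = (deriv f^[q n] x)⁻¹ * (1 - deriv f^[q n] x) := by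
        field_simp
      have e5 : (deriv f^[q n] x)⁻¹ * (1 - deriv f^[q n] x) ≤ C * |deriv f^[q n] x - 1| := by
        have : 0 < (deriv f^[q n] x)⁻¹ := inv_pos.2 hpos
        calc _ ≤ (deriv f^[q n] x)⁻¹ * |deriv f^[q n] x - 1| := by
              gcongr
              rw [abs_sub_comm]
              exact le_abs_self _
          _ ≤ _ := by gcongr
      have e6 := le_abs_self (deriv f^[q n] x - 1)
      have e7 := abs_nonneg (deriv f^[q n] x - 1)
      exact abs_le.2 ⟨by linarith, by nlinarith⟩
    rw [iteratedDeriv_zero]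
    calc _ ≤ _ := h2
      _ ≤ C * (B * (q n / q (n + 1)) * (q n : ℝ) ^ ε) := by gcongr
      _ = _ := by ring
  · have h1 : SubpolyJets (fun l : ℕ => (l : ℝ) + 1) (fun _ => 1) r (fun l x => -logD f l x) := by
      intro ε hε
      obtain ⟨B, hB, hb⟩ := hW ε hε
      refine ⟨B, hB, fun l k hk x => ?_⟩
      rw [iteratedDeriv_fun_neg, abs_neg]
      exact hb l k hk x
    have h2 := h1.exp (.of_bound (fun l => by simp) (fun n => zero_le_one)
      (by linarith : 0 ≤ C) fun l k hk x => by
        obtain rfl := Nat.le_zero.1 hk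
        rw [iteratedDeriv_zero, Real.abs_exp, mul_one, Real.exp_neg, hA.exp_logD,
          inv_le_iff_one_le_mul₀ ((hA.toSmoothLift.iterate l).deriv_pos x)]
        exact (H l x).2) (fun l => by simp) (fun l => (hA.contDiff_logD l).neg)
    have h3 := h2.reindex (fun l => by simp) (fun _ => zero_le_one) q (ψ := fun n => (q n : ℝ))
      (A := 2) (m := 1) (by norm_num) (fun n => by positivity) le_rfl
      (fun n => by linarith [hA.one_le_q n])
    have hs : ∀ n, ContDiff ℝ (⊤ : ℕ∞) (deriv (gap f (q n) (p n))) := fun n =>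
      (contDiff_infty_iff_deriv.1 (hA.contDiff_gap n)).2
    have h4 := hd.deriv.deriv.mul h3 hA.one_le_q
      (fun n => (contDiff_infty_iff_deriv.1 (hs n)).2) (fun n => (hA.contDiff_logD _).neg.exp)
    simp only [mul_one] at h4
    refine h4.congr fun n x => ?_
    have e1 := hA.hasDerivAt_deriv_iterate (q n) x
    have e2 : deriv (gap f (q n) (p n)) = fun x => deriv f^[q n] x - 1 :=
      funext fun x => hA.deriv_gap n x
    rw [e2, deriv_sub_const, e1.deriv, Real.exp_neg, hA.exp_logD]
    have := (hA.toSmoothLift.iterate (q n)).deriv_pos x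
    rw [mul_inv_cancel_right₀ this.ne']
    rfl

theorem exists_logD_add_le (hA : AprioriBounds f ρ q p) {w : ℕ → ℝ} (hw : ∀ n, 0 ≤ w n)
    (hs : SubpolyJets (fun n => (q n : ℝ)) w r (fun n => logD f (q n)))
    (hW : SubpolyJets (fun l : ℕ => (l : ℝ) + 1) (fun _ => 1) (r - 1) (logD f)) {ε : ℝ}
    (hε : 0 < ε) : ∃ C, 0 ≤ C ∧ ∀ n b l, l + b * q n ≤ q (n + 1) → ∀ k ≤ r, ∀ x,
      |iteratedDeriv k (logD f (l + b * q n)) x| ≤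
        |iteratedDeriv k (logD f l) x| + b * (C * w n * (q n : ℝ) ^ ε) := by
  obtain ⟨A, m, hA0, hm, hAm⟩ := hA.exists_succ_le
  have h1 := hs.reindex hA.one_le_q hw (fun j : {j : ℕ × ℕ // j.2 ≤ q (j.1 + 1)} => j.1.1)
    (ψ := fun j => (q j.1.1 : ℝ)) (A := 1) (m := 1) zero_le_one (fun _ => by positivity) le_rfl
    (fun j => by simp)
  have h2 := hA.subpolyJets_comp_iterate (g := fun j : {j : ℕ × ℕ // j.2 ≤ q (j.1 + 1)} => j.1.2)
    hm hA0 (fun j => hA.one_le_q _) (fun j => hw _) (fun j => hAm j.1.1 j.1.2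
      (j.2.trans (Nat.le_self_pow (by norm_num) _))) (fun j => hA.contDiff_logD _) h1 hW
  obtain ⟨C, hC, H⟩ := h2 ε hε
  refine ⟨C, hC, fun n b l hl k hk x => ?_⟩
  induction b with
  | zero => simp
  | succ b ih =>
    have hl' : l + b * q n ≤ q (n + 1) := by
      refine le_trans ?_ hl
      gcongr
      lia
    have h3 := ih hl'
    have h4 := H ⟨(n, l + b * q n), hl'⟩ k hk x
    have h5 : logD f (l + (b + 1) * q n) = fun x =>
        logD f (q n) (f^[l + b * q n] x) + logD f (l + b * q n) x := by
      funext x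
      rw [← hA.logD_add]
      congr 1
      ring
    have h6 : ContDiff ℝ (⊤ : ℕ∞) (fun x => logD f (q n) (f^[l + b * q n] x)) :=
      (hA.contDiff_logD _).comp (hA.toSmoothLift.iterate _).contDiff
    rw [h5, iteratedDeriv_fun_add ((h6.of_le (by exact_mod_cast le_top)).contDiffAt)
      (((hA.contDiff_logD _).of_le (by exact_mod_cast le_top)).contDiffAt)]
    refine (abs_add_le _ _).trans ?_
    push_cast
    dsimp only at h4
    linarith

end AprioriBounds

theorem Convergents.exists_mem {ρ : ℝ} {q : ℕ → ℕ} {p : ℕ → ℤ} (hC : Convergents ρ q p) {l : ℕ}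
    (hl : q 0 ≤ l) : ∃ n, q n ≤ l ∧ l < q (n + 1) := by
  classical
  have hex : ∃ n, l < q n := (hC.tendsto_q.eventually_gt_atTop l).exists
  obtain ⟨n, hn⟩ : ∃ n, Nat.find hex = n + 1 := Nat.exists_eq_succ_of_ne_zero fun h => by
    have := Nat.find_spec hex
    rw [h] at this
    lia
  refine ⟨n, not_lt.1 (Nat.find_min hex (by lia)), ?_⟩
  rw [← hn]
  exact Nat.find_spec hex

theorem SmoothLift.sum_logD {f : ℝ → ℝ} (hf : SmoothLift f) (q N : ℕ) (x : ℝ) :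
    (N : ℝ) * logD f q x = ∑ k ∈ Finset.range q, logD f N (f^[k] x) -
      ∑ i ∈ Finset.range N, (logD f i (f^[q] x) - logD f i x) := by
  have h1 : ∑ k ∈ Finset.range q, logD f N (f^[k] x) =
      ∑ i ∈ Finset.range N, logD f q (f^[i] x) := by
    simp only [hf.logD_eq_sum N, hf.logD_eq_sum q]
    rw [Finset.sum_comm]
    refine Finset.sum_congr rfl fun i _ => Finset.sum_congr rfl fun k _ => ?_
    rw [← Function.iterate_add_apply, ← Function.iterate_add_apply, add_comm]
  have h2 : ∀ i, logD f q (f^[i] x) = logD f i (f^[q] x) - logD f i x + logD f q x := by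
    intro i
    have e1 := hf.logD_add q i x
    have e2 := hf.logD_add i q x
    rw [add_comm] at e2
    linarith
  rw [h1, Finset.sum_congr rfl fun i _ => h2 i, Finset.sum_add_distrib]
  simp

namespace AprioriBounds
variable {f : ℝ → ℝ} {ρ : ℝ} {q : ℕ → ℕ} {p : ℕ → ℤ} {r : ℕ}

theorem exists_iteratedDeriv_logD_le (hA : AprioriBounds f ρ q p) (r L : ℕ) : ∃ M, 0 ≤ M ∧
    ∀ l < L, ∀ k ≤ r, ∀ x, |iteratedDeriv k (logD f l) x| ≤ M := by
  choose B hB0 hB using fun l k => exists_bound_iteratedDeriv (hA.contDiff_logD l)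
    (hA.logD_add_one l) k
  refine ⟨∑ l ∈ Finset.range L, ∑ k ∈ Finset.range (r + 1), B l k,
    Finset.sum_nonneg fun l _ => Finset.sum_nonneg fun k _ => (hB0 l k).le,
    fun l hl k hk x => (hB l k x).trans ?_⟩
  calc B l k ≤ ∑ k ∈ Finset.range (r + 1), B l k :=
        Finset.single_le_sum (f := fun k => B l k) (fun k _ => (hB0 l k).le)
          (Finset.mem_range.2 (by lia))
    _ ≤ _ := Finset.single_le_sum (f := fun l => ∑ k ∈ Finset.range (r + 1), B l k)
          (fun l _ => Finset.sum_nonneg fun k _ => (hB0 l k).le) (Finset.mem_range.2 hl)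

theorem subpolyJets_logD_succ (hA : AprioriBounds f ρ q p)
    (hD : SubpolyJets (fun n => (q n : ℝ)) (fun n => 1 / (q (n + 1) : ℝ)) r
      (fun n => gap f (q n) (p n)))
    (hW : SubpolyJets (fun l : ℕ => (l : ℝ) + 1) (fun _ => 1) r (logD f)) :
    SubpolyJets (fun l : ℕ => (l : ℝ) + 1) (fun _ => 1) (r + 1) (logD f) := by
  intro ε hε
  obtain ⟨C, hC, H⟩ := hA.exists_logD_add_le (fun n => by positivity)
    (hA.subpolyJets_logD_q hD hW) hW hε
  obtain ⟨M, hM, hMl⟩ := hA.exists_iteratedDeriv_logD_le (r + 1) (q 0)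
  set θ : ℝ := (1 / 2 : ℝ) ^ ε with hθ
  have hθ0 : 0 < θ := by positivity
  have hθ1 : 0 < 1 - θ := sub_pos.2 (Real.rpow_lt_one (by norm_num) (by norm_num) hε)
  refine ⟨M + C / (1 - θ), by positivity, fun l => ?_⟩
  induction l using Nat.strong_induction_on with
  | _ l ih =>
  intro k hk x
  have hl1 : (1 : ℝ) ≤ ((l : ℝ) + 1) ^ ε := Real.one_le_rpow (by simp) hε.le
  rcases lt_or_ge l (q 0) with hl | hl
  · refine (hMl l hl k hk x).trans ?_
    have : 0 ≤ C / (1 - θ) := by positivity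
    nlinarith
  obtain ⟨n, hn, hn'⟩ := hA.convergents.exists_mem hl
  have hqpos := hA.convergents.q_pos n
  have hmod := Nat.mod_lt l hqpos
  have hdm := Nat.mod_add_div' l (q n)
  have hdiv : 1 ≤ l / q n := (Nat.one_le_div_iff hqpos).2 hn
  have h2l : 2 * (l % q n + 1) ≤ l + 1 := by nlinarith
  have h1 := H n (l / q n) (l % q n) (by lia) k hk x
  have h2 := ih (l % q n) (by lia) k hk x
  rw [hdm] at h1
  have hq0 : (0 : ℝ) < q n := by exact_mod_cast hqpos
  have hq0' : (0 : ℝ) < q (n + 1) := by exact_mod_cast hA.convergents.q_pos (n + 1)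
  have h3 : ((l / q n : ℕ) : ℝ) * (q n / q (n + 1)) ≤ 1 := by
    rw [mul_div_assoc', div_le_one hq0']
    have : l / q n * q n ≤ q (n + 1) := by lia
    exact_mod_cast this
  have h4 : (q n : ℝ) ^ ε ≤ ((l : ℝ) + 1) ^ ε := by
    have : (q n : ℝ) ≤ l := by exact_mod_cast hn
    gcongr
    linarith
  have h5 : (((l % q n : ℕ) : ℝ) + 1) ^ ε ≤ θ * ((l : ℝ) + 1) ^ ε := by
    rw [hθ, ← Real.mul_rpow (by norm_num) (by positivity)]
    have : 2 * (((l % q n : ℕ) : ℝ) + 1) ≤ l + 1 := by exact_mod_cast h2l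
    gcongr
    linarith
  have h6 : ((l / q n : ℕ) : ℝ) * (C * (q n / q (n + 1)) * (q n : ℝ) ^ ε) ≤
      C * ((l : ℝ) + 1) ^ ε := by
    calc _ = ((l / q n : ℕ) : ℝ) * (q n / q (n + 1)) * (C * (q n : ℝ) ^ ε) := by ring
      _ ≤ 1 * (C * ((l : ℝ) + 1) ^ ε) := by gcongr
      _ = _ := by ring
  simp only [mul_one] at h2 ⊢
  calc _ ≤ _ := h1
    _ ≤ (M + C / (1 - θ)) * (θ * ((l : ℝ) + 1) ^ ε) + C * ((l : ℝ) + 1) ^ ε := by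
      refine add_le_add (h2.trans ?_) h6
      gcongr
    _ ≤ (M + C / (1 - θ)) * ((l : ℝ) + 1) ^ ε := by
      have : C = C / (1 - θ) * (1 - θ) := by field_simp
      have : 0 ≤ M * (1 - θ) := by positivity
      have : (M + C / (1 - θ)) * θ + C ≤ M + C / (1 - θ) := by nlinarith
      nlinarith

theorem subpolyJets_logD_q_of_succ (hA : AprioriBounds f ρ q p)
    (hD : SubpolyJets (fun n => (q n : ℝ)) (fun n => 1 / (q (n + 1) : ℝ)) r
      (fun n => gap f (q n) (p n)))
    (hW : SubpolyJets (fun l : ℕ => (l : ℝ) + 1) (fun _ => 1) (r + 1) (logD f)) :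
    SubpolyJets (fun n => (q n : ℝ)) (fun n => 1 / (q (n + 1) : ℝ)) r
      (fun n => logD f (q n)) := by
  obtain ⟨A, m, hA0, hm, hAm⟩ := hA.exists_succ_le
  intro ε hε
  obtain ⟨C₁, hC₁, H₁⟩ : ∃ C, 0 ≤ C ∧ ∀ n, ∀ i < q (n + 1) ^ 2, ∀ k ≤ r, ∀ x,
      |iteratedDeriv k (fun x => logD f i (f^[q n] x) - logD f i x) x| ≤
        C * (1 / (q (n + 1) : ℝ)) * (q n : ℝ) ^ ε := by
    have h1 := hW.reindex (fun l => by simp) (fun _ => zero_le_one)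
      (fun j : {j : ℕ × ℕ // j.2 < q (j.1 + 1) ^ 2} => j.1.2) (ψ := fun j => (q j.1.1 : ℝ))
      hA0 (fun _ => by positivity) hm (fun j => hAm _ _ j.2.le)
    have h2 := hD.reindex hA.one_le_q (fun _ => by positivity)
      (fun j : {j : ℕ × ℕ // j.2 < q (j.1 + 1) ^ 2} => j.1.1) (ψ := fun j => (q j.1.1 : ℝ))
      (A := 1) (m := 1) zero_le_one (fun _ => by positivity) le_rfl (fun j => by simp)
    have h3 := SubpolyJets.comp_add_sub (fun j => hA.one_le_q _) (fun j => by positivity)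
      (fun j => by
        rw [div_le_one (by linarith [hA.one_le_q (j.1.1 + 1)])]
        exact hA.one_le_q _) (fun j => hA.contDiff_logD _) (fun j => hA.contDiff_gap _) h1 h2
    obtain ⟨C, hC, H⟩ := h3 ε hε
    refine ⟨C, hC, fun n i hi k hk x => ?_⟩
    refine Eq.trans_le ?_ (H ⟨(n, i), hi⟩ k hk x)
    congr 2
    funext y
    dsimp only
    rw [← hA.logD_add_int i (y + gap f (q n) (p n) y) (p n)]
    congr 2
    unfold gap
    ring
  obtain ⟨C₂, hC₂, H₂⟩ : ∃ C, 0 ≤ C ∧ ∀ n, ∀ i < q n, ∀ k ≤ r, ∀ x,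
      |iteratedDeriv k (fun x => logD f (q (n + 1) ^ 2) (f^[i] x)) x| ≤ C * (q n : ℝ) ^ ε := by
    have h1 := (hW.mono (Nat.le_succ r)).reindex (fun l => by simp) (fun _ => zero_le_one)
      (fun j : {j : ℕ × ℕ // j.2 < q j.1} => q (j.1.1 + 1) ^ 2) (ψ := fun j => (q j.1.1 : ℝ))
      hA0 (fun _ => by positivity) hm (fun j => by exact_mod_cast hAm j.1.1 _ le_rfl)
    have h2 := hA.subpolyJets_comp_iterate (g := fun j : {j : ℕ × ℕ // j.2 < q j.1} => j.1.2)
      hm hA0 (fun j => hA.one_le_q _) (fun j => zero_le_one) (fun j => hAm j.1.1 j.1.2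
      ((j.2.le.trans (hA.convergents.q_le _)).trans (Nat.le_self_pow (by norm_num) _)))
      (fun j => hA.contDiff_logD _) h1 (hW.mono (by lia))
    obtain ⟨C, hC, H⟩ := h2 ε hε
    exact ⟨C, hC, fun n i hi k hk x => (H ⟨(n, i), hi⟩ k hk x).trans_eq (by simp)⟩
  refine ⟨C₁ + C₂, by positivity, fun n k hk x => ?_⟩
  have hq0 : (0 : ℝ) < q n := by linarith [hA.one_le_q n]
  have hq0' : (0 : ℝ) < q (n + 1) := by linarith [hA.one_le_q (n + 1)]
  have hs1 : ∀ i, ContDiff ℝ (⊤ : ℕ∞) (fun x => logD f i (f^[q n] x) - logD f i x) := fun i =>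
    ((hA.contDiff_logD i).comp (hA.toSmoothLift.iterate _).contDiff).sub (hA.contDiff_logD i)
  have hs2 : ∀ i, ContDiff ℝ (⊤ : ℕ∞) (fun x => logD f (q (n + 1) ^ 2) (f^[i] x)) := fun i =>
    (hA.contDiff_logD _).comp (hA.toSmoothLift.iterate _).contDiff
  have e : (fun x => ((q (n + 1) ^ 2 : ℕ) : ℝ) * logD f (q n) x) = fun x =>
      ∑ k ∈ Finset.range (q n), logD f (q (n + 1) ^ 2) (f^[k] x) -
      ∑ i ∈ Finset.range (q (n + 1) ^ 2), (logD f i (f^[q n] x) - logD f i x) :=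
    funext (hA.sum_logD (q n) (q (n + 1) ^ 2))
  have h1 := congrArg (fun u => iteratedDeriv k u x) e
  rw [iteratedDeriv_const_mul_field, iteratedDeriv_fun_sub
    (((ContDiff.sum fun i _ => hs2 i).of_le (by exact_mod_cast le_top)).contDiffAt)
    (((ContDiff.sum fun i _ => hs1 i).of_le (by exact_mod_cast le_top)).contDiffAt),
    iteratedDeriv_fun_sum (fun i _ => ((hs2 i).of_le (by exact_mod_cast le_top)).contDiffAt),
    iteratedDeriv_fun_sum (fun i _ => ((hs1 i).of_le (by exact_mod_cast le_top)).contDiffAt)] at h1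
  have h2 := congrArg abs h1
  have h3 := h2.trans_le ((abs_sub _ _).trans (add_le_add (Finset.abs_sum_le_sum_abs _ _)
    (Finset.abs_sum_le_sum_abs _ _)))
  have h4 := h3.trans (add_le_add
    (Finset.sum_le_sum fun i hi => H₂ n i (Finset.mem_range.1 hi) k hk x)
    (Finset.sum_le_sum fun i hi => H₁ n i (Finset.mem_range.1 hi) k hk x))
  simp only [Finset.sum_const, Finset.card_range, nsmul_eq_mul] at h4
  rw [abs_mul, abs_of_nonneg (by positivity : (0 : ℝ) ≤ ((q (n + 1) ^ 2 : ℕ) : ℝ))] at h4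
  push_cast at h4
  have h5 : (q n : ℝ) ≤ q (n + 1) := by exact_mod_cast hA.convergents.q_le n
  have h6 : (q n : ℝ) * (C₂ * (q n : ℝ) ^ ε) ≤ q (n + 1) * (C₂ * (q n : ℝ) ^ ε) := by gcongr
  have h7 : (q (n + 1) : ℝ) ^ 2 * |iteratedDeriv k (logD f (q n)) x| ≤
      (q (n + 1) : ℝ) ^ 2 * ((C₁ + C₂) * (1 / q (n + 1)) * (q n : ℝ) ^ ε) := by
    calc _ ≤ _ := h4
      _ ≤ q (n + 1) * (C₂ * (q n : ℝ) ^ ε) + (q (n + 1) : ℝ) ^ 2 *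
          (C₁ * (1 / (q (n + 1) : ℝ)) * (q n : ℝ) ^ ε) := by linarith
      _ = _ := by
        field_simp
        ring
  exact le_of_mul_le_mul_left h7 (by positivity)

theorem subpolyJets_gap_succ (hA : AprioriBounds f ρ q p)
    (hD : SubpolyJets (fun n => (q n : ℝ)) (fun n => 1 / (q (n + 1) : ℝ)) r
      (fun n => gap f (q n) (p n)))
    (hW : SubpolyJets (fun l : ℕ => (l : ℝ) + 1) (fun _ => 1) (r + 1) (logD f)) :
    SubpolyJets (fun n => (q n : ℝ)) (fun n => 1 / (q (n + 1) : ℝ)) (r + 1)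
      (fun n => gap f (q n) (p n)) := by
  have hs := hA.subpolyJets_logD_q_of_succ hD hW
  have hw : ∀ n, 0 ≤ 1 / (q (n + 1) : ℝ) := fun n => by positivity
  refine .of_deriv hA.subpolyJets_gap_zero ?_ hA.one_le_q hw
  obtain ⟨C, hC, H⟩ := hA.exists_deriv_le
  have h0 : SubpolyJets (fun n => (q n : ℝ)) (fun n => 1 / (q (n + 1) : ℝ)) 0
      (fun n => deriv (gap f (q n) (p n))) := by
    intro ε hε
    obtain ⟨B, hB, hb⟩ := hs ε hε
    refine ⟨C * B, by positivity, fun n k hk x => ?_⟩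
    obtain rfl := Nat.le_zero.1 hk
    have h1 := hb n 0 (Nat.zero_le _) x
    rw [iteratedDeriv_zero] at h1 ⊢
    dsimp only at h1 ⊢
    rw [hA.deriv_gap]
    have hpos := (hA.toSmoothLift.iterate (q n)).deriv_pos x
    have h2 : |deriv f^[q n] x - 1| ≤ C * |logD f (q n) x| := by
      rw [← hA.exp_logD]
      have e1 := Real.add_one_le_exp (logD f (q n) x)
      have e2 := Real.add_one_le_exp (-logD f (q n) x)
      have e3 : Real.exp (logD f (q n) x) ≤ C := by rw [hA.exp_logD]; exact (H _ _).1
      have e4 := Real.exp_pos (logD f (q n) x)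
      have e5 : Real.exp (-logD f (q n) x) * Real.exp (logD f (q n) x) = 1 := by
        rw [← Real.exp_add]; simp
      have e6 := le_abs_self (logD f (q n) x)
      have e7 := neg_abs_le (logD f (q n) x)
      refine abs_le.2 ⟨by nlinarith, ?_⟩
      calc _ = Real.exp (logD f (q n) x) * (1 - Real.exp (-logD f (q n) x)) := by linarith
        _ ≤ Real.exp (logD f (q n) x) * |logD f (q n) x| := by
          gcongr
          linarith
        _ ≤ _ := by gcongr
    calc _ ≤ _ := h2
      _ ≤ C * (B * (1 / (q (n + 1) : ℝ)) * (q n : ℝ) ^ ε) := by gcongr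
      _ = _ := by ring
  rcases r with _ | r
  · exact h0
  refine .of_deriv h0 ?_ hA.one_le_q hw
  have h2 := (hA.subpolyJets_deriv_iterate (hW.mono (by lia : r ≤ r + 1 + 1))).reindex
    (fun l => by simp) (fun _ => zero_le_one) q (ψ := fun n => (q n : ℝ))
    (A := 2) (m := 1) (by norm_num) (fun n => by positivity) le_rfl
    (fun n => by linarith [hA.one_le_q n])
  have h3 := hs.deriv.mul h2 hA.one_le_q
    (fun n => (contDiff_infty_iff_deriv.1 (hA.contDiff_logD (q n))).2)
    (fun n => (hA.toSmoothLift.iterate _).contDiff_deriv)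
  simp only [mul_one] at h3
  refine h3.congr fun n x => ?_
  have e2 : deriv (gap f (q n) (p n)) = fun x => deriv f^[q n] x - 1 :=
    funext fun x => hA.deriv_gap n x
  rw [e2, deriv_sub_const, (hA.hasDerivAt_deriv_iterate (q n) x).deriv]
  rfl

theorem subpolyJets (hA : AprioriBounds f ρ q p) (r : ℕ) :
    SubpolyJets (fun n => (q n : ℝ)) (fun n => 1 / (q (n + 1) : ℝ)) r
      (fun n => gap f (q n) (p n)) ∧
    SubpolyJets (fun l : ℕ => (l : ℝ) + 1) (fun _ => 1) r (logD f) := by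
  induction r with
  | zero => exact ⟨hA.subpolyJets_gap_zero, hA.subpolyJets_logD_zero⟩
  | succ r ih =>
    have h := hA.subpolyJets_logD_succ ih.1 ih.2
    exact ⟨hA.subpolyJets_gap_succ ih.1 h, h⟩

end AprioriBounds

theorem abs_sub_sub_le_of_iteratedDeriv_two {u : ℝ → ℝ} (hu : ContDiff ℝ (⊤ : ℕ∞) u) {B : ℝ}
    (hB : ∀ x, |iteratedDeriv 2 u x| ≤ B) (x y : ℝ) :
    |u y - u x - (y - x) * deriv u x| ≤ B * (y - x) ^ 2 := by
  have hB0 := (abs_nonneg _).trans (hB x)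
  have hu1 : ContDiff ℝ (⊤ : ℕ∞) (deriv u) := (contDiff_infty_iff_deriv.1 hu).2
  have h1 : ∀ z, |deriv u z - deriv u x| ≤ B * |z - x| := fun z => by
    have := Convex.norm_image_sub_le_of_norm_deriv_le (s := univ) (f := deriv u) (C := B)
        (x := x) (y := z) (fun y _ => hu1.differentiable (by simp) y)
        (fun y _ => by
          have := hB y
          rwa [iteratedDeriv_succ, iteratedDeriv_one] at this) convex_univ trivial trivial
    simpa using this
  have h2 := Convex.norm_image_sub_le_of_norm_hasDerivWithin_le (s := uIcc x y)
    (f := fun z => u z - z * deriv u x) (f' := fun z => deriv u z - 1 * deriv u x)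
    (C := B * |y - x|) (x := x) (y := y)
    (fun z _ => (((hu.differentiable (by simp) z).hasDerivAt).sub
      ((hasDerivAt_id z).mul_const _)).hasDerivWithinAt)
    (fun z hz => by
      rw [one_mul]
      refine (h1 z).trans ?_
      gcongr B * ?_
      exact abs_sub_left_of_mem_uIcc hz)
    (convex_uIcc x y) left_mem_uIcc right_mem_uIcc
  rw [Real.norm_eq_abs, Real.norm_eq_abs] at h2
  calc _ = |u y - y * deriv u x - (u x - x * deriv u x)| := by ring_nf
    _ ≤ _ := h2
    _ = B * |y - x| ^ 2 := by ring
    _ = _ := by rw [sq_abs]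

/-- A family of smooth functions with uniformly bounded derivatives has a smooth limit along any
ultrafilter. -/
theorem exists_contDiff_limit {ι : Type*} (𝒰 : Ultrafilter ι) {u : ι → ℝ → ℝ}
    (hu : ∀ i, ContDiff ℝ (⊤ : ℕ∞) (u i))
    (hb : ∀ k, ∃ B, ∀ i x, |iteratedDeriv k (u i) x| ≤ B) :
    ∃ v : ℝ → ℝ, ContDiff ℝ (⊤ : ℕ∞) v ∧ (∀ x, Tendsto (fun i => u i x) 𝒰 (nhds (v x))) ∧
      ∀ x, Tendsto (fun i => deriv (u i) x) 𝒰 (nhds (deriv v x)) := by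
  choose B hB using hb
  have hlim : ∀ k x, ∃ y, Tendsto (fun i => iteratedDeriv k (u i) x) 𝒰 (nhds y) := by
    intro k x
    have h1 : Icc (-B k) (B k) ∈ 𝒰.map (fun i : ι => iteratedDeriv k (u i) x) :=
      Ultrafilter.mem_map.2 (univ_mem' fun i => abs_le.1 (hB k i x))
    obtain ⟨y, -, hy⟩ := isCompact_Icc.ultrafilter_le_nhds' _ h1
    exact ⟨y, hy⟩
  choose v hv using hlim
  have hd : ∀ k x, HasDerivAt (v k) (v (k + 1) x) x := by
    intro k x
    have h1 : ∀ y, |v k y - v k x - (y - x) * v (k + 1) x| ≤ B (k + 2) * (y - x) ^ 2 := by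
      intro y
      refine le_of_tendsto (((hv k y).sub (hv k x)).sub ((hv (k + 1) x).const_mul (y - x))).abs
        (Eventually.of_forall fun i => ?_)
      have := abs_sub_sub_le_of_iteratedDeriv_two (contDiff_iteratedDeriv_infty (hu i) k)
        (B := B (k + 2)) (fun z => by rw [iteratedDeriv_iteratedDeriv]; exact hB _ i z) x y
      rwa [← iteratedDeriv_succ] at this
    rw [hasDerivAt_iff_isLittleO]
    have h2 : (fun y => v k y - v k x - (y - x) • v (k + 1) x) =O[nhds x]
        fun y => (y - x) ^ 2 := by
      refine Asymptotics.IsBigO.of_bound (B (k + 2)) (Eventually.of_forall fun y => ?_)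
      simpa using h1 y
    refine h2.trans_isLittleO ?_
    have h3 := (Asymptotics.isLittleO_pow_id (𝕜 := ℝ) (n := 2) (by norm_num)).comp_tendsto
      (show Tendsto (fun y => y - x) (nhds x) (nhds 0) by
        simpa using (continuous_sub_right x).tendsto x)
    exact h3
  have hsm : ∀ n : ℕ, ∀ k, ContDiff ℝ n (v k) := by
    intro n
    induction n with
    | zero =>
      intro k
      exact_mod_cast contDiff_zero.2
        (continuous_iff_continuousAt.2 fun x => (hd k x).continuousAt)
    | succ n ih =>
      intro k
      push_cast
      refine contDiff_succ_iff_deriv.2 ⟨fun x => (hd k x).differentiableAt, by simp, ?_⟩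
      rw [show deriv (v k) = v (k + 1) from funext fun x => (hd k x).deriv]
      exact ih _
  refine ⟨v 0, contDiff_infty.2 fun n => hsm n 0, fun x => by simpa using hv 0 x, fun x => ?_⟩
  rw [(hd 0 x).deriv]
  simpa using hv 1 x

theorem RotLift.abs_iterate_sub_le {f : ℝ → ℝ} {ρ : ℝ} (hf : RotLift f ρ) (l : ℕ) (x : ℝ) :
    |f^[l] x - x - l * ρ| ≤ 1 := by
  have h1 := hf.lt_iterate (d := l) (k := ⌈l * ρ⌉ - 1) (by
    push_cast; linarith [Int.ceil_lt_add_one ((l : ℝ) * ρ)]) x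
  have h2 := hf.iterate_lt (d := l) (k := ⌊l * ρ⌋ + 1) (by
    push_cast; linarith [Int.lt_floor_add_one ((l : ℝ) * ρ)]) x
  push_cast at h1 h2
  have h3 := Int.le_ceil ((l : ℝ) * ρ)
  have h4 := Int.floor_le ((l : ℝ) * ρ)
  exact abs_le.2 ⟨by linarith, by linarith⟩

namespace AprioriBounds
variable {f : ℝ → ℝ} {ρ : ℝ} {q : ℕ → ℕ} {p : ℕ → ℤ}

theorem exists_iteratedDeriv_logD_bound (hA : AprioriBounds f ρ q p) (r : ℕ) : ∃ C, 0 ≤ C ∧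
    ∀ l, ∀ k ≤ r, ∀ x, |iteratedDeriv k (logD f l) x| ≤ C := by
  obtain ⟨C, hC, H⟩ := hA.exists_logD_add_le (fun n => by positivity)
    (hA.subpolyJets_logD_q_of_succ (hA.subpolyJets r).1 (hA.subpolyJets (r + 1)).2)
    (hA.subpolyJets (r - 1)).2 (ε := 1 / 2) (by norm_num)
  obtain ⟨M, hM, hMl⟩ := hA.exists_iteratedDeriv_logD_le r (q 0)
  have hq0 : ∀ n, (0 : ℝ) < q n := fun n => by linarith [hA.one_le_q n]
  have hsum : Summable fun n => C * (q n : ℝ) ^ (-(1 / 2) : ℝ) := by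
    set θ : ℝ := (2 : ℝ) ^ (-(1 / 2) : ℝ) with hθ
    have hθ0 : 0 < θ := by positivity
    have hθ1 : √θ < 1 := by
      rw [← Real.sqrt_one]
      exact Real.sqrt_lt_sqrt hθ0.le
        (Real.rpow_lt_one_of_one_lt_of_neg (by norm_num) (by norm_num))
    obtain ⟨B, hB⟩ := exists_geometric_of_two_step (a := fun n => (q n : ℝ) ^ (-(1 / 2) : ℝ))
      (t := √θ) (fun n => by positivity) (by positivity) (fun n => by
        rw [Real.sq_sqrt hθ0.le, hθ, ← Real.mul_rpow (by norm_num) (hq0 n).le]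
        refine Real.rpow_le_rpow_of_nonpos (by linarith [hq0 n]) ?_ (by norm_num)
        exact_mod_cast hA.convergents.two_q_le n)
    refine Summable.mul_left _ (.of_nonneg_of_le (fun n => by positivity) hB ?_)
    exact (summable_geometric_of_lt_one (Real.sqrt_nonneg _) hθ1).mul_left _
  have hnn : ∀ n, 0 ≤ C * (q n : ℝ) ^ (-(1 / 2) : ℝ) := fun n => by positivity
  have key : ∀ n, ∀ l < q n, ∀ k ≤ r, ∀ x, |iteratedDeriv k (logD f l) x| ≤
      M + ∑ j ∈ Finset.range n, C * (q j : ℝ) ^ (-(1 / 2) : ℝ) := by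
    intro n
    induction n with
    | zero => simpa using hMl
    | succ n ih =>
      intro l hl k hk x
      rw [Finset.sum_range_succ]
      rcases lt_or_ge l (q n) with hl' | hl'
      · linarith [ih l hl' k hk x, hnn n]
      have hqpos := hA.convergents.q_pos n
      have hdm := Nat.mod_add_div' l (q n)
      have h1 := H n (l / q n) (l % q n) (by lia) k hk x
      rw [hdm] at h1
      have h2 := ih (l % q n) (Nat.mod_lt l hqpos) k hk x
      have h3 : ((l / q n : ℕ) : ℝ) * q n ≤ q (n + 1) := by
        have : l / q n * q n ≤ q (n + 1) := by lia
        exact_mod_cast this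
      have h4 : ((l / q n : ℕ) : ℝ) * (C * (1 / q (n + 1)) * (q n : ℝ) ^ (1 / 2 : ℝ)) ≤
          C * (q n : ℝ) ^ (-(1 / 2) : ℝ) := by
        have e : (q n : ℝ) ^ (1 / 2 : ℝ) = q n * (q n : ℝ) ^ (-(1 / 2) : ℝ) := by
          nth_rw 2 [← Real.rpow_one (q n : ℝ)]
          rw [← Real.rpow_add (hq0 n)]
          norm_num
        calc _ = ((l / q n : ℕ) : ℝ) * q n / q (n + 1) * (C * (q n : ℝ) ^ (-(1 / 2) : ℝ)) := by
              rw [e]; ring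
          _ ≤ 1 * (C * (q n : ℝ) ^ (-(1 / 2) : ℝ)) := by
              gcongr
              exact div_le_one_of_le₀ h3 (hq0 _).le
          _ = _ := one_mul _
      linarith
  refine ⟨M + ∑' j, C * (q j : ℝ) ^ (-(1 / 2) : ℝ), add_nonneg hM (tsum_nonneg hnn), fun l k hk x => ?_⟩
  obtain ⟨n, hn⟩ := (hA.convergents.tendsto_q.eventually_gt_atTop l).exists
  exact (key n l hn k hk x).trans (by gcongr; exact hsum.sum_le_tsum _ fun j _ => hnn j)

theorem exists_iteratedDeriv_iterate_bound (hA : AprioriBounds f ρ q p) (k : ℕ) : ∃ C, ∀ l x,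
    |iteratedDeriv k (fun x => f^[l] x - x - l * ρ) x| ≤ C := by
  rcases k with _ | k
  · exact ⟨1, fun l x => by simpa using hA.abs_iterate_sub_le l x⟩
  obtain ⟨C, hC, H⟩ := hA.exists_deriv_le
  obtain ⟨B, hB, hb⟩ := hA.exists_iteratedDeriv_logD_bound k
  have h1 : SubpolyJets (fun _ : ℕ => (1 : ℝ)) (fun _ => 1) k (logD f) :=
    .of_bound (fun _ => le_rfl) (fun _ => zero_le_one) hB (by simpa using hb)
  have h2 := h1.exp (.of_bound (fun _ => le_rfl) (fun _ => zero_le_one) (by linarith : 0 ≤ C)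
    (fun l k hk x => by
      obtain rfl := Nat.le_zero.1 hk
      rw [iteratedDeriv_zero, Real.abs_exp, hA.exp_logD, mul_one]
      exact (H l x).1)) (fun _ => le_rfl) hA.contDiff_logD
  obtain ⟨D, hD, h3⟩ := h2 1 one_pos
  refine ⟨D + 1, fun l x => ?_⟩
  have hs := hA.toSmoothLift.iterate l
  have e : deriv (fun x => f^[l] x - x - l * ρ) = fun x => Real.exp (logD f l x) - 1 := by
    funext x
    rw [hA.exp_logD]
    exact (((hs.differentiable x).hasDerivAt.sub (hasDerivAt_id x)).sub_const _).deriv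
  rw [iteratedDeriv_succ', e, iteratedDeriv_fun_sub
    (((hA.contDiff_logD l).exp.of_le (by exact_mod_cast le_top)).contDiffAt) contDiffAt_const]
  have h4 : |iteratedDeriv k (fun _ : ℝ => (1 : ℝ)) x| ≤ 1 := by
    rw [iteratedDeriv_const]; split_ifs <;> simp
  have h5 := h3 l k le_rfl x
  simp only [mul_one, Real.one_rpow] at h5
  exact (abs_sub _ _).trans (add_le_add h5 h4)

/-- The averages of the recentred iterates accumulate on a smooth conjugacy to a translation. -/
theorem exists_conj (hA : AprioriBounds f ρ q p) :
    ∃ H, SmoothLift H ∧ ∀ x, H (f x) = H x + ρ := by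
  set w : ℕ → ℝ → ℝ := fun l x => f^[l] x - x - l * ρ with hw
  have hws : ∀ l, ContDiff ℝ (⊤ : ℕ∞) (w l) := fun l =>
    ((hA.toSmoothLift.iterate l).contDiff.sub contDiff_fun_id).sub contDiff_const
  set u : ℕ → ℝ → ℝ := fun N x => ((N : ℝ) + 1)⁻¹ * ∑ l ∈ Finset.range (N + 1), w l x with hu
  have hus : ∀ N, ContDiff ℝ (⊤ : ℕ∞) (u N) := fun N =>
    contDiff_const.mul (ContDiff.sum fun l _ => hws l)
  have havg : ∀ (N : ℕ) (c : ℝ), ((N : ℝ) + 1)⁻¹ * ∑ _l ∈ Finset.range (N + 1), c = c := by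
    intro N c
    have : (N : ℝ) + 1 ≠ 0 := by positivity
    simp [field]
  obtain ⟨v, hv, hlim, hlim'⟩ := exists_contDiff_limit (hyperfilter ℕ) hus fun k => by
    obtain ⟨C, hC⟩ := hA.exists_iteratedDeriv_iterate_bound k
    refine ⟨C, fun N x => ?_⟩
    rw [hu, iteratedDeriv_const_mul_field, iteratedDeriv_fun_sum
      (fun l _ => ((hws l).of_le (by exact_mod_cast le_top)).contDiffAt), abs_mul,
      abs_of_pos (by positivity)]
    refine (mul_le_mul_of_nonneg_left ((Finset.abs_sum_le_sum_abs _ _).trans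
      (Finset.sum_le_sum fun l _ => hC l x)) (by positivity)).trans_eq (havg N C)
  have hle : (hyperfilter ℕ : Filter ℕ) ≤ atTop := Nat.hyperfilter_le_atTop
  obtain ⟨C, hC, hCd⟩ := hA.exists_deriv_le
  refine ⟨fun x => x + v x, ⟨contDiff_id.add hv, fun x => ?_, fun x => ?_⟩, fun x => ?_⟩
  · have h1 : v (x + 1) = v x := by
      refine tendsto_nhds_unique (hlim (x + 1)) ((hlim x).congr fun N => ?_)
      simp only [hu, hw]
      congr 1
      refine Finset.sum_congr rfl fun l _ => ?_
      rw [(hA.toSmoothLift.iterate l).map_add_one]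
      ring
    simp only [h1]
    ring
  · have h1 : C⁻¹ - 1 ≤ deriv v x := by
      refine ge_of_tendsto (hlim' x) (Eventually.of_forall fun N => ?_)
      have e : deriv (u N) x = ((N : ℝ) + 1)⁻¹ *
          ∑ l ∈ Finset.range (N + 1), (deriv f^[l] x - 1) := by
        refine HasDerivAt.deriv (HasDerivAt.const_mul _ (HasDerivAt.fun_sum fun l _ => ?_))
        exact ((((hA.toSmoothLift.iterate l).differentiable x).hasDerivAt.sub
          (hasDerivAt_id x)).sub_const _)
      rw [e, ← havg N (C⁻¹ - 1)]
      gcongr with l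
      rw [inv_le_iff_one_le_mul₀' (by linarith)]
      exact (hCd l x).2
    have h2 : deriv (fun x => x + v x) x = 1 + deriv v x :=
      ((hasDerivAt_id x).add (hv.differentiable (by simp) x).hasDerivAt).deriv
    rw [h2]
    have : 0 < C⁻¹ := by positivity
    linarith
  · have h1 : Tendsto (fun N => u N (f x) - u N x) (hyperfilter ℕ) (nhds (v (f x) - v x)) :=
      (hlim (f x)).sub (hlim x)
    have e : ∀ N : ℕ, u N (f x) - u N x =
        ((N : ℝ) + 1)⁻¹ * w (N + 1) x + (x + ρ - f x) := by
      intro N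
      have h2 : ∀ l : ℕ, w l (f x) - w l x = (w (l + 1) x - w l x) + (x + ρ - f x) := by
        intro l
        simp only [hw, Function.iterate_succ_apply]
        push_cast
        ring
      simp only [hu]
      rw [← mul_sub, ← Finset.sum_sub_distrib, Finset.sum_congr rfl fun l _ => h2 l,
        Finset.sum_add_distrib, mul_add, havg,
        Finset.sum_range_sub (fun l => w l x)]
      simp [hw]
    have h3 : Tendsto (fun N : ℕ => ((N : ℝ) + 1)⁻¹ * w (N + 1) x) atTop (nhds 0) := by
      refine squeeze_zero_norm (a := fun N : ℕ => ((N : ℝ) + 1)⁻¹) (fun N => ?_)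
        (by simpa using tendsto_one_div_add_atTop_nhds_zero_nat (𝕜 := ℝ))
      rw [norm_mul, Real.norm_of_nonneg (by positivity)]
      exact mul_le_of_le_one_right (by positivity) (hA.abs_iterate_sub_le (N + 1) x)
    have h4 := tendsto_nhds_unique h1 (((h3.mono_left hle).add_const (x + ρ - f x)).congr
      fun N => (e N).symm)
    dsimp only
    linarith

end AprioriBounds

/-- **Herman–Yoccoz theorem**: a smooth lift with Diophantine rotation number is smoothly conjugate
to the translation. -/
theorem RotLift.exists_conj {f : ℝ → ℝ} {ρ : ℝ} (hf : RotLift f ρ) (hdio : Diophantine ρ) :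
    ∃ H, SmoothLift H ∧ ∀ x, H (f x) = H x + ρ := by
  obtain ⟨q, p, hA⟩ := hf.exists_aprioriBounds hdio
  exact hA.exists_conj

section ParametricIntegral

variable {P : Type*} [NormedAddCommGroup P] [NormedSpace ℝ P]

open MeasureTheory Convolution in
/-- The integral over `[0, 1]` of a smooth function depends smoothly on parameters. -/
theorem contDiff_integral_zero_one {g : P × ℝ → ℝ} (hg : ContDiff ℝ (⊤ : ℕ∞) g) :
    ContDiff ℝ (⊤ : ℕ∞) fun z => ∫ t in (0 : ℝ)..1, g (z, t) := by
  let χ : ContDiffBump (0 : ℝ) := ⟨2, 3, by norm_num, by norm_num⟩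
  let f : ℝ → ℝ := indicator (Ioc 0 1) fun _ => 1
  let G : P → ℝ → ℝ := fun p s => χ s * g (p, -s)
  have hf : LocallyIntegrable f volume :=
    ((integrable_indicator_iff measurableSet_Ioc).2
      (integrableOn_const (by simp))).locallyIntegrable
  have h := contDiffOn_convolution_right_with_param (n := (⊤ : ℕ∞)) (f := f) (μ := volume)
    (ContinuousLinearMap.mul ℝ ℝ) (g := G) (s := univ) (k := Metric.closedBall 0 3) isOpen_univ
    (isCompact_closedBall _ _) (fun p x _ hx => ?_) hf ?_
  · rw [univ_prod_univ, contDiffOn_univ] at h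
    have h2 := h.comp (contDiff_id.prodMk contDiff_const : ContDiff ℝ (⊤ : ℕ∞)
      fun z : P => (z, (0 : ℝ)))
    convert h2 using 1
    ext z
    simp only [Function.comp_apply, convolution_def, ContinuousLinearMap.mul_apply', id]
    rw [intervalIntegral.integral_of_le zero_le_one, ← integral_indicator measurableSet_Ioc]
    congr 1
    ext t
    by_cases ht : t ∈ Ioc (0 : ℝ) 1
    · have : χ (-t) = 1 := χ.one_of_mem_closedBall (by
        simp only [χ, Metric.mem_closedBall, dist_zero_right, norm_neg, Real.norm_eq_abs]
        rw [abs_of_pos ht.1]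
        linarith [ht.2])
      simp [f, G, ht, this]
    · simp [f, ht]
  · have : χ x = 0 := χ.zero_of_le_dist (by
      simp only [Metric.mem_closedBall, not_le] at hx
      exact hx.le)
    simp [G, this]
  · rw [univ_prod_univ, contDiffOn_univ]
    exact (χ.contDiff.comp contDiff_snd).mul
      (hg.comp (contDiff_fst.prodMk contDiff_snd.neg))

/-- The directional difference quotient `(u (z + h • v) - u z) / h`, extended to `h = 0`. -/
noncomputable def smoothQuotient (u : P → ℝ) (v z : P) (h : ℝ) : ℝ :=
  ∫ t in (0 : ℝ)..1, fderiv ℝ u (z + (t * h) • v) v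

theorem contDiff_smoothQuotient {u : P → ℝ} (hu : ContDiff ℝ (⊤ : ℕ∞) u) (v : P) :
    ContDiff ℝ (⊤ : ℕ∞) fun p : P × ℝ => smoothQuotient u v p.1 p.2 := by
  refine contDiff_integral_zero_one
    (g := fun q : (P × ℝ) × ℝ => fderiv ℝ u (q.1.1 + (q.2 * q.1.2) • v) v) ?_
  have h1 : ContDiff ℝ (⊤ : ℕ∞) fun q : (P × ℝ) × ℝ => q.1.1 + (q.2 * q.1.2) • v := by fun_prop
  exact ((hu.fderiv_right (m := (⊤ : ℕ∞)) (by simp)).comp h1).clm_apply contDiff_const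

theorem mul_smoothQuotient {u : P → ℝ} (hu : ContDiff ℝ (⊤ : ℕ∞) u) (v z : P) (h : ℝ) :
    h * smoothQuotient u v z h = u (z + h • v) - u z := by
  have hd : ∀ t : ℝ, HasDerivAt (fun t : ℝ => u (z + (t * h) • v))
      (h * fderiv ℝ u (z + (t * h) • v) v) t := fun t => by
    have h1 := (hu.differentiable (by simp) (z + (t * h) • v)).hasFDerivAt
    have h2 : HasDerivAt (fun t : ℝ => z + (t * h) • v) (h • v) t := by
      simpa using (((hasDerivAt_id t).mul_const h).smul_const v).const_add z
    have h3 := h1.comp_hasDerivAt t h2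
    rw [map_smul, smul_eq_mul] at h3
    exact h3
  have hc : Continuous fun t : ℝ => h * fderiv ℝ u (z + (t * h) • v) v :=
    continuous_const.mul (((hu.continuous_fderiv (by simp)).comp (by fun_prop)).clm_apply
      continuous_const)
  have := intervalIntegral.integral_eq_sub_of_hasDerivAt (a := 0) (b := 1) (fun t _ => hd t)
    (hc.intervalIntegrable _ _)
  rw [intervalIntegral.integral_const_mul] at this
  simpa [smoothQuotient] using this

theorem smoothQuotient_zero (u : P → ℝ) (v z : P) : smoothQuotient u v z 0 = fderiv ℝ u z v := by
  simp [smoothQuotient]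

end ParametricIntegral

section Plane

variable {u : ℝ × ℝ → ℝ}

theorem hasDerivAt_snd (hu : ContDiff ℝ (⊤ : ℕ∞) u) (ε x : ℝ) :
    HasDerivAt (fun x => u (ε, x)) (fderiv ℝ u (ε, x) (0, 1)) x := by
  have h1 := (hu.differentiable (by simp) (ε, x)).hasFDerivAt
  exact h1.comp_hasDerivAt x ((hasDerivAt_const x ε).prodMk (hasDerivAt_id x))

/-- Iterated partial derivatives of a smooth function of two variables are jointly smooth. -/
theorem contDiff_iteratedDeriv_snd (hu : ContDiff ℝ (⊤ : ℕ∞) u) (k : ℕ) :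
    ContDiff ℝ (⊤ : ℕ∞) fun p : ℝ × ℝ => iteratedDeriv k (fun x => u (p.1, x)) p.2 := by
  induction k with
  | zero => simpa using hu
  | succ k ih =>
    have h := (ih.fderiv_right (m := (⊤ : ℕ∞)) (by simp)).clm_apply
      (contDiff_const (c := ((0, 1) : ℝ × ℝ)))
    convert h using 1
    ext p
    rw [iteratedDeriv_succ]
    exact (hasDerivAt_snd ih p.1 p.2).deriv

/-- A smooth function vanishing for `ε = 0` is divisible by `ε`. -/
theorem exists_contDiff_eq_mul (hu : ContDiff ℝ (⊤ : ℕ∞) u) (h0 : ∀ x, u (0, x) = 0) :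
    ∃ v : ℝ × ℝ → ℝ, ContDiff ℝ (⊤ : ℕ∞) v ∧ ∀ ε x, u (ε, x) = ε * v (ε, x) := by
  refine ⟨fun p => smoothQuotient u (1, 0) (0, p.2) p.1,
    (contDiff_smoothQuotient hu (1, 0)).comp
      ((contDiff_const.prodMk contDiff_snd).prodMk contDiff_fst), fun ε x => ?_⟩
  dsimp only
  rw [mul_smoothQuotient hu]
  simp [h0]

/-- A fibered smooth family of smooth lifts has a smooth family of inverses. -/
theorem exists_contDiff_inverse (hu : ContDiff ℝ (⊤ : ℕ∞) u)
    (hl : ∀ ε, SmoothLift fun x => u (ε, x)) :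
    ∃ v : ℝ × ℝ → ℝ, ContDiff ℝ (⊤ : ℕ∞) v ∧ (∀ ε x, v (ε, u (ε, x)) = x) ∧
      ∀ ε x, u (ε, v (ε, x)) = x := by
  let T : ℝ × ℝ → ℝ × ℝ := fun p => (p.1, u p)
  have hT : ContDiff ℝ (⊤ : ℕ∞) T := contDiff_fst.prodMk hu
  have hinj : Function.Injective T := by
    rintro ⟨a, x⟩ ⟨b, y⟩ h
    obtain ⟨rfl, h2⟩ : a = b ∧ u (a, x) = u (b, y) := by simpa [T] using h
    rw [(hl a).strictMono.injective h2]
  have hsurj : Function.Surjective T := by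
    rintro ⟨a, y⟩
    obtain ⟨x, hx⟩ : ∃ x, u (a, x) = y := by
      have hc := (hl a).continuous
      obtain ⟨n, hn⟩ := exists_nat_ge |y - u (a, 0)|
      have h1 : u (a, 0 + n) = u (a, 0) + n := by
        simpa using (hl a).map_add_int 0 n
      have h2 : u (a, 0 + (-n : ℤ)) = u (a, 0) + (-n : ℤ) := (hl a).map_add_int 0 (-n)
      have h3 := abs_le.1 hn
      push_cast at h2
      exact mem_range_of_exists_le_of_exists_ge hc ⟨0 + -n, by linarith⟩
        ⟨0 + n, by linarith⟩
    exact ⟨(a, x), by simp [T, hx]⟩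
  have hd : ∀ p : ℝ × ℝ, ∃ e : (ℝ × ℝ) ≃L[ℝ] ℝ × ℝ, HasStrictFDerivAt T (e : _ →L[ℝ] _) p := by
    intro p
    have h1 : HasStrictFDerivAt T (fderiv ℝ T p) p := hT.contDiffAt.hasStrictFDerivAt (by simp)
    have h2 : fderiv ℝ T p = (ContinuousLinearMap.fst ℝ ℝ ℝ).prod (fderiv ℝ u p) :=
      (hasFDerivAt_fst.prodMk (hu.differentiable (by simp) p).hasFDerivAt).fderiv
    have h3 : 0 < fderiv ℝ u p (0, 1) := by
      have := (hl p.1).deriv_pos p.2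
      rwa [(hasDerivAt_snd hu p.1 p.2).deriv] at this
    have hi : Function.Injective (fderiv ℝ T p) := by
      rw [injective_iff_map_eq_zero]
      rintro ⟨a, b⟩ hab
      rw [h2] at hab
      obtain ⟨rfl, h5⟩ : a = 0 ∧ fderiv ℝ u p (a, b) = 0 := by simpa using hab
      have h6 : ((0, b) : ℝ × ℝ) = b • (0, 1) := by simp
      rw [h6, map_smul, smul_eq_mul, mul_eq_zero] at h5
      rw [h5.resolve_right h3.ne']
      rfl
    have hi' : Function.Injective (fderiv ℝ T p : (ℝ × ℝ) →ₗ[ℝ] ℝ × ℝ) := hi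
    refine ⟨(LinearEquiv.ofInjectiveEndo _ hi').toContinuousLinearEquiv, ?_⟩
    convert h1 using 1
    ext <;> rfl
  choose e he using hd
  have ho : IsOpenMap T := isOpenMap_of_hasStrictFDerivAt_equiv he
  let Te : ℝ × ℝ ≃ₜ ℝ × ℝ :=
    (Equiv.ofBijective T ⟨hinj, hsurj⟩).toHomeomorphOfContinuousOpen hT.continuous ho
  have hs : ContDiff ℝ (⊤ : ℕ∞) Te.symm :=
    Te.contDiff_symm (f₀' := fun p => e p) (fun p => (he p).hasFDerivAt) hT
  have h1 : ∀ ε x, Te.symm (ε, u (ε, x)) = (ε, x) := fun ε x => Te.symm_apply_apply (ε, x)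
  have h2 : ∀ p, T (Te.symm p) = p := fun p => Te.apply_symm_apply p
  have h3 : ∀ p, (Te.symm p).1 = p.1 := fun p => by
    have h := congrArg (fun q : ℝ × ℝ => q.1) (h2 p)
    exact h
  refine ⟨fun p => (Te.symm p).2, contDiff_snd.comp hs, fun ε x => by simp only [h1], fun ε x => ?_⟩
  have h4 := congrArg (fun q : ℝ × ℝ => q.2) (h2 (ε, x))
  have h5 : (ε, (Te.symm (ε, x)).2) = Te.symm (ε, x) := Prod.ext (h3 (ε, x)).symm rfl
  rw [h5]
  exact h4

end Plane

section Fourier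

open Complex in
theorem fourierCoeffOn_of_periodic {g : ℝ → ℝ} (hg : ContDiff ℝ (⊤ : ℕ∞) g)
    (hp : ∀ x, g (x + 1) = g x) {n : ℤ} (hn : n ≠ 0) (h01 : (0 : ℝ) < 0 + 1) :
    fourierCoeffOn h01 (fun x => (g x : ℂ)) n =
      1 / (2 * Real.pi * I * n) * fourierCoeffOn h01 (fun x => ((deriv g x : ℝ) : ℂ)) n := by
  have h := fourierCoeffOn_of_hasDerivAt h01 (f := fun x => (g x : ℂ))
    (f' := fun x => ((deriv g x : ℝ) : ℂ)) hn
    (fun x _ => ((hg.differentiable (by simp) x).hasDerivAt).ofReal_comp)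
    (Continuous.intervalIntegrable
      (continuous_ofReal.comp (hg.continuous_deriv (by simp))) _ _)
  rw [h, hp 0]
  push_cast
  ring_nf

theorem norm_fourierCoeffOn_le {g : ℝ → ℝ} {C : ℝ} (hC : ∀ x, |g x| ≤ C) (n : ℤ)
    (h01 : (0 : ℝ) < 0 + 1) : ‖fourierCoeffOn h01 (fun x => (g x : ℂ)) n‖ ≤ C := by
  rw [fourierCoeffOn_eq_integral, norm_smul]
  have := intervalIntegral.norm_integral_le_of_norm_le_const (a := 0) (b := 0 + 1) (C := C)
    (f := fun x : ℝ => fourier (-n) (x : AddCircle ((0 : ℝ) + 1 - 0)) • (g x : ℂ)) fun x _ => by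
      rw [norm_smul, Complex.norm_real]
      have : ‖fourier (-n) (x : AddCircle ((0 : ℝ) + 1 - 0))‖ = 1 := Circle.norm_coe _
      rw [this, one_mul]
      exact hC x
  simpa using this

/-- Fourier expansion of a smooth periodic function, with rapidly decreasing coefficients. -/
theorem exists_fourier_expansion {g : ℝ → ℝ} (hg : ContDiff ℝ (⊤ : ℕ∞) g)
    (hp : ∀ x, g (x + 1) = g x) :
    ∃ c : ℤ → ℂ, (∀ x : ℝ, HasSum (fun n : ℤ => c n * Complex.exp (2 * Real.pi * Complex.I * n * x))
      (g x : ℂ)) ∧ ∀ k : ℕ, ∃ C : ℝ, ∀ n : ℤ, ‖c n‖ * |(n : ℝ)| ^ k ≤ C := by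
  have h01 : (0 : ℝ) < 0 + 1 := by norm_num
  have hdecay : ∀ k : ℕ, ∀ g : ℝ → ℝ, ContDiff ℝ (⊤ : ℕ∞) g → (∀ x, g (x + 1) = g x) →
      ∃ C : ℝ, ∀ n : ℤ, ‖fourierCoeffOn h01 (fun x => (g x : ℂ)) n‖ * |(n : ℝ)| ^ k ≤ C := by
    intro k
    induction k with
    | zero =>
      intro g hg hp
      obtain ⟨C, _, hC⟩ := exists_bound_of_periodic hg.continuous hp
      exact ⟨C, fun n => by simpa using norm_fourierCoeffOn_le hC n h01⟩
    | succ k ih =>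
      intro g hg hp
      have hp' : ∀ x, deriv g (x + 1) = deriv g x := fun x => by
        simpa using iteratedDeriv_add_one hp 1 x
      obtain ⟨C, hC⟩ := ih (deriv g) (contDiff_infty_iff_deriv.1 hg).2 hp'
      refine ⟨C, fun n => ?_⟩
      have hC0 : 0 ≤ C := (by positivity : (0 : ℝ) ≤ _).trans (hC n)
      rcases eq_or_ne n 0 with rfl | hn
      · simpa using hC0
      · refine le_trans ?_ (hC n)
        have hn' : (0 : ℝ) < |(n : ℝ)| := abs_pos.2 (by exact_mod_cast hn)
        rw [fourierCoeffOn_of_periodic hg hp hn h01, norm_mul, pow_succ]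
        have h1 : ‖(1 : ℂ) / (2 * Real.pi * Complex.I * n)‖ = 1 / (2 * Real.pi * |(n : ℝ)|) := by
          simp [abs_of_pos Real.pi_pos]
        have h2 : 1 / (2 * Real.pi * |(n : ℝ)|) * |(n : ℝ)| ≤ 1 := by
          have : 1 / (2 * Real.pi * |(n : ℝ)|) * |(n : ℝ)| = 1 / (2 * Real.pi) := by field_simp
          rw [this, div_le_one (by positivity)]
          linarith [Real.pi_gt_three]
        rw [h1]
        calc _ = (1 / (2 * Real.pi * |(n : ℝ)|) * |(n : ℝ)|) *
            (‖fourierCoeffOn h01 (fun x => ((deriv g x : ℝ) : ℂ)) n‖ * |(n : ℝ)| ^ k) := by ring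
          _ ≤ _ := mul_le_of_le_one_left (by positivity) h2
  refine ⟨fun n => fourierCoeffOn h01 (fun x => (g x : ℂ)) n, fun x => ?_,
    fun k => hdecay k g hg hp⟩
  have hcont : Continuous (AddCircle.liftIco (1 : ℝ) 0 fun x => (g x : ℂ)) :=
    AddCircle.liftIco_continuous (by simp [← hp 0])
      (Complex.continuous_ofReal.comp hg.continuous).continuousOn
  have hco : ∀ n, fourierCoeff (AddCircle.liftIco (1 : ℝ) 0 fun x => (g x : ℂ)) n =
      fourierCoeffOn h01 (fun x => (g x : ℂ)) n := fun n => fourierCoeff_liftIco_eq _ n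
  obtain ⟨C, hC⟩ := hdecay 2 g hg hp
  have hsum : Summable (fourierCoeff (⟨_, hcont⟩ : C(AddCircle (1 : ℝ), ℂ))) := by
    refine Summable.of_norm_bounded_eventually (g := fun n : ℤ => C * (1 / (n : ℝ) ^ 2))
      ((Real.summable_one_div_int_pow.2 (by norm_num)).mul_left C) ?_
    refine (eventually_cofinite_ne (0 : ℤ)).mono fun n hn => ?_
    have hn' : (0 : ℝ) < |(n : ℝ)| := abs_pos.2 (by exact_mod_cast hn)
    have h1 := hC n
    rw [← hco, sq_abs] at h1
    rw [mul_one_div, le_div_iff₀ (by rw [← sq_abs]; positivity)]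
    exact h1
  have h := has_pointwise_sum_fourier_series_of_summable hsum (x : AddCircle (1 : ℝ))
  have hper : Function.Periodic g 1 := hp
  have hx : (AddCircle.liftIco (1 : ℝ) 0 fun x => (g x : ℂ)) (x : AddCircle (1 : ℝ)) = (g x : ℂ) := by
    have h1 : ((Int.fract x : ℝ) : AddCircle (1 : ℝ)) = (x : AddCircle (1 : ℝ)) :=
      AddCircle.coe_fract x
    rw [← h1, AddCircle.liftIco_coe_apply]
    · have := hper.sub_zsmul_eq (x := x) ⌊x⌋
      simp only [zsmul_eq_mul, mul_one] at this
      rw [Int.fract, this]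
    · simp [Int.fract_nonneg, Int.fract_lt_one]
  rw [ContinuousMap.coe_mk, hx] at h
  convert h using 2 with n
  rw [smul_eq_mul, fourier_coe_apply, hco]
  simp

open Complex in
theorem DiophantineWith.le_norm_exp_sub_one {c β ρ : ℝ} (h : DiophantineWith c β ρ) {k : ℕ}
    (hk : 1 + β ≤ k) {n : ℤ} (hn : n ≠ 0) :
    c ≤ ‖exp (2 * Real.pi * I * n * ρ) - 1‖ * |(n : ℝ)| ^ k := by
  set m := round ((n : ℝ) * ρ) with hm
  set δ : ℝ := n * ρ - m with hδ
  have hδ2 : |δ| ≤ 1 / 2 := abs_sub_round _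
  have h1 : ‖exp (2 * Real.pi * I * n * ρ) - 1‖ = 2 * |Real.sin (Real.pi * δ)| := by
    have e : (2 * Real.pi * I * n * ρ : ℂ) = I * ((2 * (Real.pi * (n * ρ)) : ℝ) : ℂ) := by
      push_cast
      ring
    have e2 : Real.pi * δ = 2 * (Real.pi * (n * ρ)) / 2 - m * Real.pi := by
      rw [hδ]
      ring
    rw [e, norm_exp_I_mul_ofReal_sub_one, e2, Real.sin_sub_int_mul_pi, abs_mul, abs_zpow]
    simp
  have h2 : 2 * |δ| ≤ |Real.sin (Real.pi * δ)| := by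
    have h3 : |Real.pi * δ| ≤ Real.pi / 2 := by
      rw [abs_mul, abs_of_pos Real.pi_pos]
      nlinarith [Real.pi_pos]
    have h4 := Real.mul_abs_le_abs_sin h3
    rw [abs_mul, abs_of_pos Real.pi_pos] at h4
    calc 2 * |δ| = 2 / Real.pi * (Real.pi * |δ|) := by
          field_simp
      _ ≤ _ := h4
  have h5 : c ≤ |δ| * |(n : ℝ)| ^ k := by
    have hq : 1 ≤ n.natAbs := Int.natAbs_pos.2 hn
    have hcast : ((n.natAbs : ℕ) : ℝ) = |(n : ℝ)| := by
      rw [Nat.cast_natAbs, Int.cast_abs]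
    rcases le_total 0 n with h0 | h0
    · have h6 := h.le_mul hq m hk
      rw [hcast] at h6
      have : |(n : ℝ)| = n := abs_of_nonneg (by exact_mod_cast h0)
      rwa [show |(n : ℝ)| * ρ - m = δ by rw [this]] at h6
    · have h6 := h.le_mul hq (-m) hk
      rw [hcast] at h6
      have : |(n : ℝ)| = -n := abs_of_nonpos (by exact_mod_cast h0)
      rwa [show |(n : ℝ)| * ρ - ((-m : ℤ) : ℝ) = -δ by rw [this, hδ]; push_cast; ring,
        abs_neg] at h6
  rw [h1]
  refine h5.trans ?_
  gcongr
  have := abs_nonneg δ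
  linarith

open Complex in
theorem norm_iteratedFDeriv_const_mul_exp (d w : ℂ) (k : ℕ) (x : ℝ) :
    ‖iteratedFDeriv ℝ k (fun x : ℝ => d * exp (w * x)) x‖ = ‖d‖ * ‖w‖ ^ k * ‖exp (w * x)‖ := by
  have h : ∀ k, iteratedDeriv k (fun x : ℝ => d * exp (w * x)) =
      fun x : ℝ => d * w ^ k * exp (w * x) := by
    intro k
    induction k with
    | zero => simp
    | succ k ih =>
      rw [iteratedDeriv_succ, ih]
      ext x
      have h1 : HasDerivAt (fun x : ℝ => w * x) w x := by
        simpa using ((hasDerivAt_id x).ofReal_comp).const_mul w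
      rw [(h1.cexp.const_mul (d * w ^ k)).deriv]
      ring
  rw [norm_iteratedFDeriv_eq_norm_iteratedDeriv, h, norm_mul, norm_mul, norm_pow]

open Complex in
/-- The cohomological equation over a Diophantine translation. -/
theorem Diophantine.exists_cohomological {ρ : ℝ} (hdio : Diophantine ρ) {g : ℝ → ℝ}
    (hg : ContDiff ℝ (⊤ : ℕ∞) g) (hp : ∀ x, g (x + 1) = g x) :
    ∃ (ψ : ℝ → ℝ) (a : ℝ), ContDiff ℝ (⊤ : ℕ∞) ψ ∧ (∀ x, ψ (x + 1) = ψ x) ∧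
      ∀ x, ψ (x + ρ) - ψ x + a = g x := by
  obtain ⟨c₀, hc₀, β, hβ, hd⟩ := hdio
  obtain ⟨K, hK⟩ := exists_nat_ge (1 + β)
  obtain ⟨c, hsum, hdec⟩ := exists_fourier_expansion hg hp
  let e : ℤ → ℝ → ℂ := fun n x => exp (2 * Real.pi * I * n * x)
  have he : ∀ n x, ‖e n x‖ = 1 := fun n x => by
    have : (2 * Real.pi * I * n * x : ℂ) = ((2 * Real.pi * n * x : ℝ) : ℂ) * I := by
      push_cast
      ring
    simp only [e, this, norm_exp_ofReal_mul_I]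
  have hadd : ∀ n x y, e n (x + y) = e n y * e n x := fun n x y => by
    simp only [e, ← exp_add]
    push_cast
    ring_nf
  have he1 : ∀ n, e n 1 = 1 := fun n => by
    have : (2 * Real.pi * I * n * (1 : ℝ) : ℂ) = n * (2 * Real.pi * I) := by
      push_cast
      ring
    simp only [e, this, exp_int_mul_two_pi_mul_I]
  let d : ℤ → ℂ := fun n => c n / (e n ρ - 1)
  have hd0 : d 0 = 0 := by simp [d, e]
  have hdn : ∀ n, n ≠ 0 → ‖d n‖ ≤ ‖c n‖ * |(n : ℝ)| ^ K / c₀ := fun n hn => by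
    have h1 := hd.le_norm_exp_sub_one hK hn
    have h2 : 0 < ‖e n ρ - 1‖ := by
      refine lt_of_le_of_ne (norm_nonneg _) fun h0 => ?_
      simp only [e] at h0
      rw [← h0, zero_mul] at h1
      linarith
    simp only [d, norm_div]
    rw [div_le_div_iff₀ h2 hc₀, mul_assoc]
    refine mul_le_mul_of_nonneg_left (h1.trans_eq (mul_comm _ _)) (norm_nonneg _)
  have hv : ∀ k : ℕ, Summable fun n : ℤ => ‖d n‖ * (2 * Real.pi * |(n : ℝ)|) ^ k := fun k => by
    obtain ⟨C, hC⟩ := hdec (K + k + 2)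
    refine Summable.of_nonneg_of_le (fun n => by positivity) (fun n => ?_)
      ((Real.summable_one_div_int_pow.2 (by norm_num : 1 < 2)).mul_left
        ((2 * Real.pi) ^ k * C / c₀))
    rcases eq_or_ne n 0 with rfl | hn
    · simp [hd0]
    · have hn' : (0 : ℝ) < |(n : ℝ)| := abs_pos.2 (by exact_mod_cast hn)
      rw [mul_one_div, ← sq_abs, le_div_iff₀ (by positivity)]
      calc ‖d n‖ * (2 * Real.pi * |(n : ℝ)|) ^ k * |(n : ℝ)| ^ 2
          ≤ ‖c n‖ * |(n : ℝ)| ^ K / c₀ * (2 * Real.pi * |(n : ℝ)|) ^ k * |(n : ℝ)| ^ 2 := by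
            gcongr
            exact hdn n hn
        _ = (2 * Real.pi) ^ k * (‖c n‖ * |(n : ℝ)| ^ (K + k + 2)) / c₀ := by
            rw [mul_pow]
            ring
        _ ≤ _ := by
            gcongr
            exact hC n
  have hsm : ContDiff ℝ (⊤ : ℕ∞) fun x : ℝ => ∑' n, d n * e n x := by
    refine contDiff_tsum (v := fun k n => ‖d n‖ * (2 * Real.pi * |(n : ℝ)|) ^ k) (fun n => ?_)
      (fun k _ => hv k) fun k n x _ => ?_
    · exact contDiff_const.mul (contDiff_const.mul ofRealCLM.contDiff).cexp
    · have := he n x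
      simp only [e] at this ⊢
      rw [norm_iteratedFDeriv_const_mul_exp, this, mul_one]
      simp [abs_of_pos Real.pi_pos]
  have hsd : ∀ x, Summable fun n => d n * e n x := fun x =>
    Summable.of_norm (by simpa [he] using hv 0)
  refine ⟨fun x => (∑' n, d n * e n x).re, (c 0).re, reCLM.contDiff.comp hsm, fun x => ?_,
    fun x => ?_⟩
  · simp only [hadd, he1, one_mul]
  · have h1 := ((hsd (x + ρ)).hasSum.sub (hsd x).hasSum).sub (hsum x)
    have h2 : HasSum (fun n => d n * e n (x + ρ) - d n * e n x - c n * e n x) (-c 0) := by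
      convert! hasSum_ite_eq (0 : ℤ) (-c 0) using 2 with n
      rw [hadd]
      rcases eq_or_ne n 0 with rfl | hn
      · simp [hd0, e]
      · have h3 : e n ρ - 1 ≠ 0 := fun h0 => by
          have h1 := hd.le_norm_exp_sub_one hK hn
          simp only [e] at h0
          rw [h0, norm_zero, zero_mul] at h1
          linarith
        rw [if_neg hn]
        simp only [d]
        field_simp
        ring
    have h3 := congrArg re (h1.unique h2)
    simp only [sub_re, neg_re, ofReal_re] at h3
    linarith

end Fourier

section Borel

theorem exists_bound_iteratedFDeriv_of_periodic {W : ℝ × ℝ → ℝ} (hW : ContDiff ℝ (⊤ : ℕ∞) W)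
    (hp : ∀ t x, W (t, x + 1) = W (t, x)) {R : ℝ} (h0 : ∀ t x, R ≤ |t| → W (t, x) = 0) (k : ℕ) :
    ∃ C : ℝ, 0 ≤ C ∧ ∀ p, ‖iteratedFDeriv ℝ k W p‖ ≤ C := by
  have hc : Continuous fun p => ‖iteratedFDeriv ℝ k W p‖ :=
    (hW.continuous_iteratedFDeriv (by exact_mod_cast le_top)).norm
  obtain ⟨C, hC⟩ := (isCompact_Icc (a := -R) (b := R)).prod (isCompact_Icc (a := (0 : ℝ)) (b := 1))
    |>.bddAbove_image hc.continuousOn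
  refine ⟨max C 0, le_max_right _ _, fun p => ?_⟩
  by_cases hp1 : |p.1| ≤ R
  · have hper : ∀ n : ℤ, ∀ q : ℝ × ℝ, W (q + (0, (n : ℝ))) = W q := by
      rintro n ⟨t, x⟩
      have h1 : Function.Periodic (fun x => W (t, x)) 1 := hp t
      simpa using h1.int_mul n x
    have h2 : iteratedFDeriv ℝ k W p = iteratedFDeriv ℝ k W (p + (0, ((-⌊p.2⌋ : ℤ) : ℝ))) := by
      rw [← iteratedFDeriv_comp_add_right k (0, ((-⌊p.2⌋ : ℤ) : ℝ)) p]
      congr 1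
      ext1 q
      exact (hper _ q).symm
    rw [h2]
    refine (hC (mem_image_of_mem _ ⟨by simpa using abs_le.1 hp1, ?_⟩)).trans (le_max_left _ _)
    have h3 := Int.fract_nonneg p.2
    have h4 := Int.fract_lt_one p.2
    rw [Int.fract] at h3 h4
    simp only [Prod.snd_add, Int.cast_neg, ← sub_eq_add_neg]
    exact ⟨h3, h4.le⟩
  · have h1 : W =ᶠ[nhds p] fun _ => 0 := by
      have : ∀ᶠ q : ℝ × ℝ in nhds p, R < |q.1| :=
        (continuous_fst.abs).continuousAt.eventually (lt_mem_nhds (not_le.1 hp1))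
      exact this.mono fun q hq => h0 q.1 q.2 hq.le
    rw [(h1.iteratedFDeriv ℝ k).eq_of_nhds]
    simp

/-- Dilation of the first coordinate. -/
noncomputable def dilateFst (l : ℝ) : ℝ × ℝ →L[ℝ] ℝ × ℝ :=
  (l • ContinuousLinearMap.fst ℝ ℝ ℝ).prod (ContinuousLinearMap.snd ℝ ℝ ℝ)

theorem norm_dilateFst_le {l : ℝ} (hl : 1 ≤ l) : ‖dilateFst l‖ ≤ l := by
  refine ContinuousLinearMap.opNorm_le_bound _ (by linarith) fun p => ?_
  simp only [dilateFst, ContinuousLinearMap.prod_apply, Prod.norm_def,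
    _root_.smul_apply, ContinuousLinearMap.coe_fst', ContinuousLinearMap.coe_snd',
    norm_smul, Real.norm_of_nonneg (zero_le_one.trans hl)]
  refine max_le (by gcongr; exact le_max_left _ _) ?_
  calc ‖p.2‖ ≤ max ‖p.1‖ ‖p.2‖ := le_max_right _ _
    _ ≤ _ := le_mul_of_one_le_left (by positivity) hl

theorem norm_iteratedFDeriv_dilate_le {W : ℝ × ℝ → ℝ} (hW : ContDiff ℝ (⊤ : ℕ∞) W) {k : ℕ} {C : ℝ}
    (hC : ∀ p, ‖iteratedFDeriv ℝ k W p‖ ≤ C) {l : ℝ} (hl : 1 ≤ l) (p : ℝ × ℝ) :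
    ‖iteratedFDeriv ℝ k (W ∘ dilateFst l) p‖ ≤ C * l ^ k := by
  rw [(dilateFst l).iteratedFDeriv_comp_right hW p (i := k) (by exact_mod_cast le_top)]
  refine (ContinuousMultilinearMap.norm_compContinuousLinearMap_le _ _).trans ?_
  simp only [Finset.prod_const, Finset.card_univ, Fintype.card_fin]
  have := norm_nonneg (iteratedFDeriv ℝ k W p)
  gcongr
  · exact this.trans (hC p)
  · exact hC _
  · exact norm_dilateFst_le hl

/-- A smooth function vanishing near `0` is divisible by every power of the variable. -/
theorem exists_contDiff_eq_pow_mul {h : ℝ → ℝ} (hh : ContDiff ℝ (⊤ : ℕ∞) h)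
    (h0 : ∀ᶠ t in nhds 0, h t = 0) (N : ℕ) :
    ∃ v : ℝ → ℝ, ContDiff ℝ (⊤ : ℕ∞) v ∧ ∀ t, h t = t ^ N * v t := by
  refine ⟨fun t => h t / t ^ N, contDiff_iff_contDiffAt.2 fun t => ?_, fun t => ?_⟩
  · rcases eq_or_ne t 0 with rfl | ht
    · have : (fun t => h t / t ^ N) =ᶠ[nhds 0] fun _ => 0 := h0.mono fun t ht => by simp [ht]
      exact contDiffAt_const.congr_of_eventuallyEq this
    · exact hh.contDiffAt.div (contDiffAt_id.pow N) (pow_ne_zero _ ht)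
  · rcases eq_or_ne t 0 with rfl | ht
    · simp [h0.self_of_nhds]
    · field_simp

/-- **Borel's lemma** for families of smooth periodic functions. -/
theorem exists_borel_sum {g : ℕ → ℝ → ℝ} (hg : ∀ j, ContDiff ℝ (⊤ : ℕ∞) (g j))
    (hp : ∀ j x, g j (x + 1) = g j x) :
    ∃ ψ : ℝ × ℝ → ℝ, ContDiff ℝ (⊤ : ℕ∞) ψ ∧ (∀ t x, ψ (t, x + 1) = ψ (t, x)) ∧
      ∀ N : ℕ, ∃ η : ℝ × ℝ → ℝ, ContDiff ℝ (⊤ : ℕ∞) η ∧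
        ∀ t x, ψ (t, x) = ∑ j ∈ Finset.range N, t ^ j * g j x + t ^ N * η (t, x) := by
  let χ : ContDiffBump (0 : ℝ) := ⟨1, 2, by norm_num, by norm_num⟩
  have hχ : ContDiff ℝ (⊤ : ℕ∞) χ := χ.contDiff
  let W : ℕ → ℕ → ℝ × ℝ → ℝ := fun m j p => p.1 ^ m * χ p.1 * g j p.2
  have hW : ∀ m j, ContDiff ℝ (⊤ : ℕ∞) (W m j) := fun m j =>
    ((contDiff_fst.pow m).mul (hχ.comp contDiff_fst)).mul ((hg j).comp contDiff_snd)
  have hb : ∀ m j k, ∃ C : ℝ, 0 ≤ C ∧ ∀ p, ‖iteratedFDeriv ℝ k (W m j) p‖ ≤ C := fun m j k =>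
    exists_bound_iteratedFDeriv_of_periodic (hW m j) (fun t x => by simp only [W, hp]) (R := 2)
      (fun t x ht => by
        have : χ t = 0 := χ.zero_of_le_dist (by simpa [χ] using ht)
        simp [W, this]) k
  choose C hC0 hC using hb
  let l : ℕ → ℝ := fun j =>
    1 + 2 ^ j * ∑ m ∈ Finset.range (j + 1), ∑ k ∈ Finset.range (j + 1), C m j k
  have hl1 : ∀ j, 1 ≤ l j := fun j => by
    have : 0 ≤ 2 ^ j * ∑ m ∈ Finset.range (j + 1), ∑ k ∈ Finset.range (j + 1), C m j k :=
      mul_nonneg (by positivity) (Finset.sum_nonneg fun m _ => Finset.sum_nonneg fun k _ => hC0 _ _ _)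
    simp only [l]
    linarith
  have hl2 : ∀ m j k, m ≤ j → k ≤ j → C m j k / l j ≤ (1 / 2) ^ j := fun m j k hm hk => by
    have h1 : C m j k ≤ ∑ m ∈ Finset.range (j + 1), ∑ k ∈ Finset.range (j + 1), C m j k :=
      (Finset.single_le_sum (f := fun k => C m j k) (fun k _ => hC0 _ _ _)
        (Finset.mem_range.2 (Nat.lt_succ_of_le hk))).trans
      (Finset.single_le_sum (f := fun m => ∑ k ∈ Finset.range (j + 1), C m j k)
        (fun m _ => Finset.sum_nonneg fun k _ => hC0 _ _ _)
        (Finset.mem_range.2 (Nat.lt_succ_of_le hm)))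
    have h2 := hl1 j
    rw [div_le_iff₀ (by linarith), one_div, inv_pow, inv_mul_eq_div, le_div_iff₀ (by positivity)]
    simp only [l]
    nlinarith [show (0 : ℝ) < 2 ^ j by positivity]
  let f : ℕ → ℕ → ℝ × ℝ → ℝ := fun N i p => p.1 ^ i * χ (l (N + i) * p.1) * g (N + i) p.2
  have hfW : ∀ N i, f N i = (l (N + i) ^ i)⁻¹ • (W i (N + i) ∘ dilateFst (l (N + i))) := fun N i => by
    have h1 : l (N + i) ^ i ≠ 0 := pow_ne_zero _ (by have := hl1 (N + i); positivity)
    ext p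
    simp only [f, W, dilateFst, Function.comp_apply, ContinuousLinearMap.prod_apply,
      _root_.smul_apply, ContinuousLinearMap.coe_fst', ContinuousLinearMap.coe_snd',
      Pi.smul_apply, smul_eq_mul, mul_pow]
    field_simp
  have hf : ∀ N i, ContDiff ℝ (⊤ : ℕ∞) (f N i) := fun N i =>
    ((contDiff_fst.pow i).mul (hχ.comp (contDiff_const.mul contDiff_fst))).mul
      ((hg _).comp contDiff_snd)
  have hfb : ∀ N k i, k < i → ∀ p, ‖iteratedFDeriv ℝ k (f N i) p‖ ≤ (1 / 2) ^ i := by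
    intro N k i hki p
    have h1 := hl1 (N + i)
    have h2 := norm_iteratedFDeriv_dilate_le (hW i (N + i)) (hC i (N + i) k) h1 p
    have hcd : ContDiff ℝ (⊤ : ℕ∞) (W i (N + i) ∘ dilateFst (l (N + i))) :=
      (hW i (N + i)).comp (ContinuousLinearMap.contDiff _)
    rw [hfW, iteratedFDeriv_const_smul_apply (hcd.contDiffAt.of_le (by exact_mod_cast le_top)),
      norm_smul, norm_inv, Real.norm_of_nonneg (by positivity)]
    calc (l (N + i) ^ i)⁻¹ * ‖iteratedFDeriv ℝ k (W i (N + i) ∘ dilateFst (l (N + i))) p‖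
        ≤ (l (N + i) ^ i)⁻¹ * (C i (N + i) k * l (N + i) ^ k) := by gcongr
      _ ≤ (l (N + i) ^ (k + 1))⁻¹ * (C i (N + i) k * l (N + i) ^ k) := by
          have := hC0 i (N + i) k
          gcongr
          exact hki
      _ = C i (N + i) k / l (N + i) := by
          field_simp
          ring
      _ ≤ (1 / 2) ^ (N + i) := hl2 _ _ _ (by omega) (by omega)
      _ ≤ (1 / 2) ^ i := pow_le_pow_of_le_one (by norm_num) (by norm_num) (by omega)
  have hgeo : Summable fun i : ℕ => ((1 : ℝ) / 2) ^ i :=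
    summable_geometric_of_lt_one (by norm_num) (by norm_num)
  have hT : ∀ N, ContDiff ℝ (⊤ : ℕ∞) fun p => ∑' i, f N i p := fun N =>
    contDiff_tsum_of_eventually (v := fun _ i => (1 / 2) ^ i) (hf N) (fun k _ => hgeo)
      fun k _ => by
        rw [Nat.cofinite_eq_atTop]
        exact (eventually_gt_atTop k).mono fun i hi p => hfb N k i hi p
  have hs : ∀ p, Summable fun i => f 0 i p := fun p => by
    refine Summable.of_norm_bounded_eventually_nat hgeo ?_
    refine (eventually_gt_atTop 0).mono fun i hi => ?_
    simpa using hfb 0 0 i hi p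
  have hv : ∀ N j, ∃ v : ℝ → ℝ, ContDiff ℝ (⊤ : ℕ∞) v ∧ ∀ t, χ (l j * t) - 1 = t ^ N * v t :=
    fun N j => exists_contDiff_eq_pow_mul ((hχ.comp (contDiff_const.mul contDiff_id)).sub
      contDiff_const) (by
        have h1 : Tendsto (fun t : ℝ => l j * t) (nhds 0) (nhds 0) := by
          simpa only [mul_zero, id] using (tendsto_id (α := ℝ) (x := nhds 0)).const_mul (l j)
        have h2 : ∀ᶠ t in nhds (0 : ℝ), χ t = 1 := χ.eventuallyEq_one
        exact (h1.eventually h2).mono fun t ht => by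
          simp only [Function.comp_apply]
          exact sub_eq_zero.2 ht) N
  refine ⟨fun p => ∑' i, f 0 i p, hT 0, fun t x => by simp only [f, hp], fun N => ?_⟩
  choose v hvs hv using hv N
  refine ⟨fun p => ∑ j ∈ Finset.range N, p.1 ^ j * v j p.1 * g j p.2 + ∑' i, f N i p,
    (ContDiff.sum fun j _ => ((contDiff_fst.pow j).mul ((hvs j).comp contDiff_fst)).mul
      ((hg j).comp contDiff_snd)).add (hT N), fun t x => ?_⟩
  have h1 := (hs (t, x)).sum_add_tsum_nat_add N
  have h2 : ∀ i, f 0 (i + N) (t, x) = t ^ N * f N i (t, x) := fun i => by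
    simp only [f, zero_add, add_comm i N, pow_add]
    ring
  dsimp only
  rw [← h1, tsum_congr h2, tsum_mul_left, mul_add, ← add_assoc, Finset.mul_sum,
    ← Finset.sum_add_distrib]
  congr 1
  refine Finset.sum_congr rfl fun j _ => ?_
  simp only [f, zero_add]
  linear_combination t ^ j * g j x * hv j t

end Borel

section ApproxLinearization

/-- The defect of `x ↦ x + ψ (ε, x)` as a conjugacy of `G (ε, ·)` to the translation by `A ε`. -/
def conjDefect (G ψ : ℝ × ℝ → ℝ) (A : ℝ → ℝ) (p : ℝ × ℝ) : ℝ :=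
  G (p.1, p.2 + ψ p) - (p.2 + A p.1 + ψ (p.1, p.2 + A p.1))

theorem conjDefect_add {G ψ η : ℝ × ℝ → ℝ} {A b : ℝ → ℝ} {ρ : ℝ} (hG : ContDiff ℝ (⊤ : ℕ∞) G)
    (hψ : ContDiff ℝ (⊤ : ℕ∞) ψ) (hη : ContDiff ℝ (⊤ : ℕ∞) η) (hA : ContDiff ℝ (⊤ : ℕ∞) A)
    (hb : ContDiff ℝ (⊤ : ℕ∞) b) (hG0 : ∀ x, G (0, x) = x + ρ) (hψ0 : ∀ x, ψ (0, x) = 0)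
    (hA0 : A 0 = ρ) {N : ℕ} (hN : N ≠ 0) :
    ∃ B : ℝ × ℝ → ℝ, ContDiff ℝ (⊤ : ℕ∞) B ∧ (∀ x, B (0, x) = η (0, x) - b 0 - η (0, x + ρ)) ∧
      ∀ p : ℝ × ℝ, conjDefect G (fun p => ψ p + p.1 ^ N * η p) (fun ε => A ε + ε ^ N * b ε) p =
        conjDefect G ψ A p + p.1 ^ N * B p := by
  have hb1 : ContDiff ℝ (⊤ : ℕ∞) fun p : ℝ × ℝ => b p.1 := hb.comp contDiff_fst
  have hA1 : ContDiff ℝ (⊤ : ℕ∞) fun p : ℝ × ℝ => A p.1 := hA.comp contDiff_fst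
  have hpow : ContDiff ℝ (⊤ : ℕ∞) fun p : ℝ × ℝ => p.1 ^ N := contDiff_fst.pow N
  refine ⟨fun p => η p * smoothQuotient G (0, 1) (p.1, p.2 + ψ p) (p.1 ^ N * η p) - b p.1
    - b p.1 * smoothQuotient ψ (0, 1) (p.1, p.2 + A p.1) (p.1 ^ N * b p.1)
    - η (p.1, p.2 + (A p.1 + p.1 ^ N * b p.1)), ?_, fun x => ?_, ?_⟩
  · refine (((hη.mul ?_).sub hb1).sub (hb1.mul ?_)).sub (hη.comp ?_)
    · exact (contDiff_smoothQuotient hG (0, 1)).comp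
        ((contDiff_fst.prodMk (contDiff_snd.add hψ)).prodMk (hpow.mul hη))
    · exact (contDiff_smoothQuotient hψ (0, 1)).comp
        ((contDiff_fst.prodMk (contDiff_snd.add hA1)).prodMk (hpow.mul hb1))
    · exact contDiff_fst.prodMk (contDiff_snd.add (hA1.add (hpow.mul hb1)))
  · have h1 : fderiv ℝ G (0, x) (0, 1) = 1 := by
      refine (hasDerivAt_snd hG 0 x).unique ?_
      simp only [hG0]
      exact (hasDerivAt_id x).add_const ρ
    have h2 : fderiv ℝ ψ (0, x + ρ) (0, 1) = 0 := by
      refine (hasDerivAt_snd hψ 0 (x + ρ)).unique ?_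
      simp only [hψ0]
      exact hasDerivAt_const _ _
    simp only [zero_pow hN, zero_mul, smoothQuotient_zero, hψ0, add_zero, hA0, h1, h2]
    ring
  · rintro ⟨ε, x⟩
    have h1 := mul_smoothQuotient hG (0, 1) (ε, x + ψ (ε, x)) (ε ^ N * η (ε, x))
    have h2 := mul_smoothQuotient hψ (0, 1) (ε, x + A ε) (ε ^ N * b ε)
    simp only [Prod.smul_mk, smul_eq_mul, mul_zero, mul_one, Prod.mk_add_mk, add_zero] at h1 h2
    simp only [conjDefect, ← add_assoc] at h1 h2 ⊢
    linear_combination -h1 + h2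

/-- The class of approximate linearizations of order `N`. -/
structure IsApproxLinearization (G : ℝ × ℝ → ℝ) (ρ : ℝ) (N : ℕ) (ψ : ℝ × ℝ → ℝ) (A : ℝ → ℝ) :
    Prop where
  contDiff : ContDiff ℝ (⊤ : ℕ∞) ψ
  contDiff_freq : ContDiff ℝ (⊤ : ℕ∞) A
  periodic : ∀ ε x, ψ (ε, x + 1) = ψ (ε, x)
  zero : ∀ x, ψ (0, x) = 0
  freq_zero : A 0 = ρ
  exists_eq : ∃ E : ℝ × ℝ → ℝ, ContDiff ℝ (⊤ : ℕ∞) E ∧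
    ∀ p : ℝ × ℝ, conjDefect G ψ A p = p.1 ^ N * E p

variable {G : ℝ × ℝ → ℝ} {ρ : ℝ}

theorem isApproxLinearization_one (hG : ContDiff ℝ (⊤ : ℕ∞) G) (hG0 : ∀ x, G (0, x) = x + ρ) :
    IsApproxLinearization G ρ 1 (fun _ => 0) (fun _ => ρ) where
  contDiff := contDiff_const
  contDiff_freq := contDiff_const
  periodic _ _ := rfl
  zero _ := rfl
  freq_zero := rfl
  exists_eq := by
    obtain ⟨v, hv, h⟩ := exists_contDiff_eq_mul (u := fun p => G p - (p.2 + ρ))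
      (hG.sub (contDiff_snd.add contDiff_const)) (fun x => by simp [hG0])
    refine ⟨v, hv, fun p => ?_⟩
    have := h p.1 p.2
    simpa [conjDefect] using this

theorem IsApproxLinearization.exists_succ (hG : ContDiff ℝ (⊤ : ℕ∞) G)
    (hG0 : ∀ x, G (0, x) = x + ρ) (hGl : ∀ ε x, G (ε, x + 1) = G (ε, x) + 1)
    (hdio : Diophantine ρ) {N : ℕ} (hN : N ≠ 0) {ψ : ℝ × ℝ → ℝ} {A : ℝ → ℝ}
    (h : IsApproxLinearization G ρ N ψ A) :
    ∃ (g : ℝ → ℝ) (a : ℝ), ContDiff ℝ (⊤ : ℕ∞) g ∧ (∀ x, g (x + 1) = g x) ∧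
      IsApproxLinearization G ρ (N + 1) (fun p => ψ p + p.1 ^ N * g p.2)
        (fun ε => A ε + ε ^ N * a) := by
  obtain ⟨E, hE, hEq⟩ := h.exists_eq
  have hper : ∀ x, E (0, x + 1) = E (0, x) := fun x => by
    have h1 : Tendsto (fun ε : ℝ => E (ε, x + 1)) (nhdsWithin 0 {0}ᶜ) (nhds (E (0, x + 1))) :=
      ((hE.continuous.comp (continuous_id.prodMk continuous_const)).tendsto 0).mono_left
        nhdsWithin_le_nhds
    have h2 : Tendsto (fun ε : ℝ => E (ε, x)) (nhdsWithin 0 {0}ᶜ) (nhds (E (0, x))) :=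
      ((hE.continuous.comp (continuous_id.prodMk continuous_const)).tendsto 0).mono_left
        nhdsWithin_le_nhds
    refine tendsto_nhds_unique h1 (h2.congr' ?_)
    filter_upwards [self_mem_nhdsWithin] with ε hε
    have h3 : ε ^ N ≠ 0 := pow_ne_zero _ hε
    have e1 := hEq (ε, x)
    have e2 := hEq (ε, x + 1)
    have e3 : x + 1 + A ε = x + A ε + 1 := by ring
    have e4 : x + 1 + ψ (ε, x) = x + ψ (ε, x) + 1 := by ring
    simp only [conjDefect, h.periodic, e3, e4, hGl] at e1 e2
    refine mul_left_cancel₀ h3 ?_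
    linarith
  obtain ⟨g, a, hg, hgp, hga⟩ := hdio.exists_cohomological (g := fun x => E (0, x))
    (hE.comp (contDiff_const.prodMk contDiff_id)) hper
  obtain ⟨B, hB, hB0, hBeq⟩ := conjDefect_add (η := fun p => g p.2) (b := fun _ => a) hG h.contDiff
    (hg.comp contDiff_snd) h.contDiff_freq contDiff_const hG0 h.zero h.freq_zero hN
  obtain ⟨v, hv, hvE⟩ := exists_contDiff_eq_mul (u := fun p => E p + B p) (hE.add hB) fun x => by
    have := hga x
    simp only [hB0]
    linarith
  refine ⟨g, a, hg, hgp, ⟨h.contDiff.add ((contDiff_fst.pow N).mul (hg.comp contDiff_snd)),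
    h.contDiff_freq.add ((contDiff_id.pow N).mul contDiff_const), fun ε x => ?_, fun x => ?_, ?_,
    v, hv, fun p => ?_⟩⟩
  · simp only [h.periodic, hgp]
  · simp [h.zero, hN]
  · simp [h.freq_zero, hN]
  · have := hvE p.1 p.2
    simp only [Prod.mk.eta] at this
    rw [hBeq, hEq, pow_succ, mul_assoc, ← this]
    ring

/-- A smooth family through a Diophantine translation is smoothly linearizable up to a flat
error. -/
theorem exists_isApproxLinearization (hG : ContDiff ℝ (⊤ : ℕ∞) G)
    (hG0 : ∀ x, G (0, x) = x + ρ) (hGl : ∀ ε x, G (ε, x + 1) = G (ε, x) + 1)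
    (hdio : Diophantine ρ) :
    ∃ ψ A, ∀ N, IsApproxLinearization G ρ N ψ A := by
  have hstep : ∀ (N : ℕ) (s : {q : (ℝ × ℝ → ℝ) × (ℝ → ℝ) //
      IsApproxLinearization G ρ (N + 1) q.1 q.2}), ∃ (g : ℝ → ℝ) (a : ℝ),
      ContDiff ℝ (⊤ : ℕ∞) g ∧ (∀ x, g (x + 1) = g x) ∧
      IsApproxLinearization G ρ (N + 1 + 1) (fun p => s.1.1 p + p.1 ^ (N + 1) * g p.2)
        (fun ε => s.1.2 ε + ε ^ (N + 1) * a) :=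
    fun N s => s.2.exists_succ hG hG0 hGl hdio N.succ_ne_zero
  choose g a hg hgp hs using hstep
  let S : ∀ N : ℕ, {q : (ℝ × ℝ → ℝ) × (ℝ → ℝ) // IsApproxLinearization G ρ (N + 1) q.1 q.2} :=
    fun N => Nat.rec ⟨(fun _ => 0, fun _ => ρ), isApproxLinearization_one hG hG0⟩
      (fun N s => ⟨(_, _), hs N s⟩) N
  let γ : ℕ → ℝ → ℝ := fun N => g N (S N)
  let δ : ℕ → ℝ := fun N => a N (S N)
  have hS : ∀ N, (S N).1.1 = fun p => p.1 * ∑ j ∈ Finset.range N, p.1 ^ j * γ j p.2 := fun N => by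
    induction N with
    | zero =>
      ext p
      simp [S]
    | succ N ih =>
      have e : (S (N + 1)).1.1 = fun p => (S N).1.1 p + p.1 ^ (N + 1) * γ N p.2 := rfl
      rw [e, ih]
      ext p
      rw [Finset.sum_range_succ]
      ring
  have hT : ∀ N, (S N).1.2 = fun ε => ρ + ε * ∑ j ∈ Finset.range N, ε ^ j * δ j := fun N => by
    induction N with
    | zero =>
      ext p
      simp [S]
    | succ N ih =>
      have e : (S (N + 1)).1.2 = fun ε => (S N).1.2 ε + ε ^ (N + 1) * δ N := rfl
      rw [e, ih]
      ext p
      rw [Finset.sum_range_succ]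
      ring
  obtain ⟨ψ, hψ, hψp, hψη⟩ := exists_borel_sum (g := γ) (fun j => hg _ _) fun j => hgp _ _
  obtain ⟨A, hA, -, hAη⟩ := exists_borel_sum (g := fun j _ => δ j) (fun j => contDiff_const)
    fun j _ => rfl
  have hA' : ContDiff ℝ (⊤ : ℕ∞) fun ε => A (ε, 0) := hA.comp (contDiff_id.prodMk contDiff_const)
  refine ⟨fun p => p.1 * ψ p, fun ε => ρ + ε * A (ε, 0), fun N => ⟨contDiff_fst.mul hψ,
    contDiff_const.add (contDiff_id.mul hA'), fun ε x => by simp only [hψp], fun x => by simp,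
    by simp, ?_⟩⟩
  obtain ⟨η, hη, hηe⟩ := hψη N
  obtain ⟨b, hb, hbe⟩ := hAη N
  obtain ⟨E, hE, hEe⟩ := (S N).2.exists_eq
  obtain ⟨B, hB, -, hBe⟩ := conjDefect_add (η := η) (b := fun ε => b (ε, 0)) hG (S N).2.contDiff
    hη (S N).2.contDiff_freq (hb.comp (contDiff_id.prodMk contDiff_const)) hG0 (S N).2.zero
    (S N).2.freq_zero N.succ_ne_zero
  refine ⟨fun p => p.1 * (E p + B p), contDiff_fst.mul (hE.add hB), fun p => ?_⟩
  have e1 : (fun p : ℝ × ℝ => p.1 * ψ p) = fun p => (S N).1.1 p + p.1 ^ (N + 1) * η p := by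
    ext ⟨ε, x⟩
    rw [hS, hηe]
    ring
  have e2 : (fun ε => ρ + ε * A (ε, 0)) = fun ε => (S N).1.2 ε + ε ^ (N + 1) * b (ε, 0) := by
    ext ε
    rw [hT, hbe]
    ring
  rw [e1, e2, hBe, hEe, Nat.succ_eq_add_one]
  ring

end ApproxLinearization

theorem Diophantine.irrational {ρ : ℝ} (h : Diophantine ρ) : Irrational ρ := by
  obtain ⟨c, hc, β, hβ, hd⟩ := h
  rintro ⟨q, rfl⟩
  have h1 := hd q.num q.den q.den_pos
  have h2 : ((q : ℝ) - (q.num : ℝ) / (q.den : ℝ)) = 0 := by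
    rw [← Rat.cast_def, sub_self]
  have h3 : (0 : ℝ) < q.den := by exact_mod_cast q.den_pos
  rw [h2, abs_zero] at h1
  exact absurd h1 (not_le.2 (by positivity))

theorem exists_smooth_truncation {r : ℝ} (hr : 0 < r) :
    ∃ κ : ℝ → ℝ, ContDiff ℝ (⊤ : ℕ∞) κ ∧ (∀ ε, |κ ε| < r) ∧ ∃ d > 0, ∀ ε, |ε| < d → κ ε = ε := by
  let χ : ContDiffBump (0 : ℝ) := ⟨r / 3, r / 2, by linarith, by linarith⟩
  refine ⟨fun ε => ε * χ ε, contDiff_id.mul χ.contDiff, fun ε => ?_, r / 3, by linarith,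
    fun ε hε => ?_⟩
  · rw [abs_mul, abs_of_nonneg χ.nonneg]
    by_cases h : |ε| < r / 2
    · calc |ε| * χ ε ≤ |ε| * 1 := by
            gcongr
            exact χ.le_one
        _ < r := by linarith
    · have : χ ε = 0 := χ.zero_of_le_dist (by simpa [χ] using h)
      rw [this, mul_zero]
      exact hr
  · have : χ ε = 1 := χ.one_of_mem_closedBall (by simpa [χ] using hε.le)
    dsimp only
    rw [this, mul_one]

theorem exists_deriv_pos_of_periodic {ψ : ℝ × ℝ → ℝ} (hψ : ContDiff ℝ (⊤ : ℕ∞) ψ)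
    (hp : ∀ ε x, ψ (ε, x + 1) = ψ (ε, x)) (h0 : ∀ x, ψ (0, x) = 0) :
    ∃ r > 0, ∀ ε, |ε| < r → ∀ x, 0 < deriv (fun x => x + ψ (ε, x)) x := by
  have hd : ∀ ε x, deriv (fun x => x + ψ (ε, x)) x = 1 + iteratedDeriv 1 (fun x => ψ (ε, x)) x :=
    fun ε x => by
      rw [iteratedDeriv_one]
      exact ((hasDerivAt_id x).add (hasDerivAt_snd hψ ε x).differentiableAt.hasDerivAt).deriv
  have hc : Continuous fun p : ℝ × ℝ => 1 + iteratedDeriv 1 (fun x => ψ (p.1, x)) p.2 :=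
    continuous_const.add (contDiff_iteratedDeriv_snd hψ 1).continuous
  have h1 : ∀ᶠ ε in nhds (0 : ℝ), ∀ x ∈ Icc (0 : ℝ) 1,
      0 < 1 + iteratedDeriv 1 (fun x => ψ (ε, x)) x := by
    refine isCompact_Icc.eventually_forall_of_forall_eventually fun x _ => ?_
    refine hc.continuousAt.eventually (lt_mem_nhds ?_)
    simp [h0]
  obtain ⟨r, hr, h⟩ := Metric.eventually_nhds_iff.1 h1
  refine ⟨r, hr, fun ε hε x => ?_⟩
  have h2 := h (y := ε) (by simpa using hε) (Int.fract x)
    ⟨Int.fract_nonneg x, (Int.fract_lt_one x).le⟩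
  have h3 : Function.Periodic (iteratedDeriv 1 fun x => ψ (ε, x)) 1 :=
    iteratedDeriv_add_one (hp ε) 1
  have h4 := h3.sub_zsmul_eq (x := x) ⌊x⌋
  simp only [zsmul_eq_mul, mul_one] at h4
  rw [hd, ← h4]
  exact h2

theorem exists_bound_iteratedDeriv_snd {S : ℝ × ℝ → ℝ} (hS : ContDiff ℝ (⊤ : ℕ∞) S) (k : ℕ)
    (R : ℝ) : ∃ C, ∀ ε, |ε| ≤ R → ∀ x ∈ Icc (0 : ℝ) 1, |iteratedDeriv k (fun x => S (ε, x)) x| ≤ C := by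
  obtain ⟨C, hC⟩ := ((isCompact_Icc (a := -R) (b := R)).prod
    (isCompact_Icc (a := (0 : ℝ)) (b := 1))).bddAbove_image
      (contDiff_iteratedDeriv_snd hS k).continuous.abs.continuousOn
  exact ⟨C, fun ε hε x hx => hC ⟨(ε, x), ⟨abs_le.1 hε, hx⟩, rfl⟩⟩

/-- Approximate smooth linearization of a family of circle diffeomorphisms with
Diophantine rotation number at `ε = 0`. -/
theorem stmt_19 (F : ℝ × ℝ → ℝ)
    (hF : ContDiffOn ℝ (⊤ : ℕ∞) F (Ioo (-1 : ℝ) 1 ×ˢ (univ : Set ℝ)))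
    (hlift : ∀ ε ∈ Ioo (-1 : ℝ) 1, ∀ x : ℝ, F (ε, x + 1) = F (ε, x) + 1)
    (hpos : ∀ ε ∈ Ioo (-1 : ℝ) 1, ∀ x : ℝ, 0 < deriv (fun y => F (ε, y)) x)
    (ρ : ℝ)
    (hρ : Tendsto (fun n : ℕ => (fun x => F (0, x))^[n] 0 / (n : ℝ)) atTop (nhds ρ))
    (hdio : Diophantine ρ) :
    ∃ ε₀ ∈ Ioo (0 : ℝ) 1, ∃ Φ : ℝ × ℝ → ℝ, ∃ α : ℝ → ℝ, ∃ r : ℝ → ℝ → ℝ,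
      ContDiffOn ℝ (⊤ : ℕ∞) Φ (Ioo (-ε₀) ε₀ ×ˢ (univ : Set ℝ)) ∧
      (∀ ε ∈ Ioo (-ε₀) ε₀, ∀ x : ℝ, Φ (ε, x + 1) = Φ (ε, x) + 1) ∧
      (∀ ε ∈ Ioo (-ε₀) ε₀, ∀ x : ℝ, 0 < deriv (fun y => Φ (ε, y)) x) ∧
      ContDiffOn ℝ (⊤ : ℕ∞) α (Ioo (-ε₀) ε₀) ∧
      α 0 = ρ ∧
      -- definition of the remainder `r(ε,x) = Φ(ε,·)⁻¹(F(ε,Φ(ε,x))) − x − α(ε)`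
      (∀ ε ∈ Ioo (-ε₀) ε₀, ∀ x : ℝ,
        r ε x = Function.invFun (fun y => Φ (ε, y)) (F (ε, Φ (ε, x))) - x - α ε) ∧
      -- the remainder is smooth and 1-periodic in x
      (∀ ε ∈ Ioo (-ε₀) ε₀, ContDiff ℝ (⊤ : ℕ∞) (r ε)) ∧
      (∀ ε ∈ Ioo (-ε₀) ε₀, ∀ x : ℝ, r ε (x + 1) = r ε x) ∧
      -- all x-derivatives of the remainder are O(ε^∞)
      (∀ n k : ℕ, ∃ C : ℝ, ∀ ε ∈ Ioo (-ε₀) ε₀, ∀ x : ℝ,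
        |iteratedDeriv k (r ε) x| ≤ C * |ε| ^ n) := by
  obtain ⟨κ, hκ, hκ1, d, hd, hκd⟩ := exists_smooth_truncation one_pos
  have hFκ : ContDiff ℝ (⊤ : ℕ∞) fun p : ℝ × ℝ => F (κ p.1, p.2) := by
    rw [← contDiffOn_univ]
    exact hF.comp ((hκ.comp contDiff_fst).prodMk contDiff_snd).contDiffOn
      fun p _ => ⟨abs_lt.1 (hκ1 p.1), trivial⟩
  have hκ0 : κ 0 = 0 := hκd 0 (by simpa using hd)
  have h0 : (0 : ℝ) ∈ Ioo (-1 : ℝ) 1 := by norm_num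
  have hf : RotLift (fun x => F (0, x)) ρ :=
    { contDiff := by
        have := hFκ.comp (contDiff_const.prodMk contDiff_id : ContDiff ℝ (⊤ : ℕ∞)
          fun x : ℝ => ((0 : ℝ), x))
        simpa [Function.comp_def, hκ0] using this
      map_add_one := hlift 0 h0
      deriv_pos := hpos 0 h0
      tendsto := hρ
      irrational := hdio.irrational }
  obtain ⟨H, hH, hHF⟩ := hf.exists_conj hdio
  obtain ⟨K', hK', hKH', hHK'⟩ := exists_contDiff_inverse (u := fun p => H p.2)
    (hH.contDiff.comp contDiff_snd) fun _ => hH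
  obtain ⟨K, hKc, hKH, hHK⟩ : ∃ K : ℝ → ℝ, ContDiff ℝ (⊤ : ℕ∞) K ∧ (∀ x, K (H x) = x) ∧
      ∀ x, H (K x) = x :=
    ⟨fun x => K' (0, x), hK'.comp (contDiff_const.prodMk contDiff_id), hKH' 0, hHK' 0⟩
  have hK : SmoothLift K := by
    have hK1 : ∀ x, K (x + 1) = K x + 1 := fun x => by
      rw [← hKH (K x + 1), hH.map_add_one, hHK]
    refine ⟨hKc, hK1, fun x => ?_⟩
    have h1 := (hH.differentiable (K x)).hasDerivAt.comp x
      (hKc.differentiable (by simp) x).hasDerivAt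
    have h2 : H ∘ K = id := funext hHK
    rw [h2] at h1
    have h3 := h1.unique (hasDerivAt_id x)
    have h4 := hH.deriv_pos (K x)
    by_contra h5
    nlinarith
  obtain ⟨ψ, A, hψA⟩ := exists_isApproxLinearization
    (G := fun p => H (F (κ p.1, K p.2))) (ρ := ρ)
    (hH.contDiff.comp (hFκ.comp (contDiff_fst.prodMk (hKc.comp contDiff_snd))))
    (fun x => by simp only [hκ0, hHF, hHK])
    (fun ε x => by
      rw [hK.map_add_one, hlift _ (abs_lt.1 (hκ1 ε)), hH.map_add_one]) hdio
  have hψ := hψA 0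
  obtain ⟨s, hs, hψs⟩ := exists_deriv_pos_of_periodic hψ.contDiff hψ.periodic hψ.zero
  obtain ⟨κ', hκ', hκ's, d', hd', hκd'⟩ := exists_smooth_truncation hs
  let Ψ : ℝ × ℝ → ℝ := fun p => p.2 + ψ (κ' p.1, p.2)
  have hΨc : ContDiff ℝ (⊤ : ℕ∞) Ψ :=
    contDiff_snd.add (hψ.contDiff.comp ((hκ'.comp contDiff_fst).prodMk contDiff_snd))
  have hΨ : ∀ ε, SmoothLift fun x => Ψ (ε, x) := fun ε =>
    ⟨hΨc.comp (contDiff_const.prodMk contDiff_id), fun x => by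
      simp only [Ψ, hψ.periodic]
      ring, fun x => hψs _ (hκ's ε) x⟩
  obtain ⟨Θ, hΘ, hΘΨ, hΨΘ⟩ := exists_contDiff_inverse hΨc hΨ
  obtain ⟨ε₀, hε₀, hε₀1, hε₀d, hε₀d'⟩ : ∃ ε₀ : ℝ, 0 < ε₀ ∧ ε₀ < 1 ∧ ε₀ ≤ d ∧ ε₀ ≤ d' :=
    ⟨min (1 / 2) (min d d'), by positivity, (min_le_left _ _).trans_lt (by norm_num),
      (min_le_right _ _).trans (min_le_left _ _), (min_le_right _ _).trans (min_le_right _ _)⟩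
  have hmem : ∀ ε ∈ Ioo (-ε₀) ε₀, κ ε = ε ∧ κ' ε = ε ∧ ε ∈ Ioo (-1 : ℝ) 1 ∧ |ε| ≤ ε₀ :=
    fun ε hε => by
      have := abs_lt.2 hε
      exact ⟨hκd ε (by linarith), hκd' ε (by linarith), abs_lt.1 (by linarith), this.le⟩
  let Φ : ℝ × ℝ → ℝ := fun p => K (Ψ p)
  have hΦ : ∀ ε, SmoothLift fun x => Φ (ε, x) := fun ε => hK.comp (hΨ ε)
  let R : ℝ × ℝ → ℝ := fun p => Θ (p.1, H (F (κ p.1, K (Ψ p)))) - p.2 - A (κ' p.1)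
  have hR : ContDiff ℝ (⊤ : ℕ∞) R :=
    ((hΘ.comp (contDiff_fst.prodMk (hH.contDiff.comp (hFκ.comp (contDiff_fst.prodMk
      (hKc.comp hΨc)))))).sub contDiff_snd).sub
      (hψ.contDiff_freq.comp (hκ'.comp contDiff_fst))
  have hΘ1 : ∀ ε x, Θ (ε, x + 1) = Θ (ε, x) + 1 := fun ε x => by
    rw [← hΘΨ ε (Θ (ε, x) + 1), (hΨ ε).map_add_one, hΨΘ]
  have hRp : ∀ ε x, R (ε, x + 1) = R (ε, x) := fun ε x => by
    simp only [R]
    rw [(hΨ ε).map_add_one, hK.map_add_one, hlift _ (abs_lt.1 (hκ1 ε)), hH.map_add_one, hΘ1]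
    ring
  refine ⟨ε₀, ⟨hε₀, hε₀1⟩, Φ, fun ε => A (κ' ε), fun ε x => R (ε, x),
    (hKc.comp hΨc).contDiffOn, fun ε _ => (hΦ ε).map_add_one, fun ε _ => (hΦ ε).deriv_pos,
    (hψ.contDiff_freq.comp hκ').contDiffOn, ?_, fun ε hε x => ?_,
    fun ε _ => hR.comp (contDiff_const.prodMk contDiff_id), fun ε _ => hRp ε, fun n k => ?_⟩
  · dsimp only
    rw [hκd' 0 (by simpa using hd')]
    exact hψ.freq_zero
  · obtain ⟨e1, -, -, -⟩ := hmem ε hε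
    have h1 : Φ (ε, Θ (ε, H (F (ε, Φ (ε, x))))) = F (ε, Φ (ε, x)) := by
      change K (Ψ _) = _
      rw [hΨΘ, hKH]
    have h2 := Function.leftInverse_invFun (hΦ ε).strictMono.injective
      (Θ (ε, H (F (ε, Φ (ε, x)))))
    rw [h1] at h2
    rw [h2]
    simp only [R, e1]
    rfl
  · obtain ⟨E, hE, hEe⟩ := (hψA n).exists_eq
    let S : ℝ × ℝ → ℝ := fun p => E p * smoothQuotient Θ (0, 1)
      (p.1, Ψ (p.1, p.2 + A p.1)) (p.1 ^ n * E p)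
    have hS : ContDiff ℝ (⊤ : ℕ∞) S := hE.mul ((contDiff_smoothQuotient hΘ (0, 1)).comp
      ((contDiff_fst.prodMk (hΨc.comp (contDiff_fst.prodMk (contDiff_snd.add
        (hψ.contDiff_freq.comp contDiff_fst))))).prodMk ((contDiff_fst.pow n).mul hE)))
    have hRS : ∀ ε ∈ Ioo (-ε₀) ε₀, ∀ x, R (ε, x) = ε ^ n * S (ε, x) := fun ε hε x => by
      obtain ⟨e1, e2, -, -⟩ := hmem ε hε
      have h1 := hEe (ε, x)
      have h2 := mul_smoothQuotient hΘ (0, 1) (ε, Ψ (ε, x + A ε)) (ε ^ n * E (ε, x))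
      have h3 : H (F (κ ε, K (Ψ (ε, x)))) = Ψ (ε, x + A ε) + ε ^ n * E (ε, x) := by
        simp only [conjDefect] at h1
        simp only [Ψ, e2]
        linarith
      simp only [Prod.smul_mk, smul_eq_mul, mul_zero, mul_one, Prod.mk_add_mk, add_zero,
        hΘΨ] at h2
      simp only [R, S, h3, e2]
      linarith
    obtain ⟨C, hC⟩ := exists_bound_iteratedDeriv_snd hS k ε₀
    refine ⟨C, fun ε hε x => ?_⟩
    have h3 : Function.Periodic (iteratedDeriv k fun x => R (ε, x)) 1 :=
      iteratedDeriv_add_one (hRp ε) k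
    have h4 := h3.sub_zsmul_eq (x := x) ⌊x⌋
    simp only [zsmul_eq_mul, mul_one] at h4
    have h5 : (fun x => R (ε, x)) = fun x => ε ^ n * S (ε, x) := funext (hRS ε hε)
    change |iteratedDeriv k (fun x => R (ε, x)) x| ≤ _
    rw [← h4, h5, iteratedDeriv_const_mul_field, abs_mul, abs_pow, mul_comm]
    gcongr
    exact hC ε (hmem ε hε).2.2.2 _ ⟨Int.fract_nonneg x, (Int.fract_lt_one x).le⟩
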